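/- Let Ω ⊂ ℝ² be a bounded, simply connected open set with smooth boundary containing 0, let α > -1, p₀ > 1, and let K ∈ C¹(Ω̄) with K > 0 on Ω̄. Then there exists ρ₀ > 0, depending only on Ω, α, K and p₀, such that for every p ≥ p₀ and every solution u of the problem -Δu = |x|^{2α} K(x) u^{p} in Ω, u > 0 in Ω, u = 0 on ∂Ω, one has p ∫_Ω |x|^{2α} K(x) u(x)^{p+1} dx ≤ ρ₀. -/

import Mathlib

open MeasureTheory Real Set Metric

noncomputable section

abbrev Plane := EuclideanSpace ℝ (Fin 2)

/-- The Laplace operator on ℝ² (acting on real-valued functions). -/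
def lap (u : Plane → ℝ) (x : Plane) : ℝ :=
  ∑ i, fderiv ℝ (fun y => fderiv ℝ u y (EuclideanSpace.single i 1)) x
    (EuclideanSpace.single i 1)

/-- `Ω` has smooth boundary: near each boundary point, `Ω` is a sublevel set of a smooth
function with nonvanishing differential, whose zero set is the boundary. -/
def SmoothBoundary (Ω : Set Plane) : Prop :=
  ∀ x ∈ frontier Ω, ∃ (U : Set Plane) (f : Plane → ℝ),
    IsOpen U ∧ x ∈ U ∧ ContDiffOn ℝ (⊤ : ℕ∞) f U ∧
    (∀ y ∈ U, fderiv ℝ f y ≠ 0) ∧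
    Ω ∩ U = {y ∈ U | f y < 0} ∧ frontier Ω ∩ U = {y ∈ U | f y = 0}

namespace Henon

open Filter Topology
open scoped ContDiff

/-- First partial derivative of a real function on `ℂ`. -/
def dx (u : ℂ → ℝ) (z : ℂ) : ℝ := fderiv ℝ u z 1

/-- Second partial derivative of a real function on `ℂ`. -/
def dy (u : ℂ → ℝ) (z : ℂ) : ℝ := fderiv ℝ u z Complex.I

/-- The Laplacian of a real function on `ℂ`. -/
def lapC (u : ℂ → ℝ) (z : ℂ) : ℝ := dx (dx u) z + dy (dy u) z

lemma clm_apply (l : ℂ →L[ℝ] ℝ) (w : ℂ) : l w = w.re * l 1 + w.im * l Complex.I := by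
  conv_lhs => rw [← Complex.re_add_im w]
  have h1 : ((w.re : ℂ)) = w.re • (1 : ℂ) := by simp
  have h2 : ((w.im : ℂ)) * Complex.I = w.im • Complex.I := by simp
  rw [map_add, h2, h1, map_smul, map_smul, smul_eq_mul, smul_eq_mul]

lemma fderiv_eq (u : ℂ → ℝ) (z w : ℂ) : fderiv ℝ u z w = w.re * dx u z + w.im * dy u z :=
  clm_apply _ w

lemma contDiffAt_fderiv_apply {u : ℂ → ℝ} {z : ℂ} (h : ContDiffAt ℝ 2 u z) (w : ℂ) :
    ContDiffAt ℝ 1 (fun y => fderiv ℝ u y w) z :=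
  (h.fderiv_right (m := 1) (by norm_num)).clm_apply contDiffAt_const

lemma contDiffAt_dx {u : ℂ → ℝ} {z : ℂ} (h : ContDiffAt ℝ 2 u z) : ContDiffAt ℝ 1 (dx u) z :=
  contDiffAt_fderiv_apply h 1

lemma contDiffAt_dy {u : ℂ → ℝ} {z : ℂ} (h : ContDiffAt ℝ 2 u z) : ContDiffAt ℝ 1 (dy u) z :=
  contDiffAt_fderiv_apply h Complex.I

lemma differentiableAt_fderiv {u : ℂ → ℝ} {z : ℂ} (h : ContDiffAt ℝ 2 u z) :
    DifferentiableAt ℝ (fderiv ℝ u) z :=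
  (h.fderiv_right (m := 1) (by norm_num)).differentiableAt one_ne_zero

lemma differentiableAt_dx {u : ℂ → ℝ} {z : ℂ} (h : ContDiffAt ℝ 2 u z) :
    DifferentiableAt ℝ (dx u) z := (contDiffAt_dx h).differentiableAt one_ne_zero

lemma differentiableAt_dy {u : ℂ → ℝ} {z : ℂ} (h : ContDiffAt ℝ 2 u z) :
    DifferentiableAt ℝ (dy u) z := (contDiffAt_dy h).differentiableAt one_ne_zero

lemma fderiv_fderiv_apply {u : ℂ → ℝ} {z : ℂ} (h : ContDiffAt ℝ 2 u z) (w v : ℂ) :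
    fderiv ℝ (fun y => fderiv ℝ u y w) z v = fderiv ℝ (fderiv ℝ u) z v w := by
  rw [fderiv_clm_apply (differentiableAt_fderiv h) (differentiableAt_const w)]
  simp

lemma dy_dx_eq {u : ℂ → ℝ} {z : ℂ} (h : ContDiffAt ℝ 2 u z) : dy (dx u) z = dx (dy u) z := by
  have hs := h.isSymmSndFDerivAt (by simp)
  change fderiv ℝ (fun y => fderiv ℝ u y 1) z Complex.I
    = fderiv ℝ (fun y => fderiv ℝ u y Complex.I) z 1
  rw [fderiv_fderiv_apply h, fderiv_fderiv_apply h]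
  exact hs _ _

lemma eventually_contDiffAt {u : ℂ → ℝ} {z : ℂ} (h : ContDiffAt ℝ 2 u z) :
    ∀ᶠ y in 𝓝 z, ContDiffAt ℝ 2 u y := h.eventually (by simp)

lemma lapC_eq_sndFDeriv {u : ℂ → ℝ} {z : ℂ} (h : ContDiffAt ℝ 2 u z) :
    lapC u z = fderiv ℝ (fderiv ℝ u) z 1 1 + fderiv ℝ (fderiv ℝ u) z Complex.I Complex.I := by
  rw [← fderiv_fderiv_apply h, ← fderiv_fderiv_apply h]; rfl

lemma lapC_congr {u v : ℂ → ℝ} {z : ℂ} (h : u =ᶠ[𝓝 z] v) : lapC u z = lapC v z := by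
  have hx : dx u =ᶠ[𝓝 z] dx v := by
    filter_upwards [h.eventuallyEq_nhds] with y hy
    simp [dx, hy.fderiv_eq]
  have hy : dy u =ᶠ[𝓝 z] dy v := by
    filter_upwards [h.eventuallyEq_nhds] with y hy
    simp [dy, hy.fderiv_eq]
  simp only [lapC]
  rw [dx, dy, hx.fderiv_eq, hy.fderiv_eq]; rfl

lemma lapC_add {u v : ℂ → ℝ} {z : ℂ} (hu : ContDiffAt ℝ 2 u z) (hv : ContDiffAt ℝ 2 v z) :
    lapC (fun y => u y + v y) z = lapC u z + lapC v z := by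
  have huv : fderiv ℝ (fun y => u y + v y) =ᶠ[𝓝 z] fun y => fderiv ℝ u y + fderiv ℝ v y := by
    filter_upwards [eventually_contDiffAt hu, eventually_contDiffAt hv] with y h1 h2
    exact fderiv_fun_add (h1.differentiableAt two_ne_zero) (h2.differentiableAt two_ne_zero)
  rw [lapC_eq_sndFDeriv (hu.add hv), lapC_eq_sndFDeriv hu, lapC_eq_sndFDeriv hv, huv.fderiv_eq,
    fderiv_fun_add (differentiableAt_fderiv hu) (differentiableAt_fderiv hv)]
  simp only [add_apply]; ring

lemma lapC_const_mul {u : ℂ → ℝ} {z : ℂ} (hu : ContDiffAt ℝ 2 u z) (c : ℝ) :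
    lapC (fun y => c * u y) z = c * lapC u z := by
  have huv : fderiv ℝ (fun y => c * u y) =ᶠ[𝓝 z] fun y => c • fderiv ℝ u y := by
    filter_upwards [eventually_contDiffAt hu] with y h1
    exact fderiv_const_mul (h1.differentiableAt two_ne_zero) c
  rw [lapC_eq_sndFDeriv (contDiffAt_const.mul hu), lapC_eq_sndFDeriv hu, huv.fderiv_eq,
    fderiv_fun_const_smul (differentiableAt_fderiv hu)]
  simp only [smul_apply, smul_eq_mul]; ring

lemma lapC_sub {u v : ℂ → ℝ} {z : ℂ} (hu : ContDiffAt ℝ 2 u z) (hv : ContDiffAt ℝ 2 v z) :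
    lapC (fun y => u y - v y) z = lapC u z - lapC v z := by
  have h := lapC_add hu (contDiffAt_const.mul hv : ContDiffAt ℝ 2 (fun y => (-1 : ℝ) * v y) z)
  rw [lapC_const_mul hv] at h
  simpa [sub_eq_add_neg] using h

lemma lapC_const (c : ℝ) (z : ℂ) : lapC (fun _ => c) z = 0 := by
  simp [lapC_eq_sndFDeriv contDiffAt_const]

lemma deriv_deriv_nonneg_of_isLocalMin {g : ℝ → ℝ} {t : ℝ} (hg : ContinuousAt g t)
    (h : IsLocalMin g t) : 0 ≤ deriv (deriv g) t := by
  by_contra! hneg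
  have hmax := isLocalMax_of_deriv_deriv_neg hneg h.deriv_eq_zero hg
  have hc : g =ᶠ[𝓝 t] fun _ => g t := by
    filter_upwards [h, hmax] with y h1 h2 using le_antisymm h2 h1
  have h1 : deriv g =ᶠ[𝓝 t] fun _ => 0 := by
    filter_upwards [hc.eventuallyEq_nhds] with y hy
    simp [hy.deriv_eq]
  rw [h1.deriv_eq] at hneg
  simp at hneg

lemma sndFDeriv_nonneg_of_isLocalMin {u : ℂ → ℝ} {z : ℂ} (hu : ContDiffAt ℝ 2 u z)
    (h : IsLocalMin u z) (w : ℂ) : 0 ≤ fderiv ℝ (fderiv ℝ u) z w w := by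
  set ℓ : ℝ → ℂ := fun t => z + t • w with hℓ
  have hd : ∀ t, HasDerivAt ℓ w t := fun t => by
    have := ((hasDerivAt_id t).smul_const w).const_add z
    rwa [one_smul] at this
  have hz : ℓ 0 = z := by simp [hℓ]
  have hc : Tendsto ℓ (𝓝 0) (𝓝 z) := by
    have := (hd 0).continuousAt.tendsto; rwa [hz] at this
  have h1 : deriv (fun t => u (ℓ t)) =ᶠ[𝓝 0] fun t => fderiv ℝ u (ℓ t) w := by
    filter_upwards [hc.eventually (eventually_contDiffAt hu)] with t ht
    exact ((ht.differentiableAt two_ne_zero).hasFDerivAt.comp_hasDerivAt t (hd t)).deriv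
  have h2 : deriv (deriv (fun t => u (ℓ t))) 0 = fderiv ℝ (fderiv ℝ u) z w w := by
    rw [h1.deriv_eq, ← fderiv_fderiv_apply hu]
    have hda : DifferentiableAt ℝ (fun y => fderiv ℝ u y w) (ℓ 0) := by
      rw [hz]; exact (contDiffAt_fderiv_apply hu w).differentiableAt one_ne_zero
    have := (hda.hasFDerivAt.comp_hasDerivAt (0 : ℝ) (hd 0)).deriv
    rw [hz] at this
    exact this
  rw [← h2]
  apply deriv_deriv_nonneg_of_isLocalMin
  · apply ContinuousAt.comp (g := u) _ (hd 0).continuousAt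
    rw [hz]; exact hu.continuousAt
  · have := hc.eventually h
    rw [IsLocalMin, IsMinFilter, hz]; exact this

/-- The Laplacian is nonnegative at a local minimum. -/
lemma lapC_nonneg_of_isLocalMin {u : ℂ → ℝ} {z : ℂ} (hu : ContDiffAt ℝ 2 u z)
    (h : IsLocalMin u z) : 0 ≤ lapC u z := by
  rw [lapC_eq_sndFDeriv hu]
  exact add_nonneg (sndFDeriv_nonneg_of_isLocalMin hu h _) (sndFDeriv_nonneg_of_isLocalMin hu h _)

/-- Squared distance to `c`, written as a polynomial in coordinates. -/
def sqd (c z : ℂ) : ℝ := (z.re - c.re) ^ 2 + (z.im - c.im) ^ 2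

lemma sqd_eq (c z : ℂ) : sqd c z = ‖z - c‖ ^ 2 := by
  rw [sqd, ← Complex.normSq_eq_norm_sq, Complex.normSq_apply]; simp; ring

lemma sqd_nonneg (c z : ℂ) : 0 ≤ sqd c z := by rw [sqd_eq]; positivity

lemma contDiff_re {n : ℕ∞ω} : ContDiff ℝ n Complex.re := Complex.reCLM.contDiff
lemma contDiff_im {n : ℕ∞ω} : ContDiff ℝ n Complex.im := Complex.imCLM.contDiff

lemma contDiff_sqd (c : ℂ) {n : ℕ∞ω} : ContDiff ℝ n (sqd c) := by
  unfold sqd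
  exact ((contDiff_re.sub contDiff_const).pow 2).add ((contDiff_im.sub contDiff_const).pow 2)

lemma hasFDerivAt_sqd (c z : ℂ) : HasFDerivAt (sqd c)
    ((2 * (z.re - c.re)) • Complex.reCLM + (2 * (z.im - c.im)) • Complex.imCLM) z := by
  have h1 := (Complex.reCLM.hasFDerivAt (x := z)).sub_const c.re |>.pow 2
  have h2 := (Complex.imCLM.hasFDerivAt (x := z)).sub_const c.im |>.pow 2
  exact (h1.add h2).congr_fderiv (by ext; simp)

lemma hasFDerivAt_radial {ρ : ℝ → ℝ} {ρ' : ℝ} {c z : ℂ} (h : HasDerivAt ρ ρ' (sqd c z)) :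
    HasFDerivAt (fun y => ρ (sqd c y))
      (ρ' • ((2 * (z.re - c.re)) • Complex.reCLM + (2 * (z.im - c.im)) • Complex.imCLM)) z :=
  h.comp_hasFDerivAt z (hasFDerivAt_sqd c z)

lemma dx_radial {ρ : ℝ → ℝ} {ρ' : ℝ} {c z : ℂ} (h : HasDerivAt ρ ρ' (sqd c z)) :
    dx (fun y => ρ (sqd c y)) z = 2 * ρ' * (z.re - c.re) := by
  rw [dx, (hasFDerivAt_radial h).fderiv]; simp; ring

lemma dy_radial {ρ : ℝ → ℝ} {ρ' : ℝ} {c z : ℂ} (h : HasDerivAt ρ ρ' (sqd c z)) :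
    dy (fun y => ρ (sqd c y)) z = 2 * ρ' * (z.im - c.im) := by
  rw [dy, (hasFDerivAt_radial h).fderiv]; simp; ring

/-- Laplacian of a radial function. -/
lemma lapC_radial {ρ ρ' : ℝ → ℝ} {ρ'' : ℝ} {c z : ℂ}
    (h1 : ∀ᶠ s in 𝓝 (sqd c z), HasDerivAt ρ (ρ' s) s) (h2 : HasDerivAt ρ' ρ'' (sqd c z)) :
    lapC (fun y => ρ (sqd c y)) z = 4 * sqd c z * ρ'' + 4 * ρ' (sqd c z) := by
  have hev : ∀ᶠ y in 𝓝 z, HasDerivAt ρ (ρ' (sqd c y)) (sqd c y) :=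
    ((contDiff_sqd c (n := 0)).continuous.tendsto z).eventually h1
  have hx : dx (fun y => ρ (sqd c y)) =ᶠ[𝓝 z] fun y => 2 * ρ' (sqd c y) * (y.re - c.re) := by
    filter_upwards [hev] with y hy using dx_radial hy
  have hy : dy (fun y => ρ (sqd c y)) =ᶠ[𝓝 z] fun y => 2 * ρ' (sqd c y) * (y.im - c.im) := by
    filter_upwards [hev] with y hy using dy_radial hy
  have hr := (hasFDerivAt_radial h2).const_mul 2
  have h3 := hr.mul ((Complex.reCLM.hasFDerivAt (x := z)).sub_const c.re)
  have h4 := hr.mul ((Complex.imCLM.hasFDerivAt (x := z)).sub_const c.im)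
  simp only [lapC]
  rw [dx, dy, hx.fderiv_eq, hy.fderiv_eq]
  simp only [Complex.reCLM_apply, Complex.imCLM_apply] at h3 h4
  have e3 := h3.fderiv
  have e4 := h4.fderiv
  simp only [Pi.mul_def] at e3 e4
  erw [e3, e4]
  simp [sqd]; ring

/-- The Laplacian of the composition with a holomorphic map. -/
lemma lapC_comp_holomorphic {u : ℂ → ℝ} {φ : ℂ → ℂ} {z : ℂ} (hφ : AnalyticAt ℂ φ z)
    (hu : ContDiffAt ℝ 2 u (φ z)) :
    ContDiffAt ℝ 2 (fun y => u (φ y)) z ∧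
    (∀ w, fderiv ℝ (fun y => u (φ y)) z w = fderiv ℝ u (φ z) (deriv φ z * w)) ∧
    lapC (fun y => u (φ y)) z = ‖deriv φ z‖ ^ 2 * lapC u (φ z) := by
  have hφ2 : ContDiffAt ℝ 2 φ z := (hφ.contDiffAt (n := 2)).restrict_scalars ℝ
  have hcd : ContDiffAt ℝ 2 (fun y => u (φ y)) z := hu.comp z hφ2
  have key : ∀ᶠ y in 𝓝 z, ∀ w, fderiv ℝ (fun y => u (φ y)) y w
      = fderiv ℝ u (φ y) (deriv φ y * w) := by
    filter_upwards [hφ.eventually_analyticAt, hφ.continuousAt.eventually (eventually_contDiffAt hu)]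
      with y h1 h2 w
    have hd : HasFDerivAt φ ((ContinuousLinearMap.toSpanSingleton ℂ (deriv φ y)).restrictScalars ℝ)
      y := h1.differentiableAt.hasDerivAt.hasFDerivAt.restrictScalars ℝ
    have := ((h2.differentiableAt two_ne_zero).hasFDerivAt.comp y hd).fderiv
    simp only [Function.comp_def] at this
    rw [this]; simp [mul_comm]
  refine ⟨hcd, key.self_of_nhds, ?_⟩
  have hdφ : HasFDerivAt (deriv φ)
      ((ContinuousLinearMap.toSpanSingleton ℂ (deriv (deriv φ) z)).restrictScalars ℝ) z :=
    hφ.deriv.differentiableAt.hasDerivAt.hasFDerivAt.restrictScalars ℝ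
  have hdz : HasFDerivAt φ ((ContinuousLinearMap.toSpanSingleton ℂ (deriv φ z)).restrictScalars ℝ)
      z := hφ.differentiableAt.hasDerivAt.hasFDerivAt.restrictScalars ℝ
  have hDu : HasFDerivAt (fun y => fderiv ℝ u (φ y)) _ z :=
    HasFDerivAt.comp z (differentiableAt_fderiv hu).hasFDerivAt hdz
  have snd : ∀ w, fderiv ℝ (fderiv ℝ (fun y => u (φ y))) z w w
      = fderiv ℝ (fderiv ℝ u) (φ z) (deriv φ z * w) (deriv φ z * w)
        + fderiv ℝ u (φ z) (deriv (deriv φ) z * w * w) := by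
    intro w
    rw [← fderiv_fderiv_apply hcd]
    have e1 : (fun y => fderiv ℝ (fun y => u (φ y)) y w) =ᶠ[𝓝 z]
        fun y => fderiv ℝ u (φ y) (deriv φ y * w) := by
      filter_upwards [key] with y hy using hy w
    rw [e1.fderiv_eq, (hDu.clm_apply (hdφ.mul_const w)).fderiv]
    simp [mul_comm]; ring
  rw [lapC_eq_sndFDeriv hcd, lapC_eq_sndFDeriv hu, snd, snd]
  have hI : deriv (deriv φ) z * Complex.I * Complex.I = -(deriv (deriv φ) z * 1 * 1) := by
    rw [mul_assoc, Complex.I_mul_I]; ring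
  rw [hI, map_neg]
  set B := fderiv ℝ (fderiv ℝ u) (φ z) with hB
  have hsymm : ∀ a b, B a b = B b a := fun a b => hu.isSymmSndFDerivAt (by simp) a b
  set a := deriv φ z
  have e1 : a * 1 = a.re • (1 : ℂ) + a.im • Complex.I := by
    simp
  have e2 : a * Complex.I = (-a.im) • (1 : ℂ) + a.re • Complex.I := by
    apply Complex.ext <;> simp
  rw [e1, e2, ← Complex.normSq_eq_norm_sq, Complex.normSq_apply]
  simp only [map_add, map_smul, add_apply, smul_apply, smul_eq_mul]
  rw [hsymm Complex.I 1]
  ring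

/-- Gluing: a function that is smooth near its support is smooth. -/
lemma contDiff_of_contDiffAt_tsupport {P : ℂ → ℝ} {n : ℕ∞ω}
    (h : ∀ z ∈ tsupport P, ContDiffAt ℝ n P z) : ContDiff ℝ n P := by
  rw [contDiff_iff_contDiffAt]
  intro z
  by_cases hz : z ∈ tsupport P
  · exact h z hz
  · have : P =ᶠ[𝓝 z] fun _ => 0 := notMem_tsupport_iff_eventuallyEq.mp hz
    exact contDiffAt_const.congr_of_eventuallyEq this

lemma integral_fderiv_eq_zero {P : ℂ → ℝ} (hP : ContDiff ℝ 1 P) (hc : HasCompactSupport P)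
    (w : ℂ) : ∫ z, fderiv ℝ P z w = 0 := by
  have hcont : Continuous (fun z => fderiv ℝ P z w) :=
    (hP.continuous_fderiv one_ne_zero).clm_apply continuous_const
  have h := integral_mul_fderiv_eq_neg_fderiv_mul_of_integrable (μ := (volume : Measure ℂ))
    (f := fun _ : ℂ => (1 : ℝ)) (g := P) (v := w) (by simp)
    (by simpa using hcont.integrable_of_hasCompactSupport (hc.fderiv_apply (𝕜 := ℝ) w))
    (by simpa using hP.continuous.integrable_of_hasCompactSupport hc)
    (by simp) (fun x _ => hP.differentiable one_ne_zero x)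
  simpa using h

lemma integrable_fderiv {P : ℂ → ℝ} (hP : ContDiff ℝ 1 P) (hc : HasCompactSupport P)
    (w : ℂ) : Integrable (fun z => fderiv ℝ P z w) := by
  have hcont : Continuous (fun z => fderiv ℝ P z w) :=
    (hP.continuous_fderiv one_ne_zero).clm_apply continuous_const
  exact hcont.integrable_of_hasCompactSupport (hc.fderiv_apply (𝕜 := ℝ) w)

/-- Divergence theorem for compactly supported fields. -/
lemma integral_div_eq_zero {P Q : ℂ → ℝ} (hP : ∀ z ∈ tsupport P, ContDiffAt ℝ 1 P z)
    (hQ : ∀ z ∈ tsupport Q, ContDiffAt ℝ 1 Q z) (hPc : HasCompactSupport P)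
    (hQc : HasCompactSupport Q) :
    Integrable (fun z => dx P z + dy Q z) ∧ ∫ z, (dx P z + dy Q z) = 0 := by
  have hP' := contDiff_of_contDiffAt_tsupport hP
  have hQ' := contDiff_of_contDiffAt_tsupport hQ
  refine ⟨(integrable_fderiv hP' hPc 1).add (integrable_fderiv hQ' hQc Complex.I), ?_⟩
  simp only [dx, dy]
  rw [integral_add (integrable_fderiv hP' hPc 1) (integrable_fderiv hQ' hQc Complex.I)]
  rw [integral_fderiv_eq_zero hP' hPc, integral_fderiv_eq_zero hQ' hQc, add_zero]

lemma dx_mul {u v : ℂ → ℝ} {z : ℂ} (hu : DifferentiableAt ℝ u z) (hv : DifferentiableAt ℝ v z) :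
    dx (fun y => u y * v y) z = u z * dx v z + v z * dx u z := by
  simp only [dx]; rw [fderiv_fun_mul hu hv]; simp

lemma dy_mul {u v : ℂ → ℝ} {z : ℂ} (hu : DifferentiableAt ℝ u z) (hv : DifferentiableAt ℝ v z) :
    dy (fun y => u y * v y) z = u z * dy v z + v z * dy u z := by
  simp only [dy]; rw [fderiv_fun_mul hu hv]; simp

lemma dx_add {u v : ℂ → ℝ} {z : ℂ} (hu : DifferentiableAt ℝ u z) (hv : DifferentiableAt ℝ v z) :
    dx (fun y => u y + v y) z = dx u z + dx v z := by
  simp only [dx]; rw [fderiv_fun_add hu hv]; simp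

lemma dy_add {u v : ℂ → ℝ} {z : ℂ} (hu : DifferentiableAt ℝ u z) (hv : DifferentiableAt ℝ v z) :
    dy (fun y => u y + v y) z = dy u z + dy v z := by
  simp only [dy]; rw [fderiv_fun_add hu hv]; simp

lemma dx_sub {u v : ℂ → ℝ} {z : ℂ} (hu : DifferentiableAt ℝ u z) (hv : DifferentiableAt ℝ v z) :
    dx (fun y => u y - v y) z = dx u z - dx v z := by
  simp only [dx]; rw [fderiv_fun_sub hu hv]; simp

lemma dy_sub {u v : ℂ → ℝ} {z : ℂ} (hu : DifferentiableAt ℝ u z) (hv : DifferentiableAt ℝ v z) :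
    dy (fun y => u y - v y) z = dy u z - dy v z := by
  simp only [dy]; rw [fderiv_fun_sub hu hv]; simp

/-- Points outside the support have vanishing derivatives. -/
lemma eventuallyEq_zero_of_notMem_tsupport {η : ℂ → ℝ} {z : ℂ} (h : z ∉ tsupport η) :
    η =ᶠ[𝓝 z] fun _ => 0 := notMem_tsupport_iff_eventuallyEq.mp h

lemma lapC_eq_zero_of_notMem_tsupport {η : ℂ → ℝ} {z : ℂ} (h : z ∉ tsupport η) :
    lapC η z = 0 := by
  rw [lapC_congr (eventuallyEq_zero_of_notMem_tsupport h), lapC_const]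

lemma tsupport_mul_subset_left' (f g : ℂ → ℝ) : tsupport (fun z => f z * g z) ⊆ tsupport f :=
  tsupport_mul_subset_left

lemma tsupport_mul_subset_right' (f g : ℂ → ℝ) : tsupport (fun z => f z * g z) ⊆ tsupport g :=
  tsupport_mul_subset_right

lemma lapC_mul {u v : ℂ → ℝ} {z : ℂ} (hu : ContDiffAt ℝ 2 u z) (hv : ContDiffAt ℝ 2 v z) :
    lapC (fun y => u y * v y) z
      = u z * lapC v z + v z * lapC u z + 2 * (dx u z * dx v z + dy u z * dy v z) := by
  have hx : dx (fun y => u y * v y) =ᶠ[𝓝 z] fun y => u y * dx v y + v y * dx u y := by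
    filter_upwards [eventually_contDiffAt hu, eventually_contDiffAt hv] with y h1 h2
    exact dx_mul (h1.differentiableAt two_ne_zero) (h2.differentiableAt two_ne_zero)
  have hy : dy (fun y => u y * v y) =ᶠ[𝓝 z] fun y => u y * dy v y + v y * dy u y := by
    filter_upwards [eventually_contDiffAt hu, eventually_contDiffAt hv] with y h1 h2
    exact dy_mul (h1.differentiableAt two_ne_zero) (h2.differentiableAt two_ne_zero)
  have du := hu.differentiableAt two_ne_zero
  have dv := hv.differentiableAt two_ne_zero
  have ex : dx (dx (fun y => u y * v y)) z = dx (fun y => u y * dx v y + v y * dx u y) z := by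
    rw [dx, hx.fderiv_eq]; rfl
  have ey : dy (dy (fun y => u y * v y)) z = dy (fun y => u y * dy v y + v y * dy u y) z := by
    rw [dy, hy.fderiv_eq]; rfl
  simp only [lapC]
  rw [ex, ey, dx_add (du.fun_mul (differentiableAt_dx hv)) (dv.fun_mul (differentiableAt_dx hu)),
    dy_add (du.fun_mul (differentiableAt_dy hv)) (dv.fun_mul (differentiableAt_dy hu)),
    dx_mul du (differentiableAt_dx hv), dx_mul dv (differentiableAt_dx hu),
    dy_mul du (differentiableAt_dy hv), dy_mul dv (differentiableAt_dy hu)]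
  ring

/-- Green's second identity against a compactly supported function. -/
lemma integral_green {u η : ℂ → ℝ} (hη : ContDiff ℝ 2 η) (hc : HasCompactSupport η)
    (hu : ∀ z ∈ tsupport η, ContDiffAt ℝ 2 u z) :
    Integrable (fun z => η z * lapC u z - u z * lapC η z) ∧
    ∫ z, (η z * lapC u z - u z * lapC η z) = 0 := by
  have hdx0 : ∀ z, z ∉ tsupport η → dx η z = 0 := fun z hz => by
    rw [dx, (eventuallyEq_zero_of_notMem_tsupport hz).fderiv_eq]; simp
  have hdy0 : ∀ z, z ∉ tsupport η → dy η z = 0 := fun z hz => by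
    rw [dy, (eventuallyEq_zero_of_notMem_tsupport hz).fderiv_eq]; simp
  set P : ℂ → ℝ := fun z => η z * dx u z - u z * dx η z with hP
  set Q : ℂ → ℝ := fun z => η z * dy u z - u z * dy η z with hQ
  have sP : tsupport P ⊆ tsupport η := closure_minimal (fun z hz => by
    by_contra h
    exact hz (by simp [hP, hdx0 z h, image_eq_zero_of_notMem_tsupport h])) (isClosed_tsupport _)
  have sQ : tsupport Q ⊆ tsupport η := closure_minimal (fun z hz => by
    by_contra h
    exact hz (by simp [hQ, hdy0 z h, image_eq_zero_of_notMem_tsupport h])) (isClosed_tsupport _)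
  have h := integral_div_eq_zero (P := P) (Q := Q)
    (fun z hz => by
      have h1 := hu z (sP hz)
      exact ((hη.contDiffAt.of_le (by norm_num)).mul (contDiffAt_dx h1)).sub
        ((h1.of_le (by norm_num)).mul (contDiffAt_dx hη.contDiffAt)))
    (fun z hz => by
      have h1 := hu z (sQ hz)
      exact ((hη.contDiffAt.of_le (by norm_num)).mul (contDiffAt_dy h1)).sub
        ((h1.of_le (by norm_num)).mul (contDiffAt_dy hη.contDiffAt)))
    (HasCompactSupport.of_support_subset_isCompact hc (subset_closure.trans sP))
    (HasCompactSupport.of_support_subset_isCompact hc (subset_closure.trans sQ))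
  have key : (fun z => dx P z + dy Q z) = fun z => η z * lapC u z - u z * lapC η z := by
    ext z
    by_cases hz : z ∈ tsupport η
    · have h1 := hu z hz
      have h2 : ContDiffAt ℝ 2 η z := hη.contDiffAt
      have du := h1.differentiableAt two_ne_zero
      have dη := h2.differentiableAt two_ne_zero
      rw [hP, hQ, dx_sub (dη.fun_mul (differentiableAt_dx h1)) (du.fun_mul (differentiableAt_dx h2)),
        dy_sub (dη.fun_mul (differentiableAt_dy h1)) (du.fun_mul (differentiableAt_dy h2)),
        dx_mul dη (differentiableAt_dx h1), dx_mul du (differentiableAt_dx h2),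
        dy_mul dη (differentiableAt_dy h1), dy_mul du (differentiableAt_dy h2)]
      simp only [lapC]; ring
    · have e1 : dx P z = 0 := by
        rw [dx, (eventuallyEq_zero_of_notMem_tsupport (fun h => hz (sP h))).fderiv_eq]; simp
      have e2 : dy Q z = 0 := by
        rw [dy, (eventuallyEq_zero_of_notMem_tsupport (fun h => hz (sQ h))).fderiv_eq]; simp
      rw [e1, e2, image_eq_zero_of_notMem_tsupport hz, lapC_eq_zero_of_notMem_tsupport hz]; ring
  rwa [key] at h

lemma lapC_comp_conj {u : ℂ → ℝ} {z : ℂ} (hu : ContDiffAt ℝ 2 u ((starRingEnd ℂ) z)) :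
    ContDiffAt ℝ 2 (fun y => u ((starRingEnd ℂ) y)) z ∧
    lapC (fun y => u ((starRingEnd ℂ) y)) z = lapC u ((starRingEnd ℂ) z) := by
  have hcj : ContDiff ℝ 2 (fun y : ℂ => (starRingEnd ℂ) y) := Complex.conjCLE.contDiff
  have hcd : ContDiffAt ℝ 2 (fun y => u ((starRingEnd ℂ) y)) z :=
    ContDiffAt.comp z hu hcj.contDiffAt
  have hfd : ∀ (v : ℂ → ℝ) (y w : ℂ), fderiv ℝ (fun y => v ((starRingEnd ℂ) y)) y w
      = fderiv ℝ v ((starRingEnd ℂ) y) ((starRingEnd ℂ) w) := by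
    intro v y w
    have := Complex.conjCLE.comp_right_fderiv (f := v) (x := y)
    have h2 := congrArg (fun l => l w) this
    simpa [Function.comp_def] using h2
  refine ⟨hcd, ?_⟩
  have ex : dx (fun y => u ((starRingEnd ℂ) y)) = fun y => dx u ((starRingEnd ℂ) y) := by
    ext y; simp only [dx]; rw [hfd]; simp
  have ey : dy (fun y => u ((starRingEnd ℂ) y)) = fun y => - dy u ((starRingEnd ℂ) y) := by
    ext y; simp only [dy]; rw [hfd]; simp
  have e3 : dy (fun y => - dy u ((starRingEnd ℂ) y)) z = - dy (fun y => dy u ((starRingEnd ℂ) y)) z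
    := by simp only [dy]; rw [fderiv_fun_neg]; simp
  rw [lapC, ex, ey, e3, lapC]
  have e4 : dx (fun y => dx u ((starRingEnd ℂ) y)) z = dx (dx u) ((starRingEnd ℂ) z) := by
    rw [dx, hfd]; simp [dx]
  have e5 : dy (fun y => dy u ((starRingEnd ℂ) y)) z = - dy (dy u) ((starRingEnd ℂ) z) := by
    rw [dy, hfd]; simp [dy]
  rw [e4, e5, neg_neg]

lemma mem_ball_iff_sqd {c z : ℂ} {r : ℝ} (hr : 0 < r) : z ∈ ball c r ↔ sqd c z < r ^ 2 := by
  rw [sqd_eq, mem_ball, dist_eq_norm, sq_lt_sq₀ (norm_nonneg _) hr.le]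

lemma mem_closedBall_iff_sqd {c z : ℂ} {r : ℝ} (hr : 0 < r) :
    z ∈ closedBall c r ↔ sqd c z ≤ r ^ 2 := by
  rw [sqd_eq, mem_closedBall, dist_eq_norm, sq_le_sq₀ (norm_nonneg _) hr.le]

lemma lapC_sq_radial (c z : ℂ) (a : ℝ) :
    lapC (fun y => (a - sqd c y) ^ 2) z = 16 * sqd c z - 8 * a := by
  have h1 : ∀ s, HasDerivAt (fun s : ℝ => (a - s) ^ 2) (-2 * (a - s)) s := fun s => by
    exact (((hasDerivAt_id s).const_sub a).fun_pow 2).congr_deriv (by simp)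
  have h2 : HasDerivAt (fun s : ℝ => -2 * (a - s)) 2 (sqd c z) := by
    exact (((hasDerivAt_id (sqd c z)).const_sub a).const_mul (-2)).congr_deriv (by simp)
  rw [lapC_radial (ρ := fun s => (a - s) ^ 2) (Eventually.of_forall h1) h2]; ring

/-- A positive supersolution of `-Δu ≥ w u ^ p` on a disc cannot be large. -/
lemma supersolution_bound {u : ℂ → ℝ} {x : ℂ} {r w A p : ℝ} (hr : 0 < r) (hA : 0 < A)
    (hw : 0 ≤ w) (hp : 1 ≤ p) (hc : ContinuousOn u (closedBall x r))
    (hd : ∀ z ∈ ball x r, ContDiffAt ℝ 2 u z) (hge : ∀ z ∈ closedBall x r, A ≤ u z)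
    (heq : ∀ z ∈ ball x r, w * u z ^ p ≤ -lapC u z) : w * A ^ (p - 1) * r ^ 2 ≤ 32 := by
  set b : ℂ → ℝ := fun z => (r ^ 2 - sqd x z) ^ 2 with hb
  have hbc : ContDiff ℝ 2 b := (contDiff_const.sub (contDiff_sqd x)).pow 2
  have hpos : ∀ z ∈ closedBall x r, 0 < u z := fun z hz => hA.trans_le (hge z hz)
  obtain ⟨x1, hx1, hmax⟩ := (isCompact_closedBall x r).exists_isMaxOn
    ⟨x, mem_closedBall_self hr.le⟩ (f := fun z => b z / u z)
    (hbc.continuous.continuousOn.div hc (fun z hz => (hpos z hz).ne'))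
  have hb0 : 0 < b x := by simp [hb, sqd]; positivity
  have hq : 0 < b x1 / u x1 :=
    (div_pos hb0 (hpos x (mem_closedBall_self hr.le))).trans_le
      (hmax (mem_closedBall_self hr.le))
  have hu1 := hpos x1 hx1
  have hb1 : 0 < b x1 := by
    by_contra h
    exact absurd hq (not_lt.mpr (div_nonpos_of_nonpos_of_nonneg (not_lt.mp h) hu1.le))
  have hx1b : x1 ∈ ball x r := by
    rw [mem_ball_iff_sqd hr]
    rcases lt_or_eq_of_le ((mem_closedBall_iff_sqd hr).mp hx1) with h | h
    · exact h
    · simp [hb, h] at hb1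
  set τ := u x1 / b x1 with hτ
  have hτ0 : 0 < τ := div_pos hu1 hb1
  have hmin : IsLocalMin (fun z => u z - τ * b z) x1 := by
    filter_upwards [isOpen_ball.mem_nhds hx1b] with z hz
    have h1 := hmax (ball_subset_closedBall hz)
    have h2 := hpos z (ball_subset_closedBall hz)
    simp only [mem_ofPred_eq] at h1
    rw [div_le_div_iff₀ h2 hu1] at h1
    have e : u x1 - τ * b x1 = 0 := by rw [hτ]; field_simp; ring
    rw [e, hτ, sub_nonneg, div_mul_eq_mul_div, div_le_iff₀ hb1]
    linarith
  have hlap := lapC_nonneg_of_isLocalMin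
    ((hd x1 hx1b).sub (contDiffAt_const.mul hbc.contDiffAt)) hmin
  rw [lapC_sub (hd x1 hx1b) (contDiffAt_const.mul hbc.contDiffAt),
    lapC_const_mul hbc.contDiffAt, hb, lapC_sq_radial] at hlap
  have h3 := heq x1 hx1b
  have h4 : u x1 ^ p = u x1 ^ (p - 1) * u x1 := by
    rw [← Real.rpow_add_one hu1.ne']; ring_nf
  have h5 : A ^ (p - 1) ≤ u x1 ^ (p - 1) :=
    Real.rpow_le_rpow hA.le (hge x1 hx1) (by linarith)
  have hu1' : u x1 = τ * b x1 := by rw [hτ]; field_simp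
  set s := sqd x x1 with hs
  have hs0 : 0 ≤ s := sqd_nonneg _ _
  have h6 : w * A ^ (p - 1) * (τ * b x1) ≤ τ * (8 * r ^ 2 - 16 * s) := by
    have : w * A ^ (p - 1) * u x1 ≤ w * (u x1 ^ (p - 1) * u x1) := by
      rw [mul_assoc]; gcongr
    rw [h4] at h3
    rw [← hu1']
    linarith
  have h7 : w * A ^ (p - 1) * b x1 ≤ 8 * r ^ 2 - 16 * s := by
    have : τ * (w * A ^ (p - 1) * b x1) ≤ τ * (8 * r ^ 2 - 16 * s) := by linarith
    exact le_of_mul_le_mul_left this hτ0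
  have h8 : 0 ≤ w * A ^ (p - 1) := by positivity
  set W := w * A ^ (p - 1)
  have h9 : b x1 = (r ^ 2 - s) ^ 2 := rfl
  rw [h9] at h7
  have hrs : 0 ≤ 8 * r ^ 2 - 16 * s := le_trans (by positivity) h7
  have h10 : W * (r ^ 2 / 2) ^ 2 ≤ W * (r ^ 2 - s) ^ 2 := by
    gcongr
    linarith
  have h11 : W * r ^ 2 * r ^ 2 ≤ 32 * r ^ 2 := by nlinarith
  exact le_of_mul_le_mul_right h11 (by positivity)

lemma deriv_smoothTransition_zero {x : ℝ} (h : x < 0 ∨ 1 < x) :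
    smoothTransition =ᶠ[𝓝 x] fun _ => smoothTransition x := by
  rcases h with h | h
  · filter_upwards [gt_mem_nhds h] with y hy
    rw [smoothTransition.zero_of_nonpos hy.le, smoothTransition.zero_of_nonpos h.le]
  · filter_upwards [lt_mem_nhds h] with y hy
    rw [smoothTransition.one_of_one_le hy.le, smoothTransition.one_of_one_le h.le]

lemma hasCompactSupport_deriv_smoothTransition : HasCompactSupport (deriv smoothTransition) := by
  refine HasCompactSupport.of_support_subset_isCompact (isCompact_Icc (a := (0 : ℝ)) (b := 1)) ?_
  intro x hx
  by_contra h
  apply hx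
  rw [(deriv_smoothTransition_zero (x := x) (by
    by_contra! h'; exact h ⟨h'.1, h'.2⟩)).deriv_eq]
  simp

lemma exists_bound_smoothTransition : ∃ C > 0, ∀ x, |deriv smoothTransition x| ≤ C ∧
    |deriv (deriv smoothTransition) x| ≤ C := by
  have hc : ContDiff ℝ 2 smoothTransition := smoothTransition.contDiff
  have hc1 : ContDiff ℝ 1 (deriv smoothTransition) := hc.deriv'
  obtain ⟨C1, h1⟩ := hasCompactSupport_deriv_smoothTransition.exists_bound_of_continuous
    hc1.continuous
  obtain ⟨C2, h2⟩ := hasCompactSupport_deriv_smoothTransition.deriv.exists_bound_of_continuous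
    (hc1.continuous_deriv le_rfl)
  refine ⟨max (max C1 C2) 1, by positivity, fun x => ⟨(h1 x).trans ?_, (h2 x).trans ?_⟩⟩ <;> simp

/-- Smooth radial cutoff vanishing near the origin. -/
def cutρ (ε s : ℝ) : ℝ := smoothTransition (s / ε ^ 2 - 1)

lemma contDiff_cutρ (ε : ℝ) {n : ℕ∞} : ContDiff ℝ n (cutρ ε) :=
  smoothTransition.contDiff.comp ((contDiff_id.div_const _).sub contDiff_const)

lemma hasDerivAt_cutρ (ε s : ℝ) :
    HasDerivAt (cutρ ε) (deriv smoothTransition (s / ε ^ 2 - 1) / ε ^ 2) s := by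
  have h1 : HasDerivAt smoothTransition (deriv smoothTransition (s / ε ^ 2 - 1)) (s / ε ^ 2 - 1) :=
    (smoothTransition.contDiff.differentiable (n := 1) one_ne_zero _).hasDerivAt
  have h2 : HasDerivAt (fun s : ℝ => s / ε ^ 2 - 1) (1 / ε ^ 2) s :=
    ((hasDerivAt_id s).div_const _).sub_const 1
  exact (h1.comp s h2).congr_deriv (by ring)

lemma hasDerivAt_deriv_cutρ (ε s : ℝ) :
    HasDerivAt (fun s => deriv smoothTransition (s / ε ^ 2 - 1) / ε ^ 2)
      (deriv (deriv smoothTransition) (s / ε ^ 2 - 1) / ε ^ 2 / ε ^ 2) s := by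
  have hc : ContDiff ℝ 2 smoothTransition := smoothTransition.contDiff
  have hc1 : ContDiff ℝ 1 (deriv smoothTransition) := hc.deriv'
  have h1 : HasDerivAt (deriv smoothTransition)
      (deriv (deriv smoothTransition) (s / ε ^ 2 - 1)) (s / ε ^ 2 - 1) :=
    (hc1.differentiable one_ne_zero _).hasDerivAt
  have h2 : HasDerivAt (fun s : ℝ => s / ε ^ 2 - 1) (1 / ε ^ 2) s :=
    ((hasDerivAt_id s).div_const _).sub_const 1
  exact ((h1.comp s h2).div_const (ε ^ 2)).congr_deriv (by ring)

/-- The cutoff as a function on the plane. -/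
def cut (ε : ℝ) (z : ℂ) : ℝ := cutρ ε (sqd 0 z)

lemma contDiff_cut (ε : ℝ) {n : ℕ∞} : ContDiff ℝ n (cut ε) :=
  (contDiff_cutρ ε).comp (contDiff_sqd 0)

lemma cut_nonneg (ε : ℝ) (z : ℂ) : 0 ≤ cut ε z := smoothTransition.nonneg _
lemma cut_le_one (ε : ℝ) (z : ℂ) : cut ε z ≤ 1 := smoothTransition.le_one _

lemma cut_eq_zero {ε : ℝ} (hε : 0 < ε) {z : ℂ} (h : z ∈ closedBall 0 ε) : cut ε z = 0 := by
  rw [mem_closedBall_iff_sqd hε] at h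
  apply smoothTransition.zero_of_nonpos
  rw [sub_nonpos, div_le_one (by positivity)]; exact h

lemma cut_eq_one {ε : ℝ} (hε : 0 < ε) {z : ℂ} (h : z ∉ ball 0 (2 * ε)) : cut ε z = 1 := by
  rw [mem_ball_iff_sqd (by positivity)] at h
  apply smoothTransition.one_of_one_le
  rw [le_sub_iff_add_le, le_div_iff₀ (by positivity)]; nlinarith [sq_nonneg ε]

lemma cut_eventually_one {ε : ℝ} (hε : 0 < ε) {z : ℂ} (h : z ∉ ball 0 (2 * ε)) :
    cut ε =ᶠ[𝓝 z] fun _ => 1 := by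
  have h1 : 2 * ε ^ 2 < sqd 0 z := by
    rw [mem_ball_iff_sqd (by positivity)] at h; nlinarith [sq_pos_of_pos hε]
  filter_upwards [((contDiff_sqd 0 (n := 0)).continuous.tendsto z).eventually (lt_mem_nhds h1)]
    with y hy
  apply smoothTransition.one_of_one_le
  rw [le_sub_iff_add_le, le_div_iff₀ (by positivity)]; nlinarith

lemma tendsto_cut {z : ℂ} (hz : z ≠ 0) : ∀ᶠ ε in 𝓝[>] (0 : ℝ), cut ε z = 1 := by
  have : ∀ᶠ ε in 𝓝[>] (0 : ℝ), ε < ‖z‖ / 2 :=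
    (gt_mem_nhds (by positivity)).filter_mono nhdsWithin_le_nhds
  filter_upwards [this, self_mem_nhdsWithin] with ε h1 h2
  apply cut_eq_one h2
  simp; linarith

lemma notMem_tsupport_cut {ε : ℝ} (hε : 0 < ε) : (0 : ℂ) ∉ tsupport (cut ε) := by
  rw [notMem_tsupport_iff_eventuallyEq]
  filter_upwards [closedBall_mem_nhds (0 : ℂ) hε] with y hy using cut_eq_zero hε hy

/-- Derivative bounds for the cutoff. -/
lemma exists_cut_bounds : ∃ C > 0, ∀ ε > 0, ∀ z : ℂ,
    |deriv smoothTransition (sqd 0 z / ε ^ 2 - 1) / ε ^ 2| ≤ C / ε ^ 2 ∧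
    |dx (cut ε) z| ≤ C / ε ∧ |dy (cut ε) z| ≤ C / ε ∧ |lapC (cut ε) z| ≤ C / ε ^ 2 := by
  obtain ⟨C, hC, hb⟩ := exists_bound_smoothTransition
  refine ⟨12 * C, by positivity, fun ε hε z => ?_⟩
  have hρ : |deriv smoothTransition (sqd 0 z / ε ^ 2 - 1) / ε ^ 2| ≤ C / ε ^ 2 := by
    rw [abs_div, abs_of_pos (pow_pos hε 2)]
    exact div_le_div_of_nonneg_right (hb _).1 (by positivity)
  have hle : C / ε ^ 2 ≤ 12 * C / ε ^ 2 := by gcongr; linarith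
  by_cases hz : z ∈ ball (0 : ℂ) (2 * ε)
  · have hz1 := (mem_ball_iff_sqd (by positivity)).mp hz
    have hn : ‖z‖ < 2 * ε := by simpa using hz
    refine ⟨hρ.trans hle, ?_, ?_, ?_⟩
    · change |dx (fun y => cutρ ε (sqd 0 y)) z| ≤ _
      rw [dx_radial (hasDerivAt_cutρ ε _)]
      simp only [Complex.zero_re, sub_zero]
      rw [abs_mul, abs_mul, abs_two]
      calc _ ≤ 2 * (C / ε ^ 2) * (2 * ε) := by
            gcongr; exact (Complex.abs_re_le_norm z).trans hn.le
        _ = 4 * C / ε := by field_simp; ring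
        _ ≤ _ := by gcongr; linarith
    · change |dy (fun y => cutρ ε (sqd 0 y)) z| ≤ _
      rw [dy_radial (hasDerivAt_cutρ ε _)]
      simp only [Complex.zero_im, sub_zero]
      rw [abs_mul, abs_mul, abs_two]
      calc _ ≤ 2 * (C / ε ^ 2) * (2 * ε) := by
            gcongr; exact (Complex.abs_im_le_norm z).trans hn.le
        _ = 4 * C / ε := by field_simp; ring
        _ ≤ _ := by gcongr; linarith
    · change |lapC (fun y => cutρ ε (sqd 0 y)) z| ≤ _
      rw [lapC_radial (Eventually.of_forall (hasDerivAt_cutρ ε)) (hasDerivAt_deriv_cutρ ε _)]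
      by_cases h2 : sqd 0 z ≤ 2 * ε ^ 2
      · have h3 : |deriv (deriv smoothTransition) (sqd 0 z / ε ^ 2 - 1) / ε ^ 2 / ε ^ 2|
            ≤ C / ε ^ 2 / ε ^ 2 := by
          rw [abs_div, abs_div, abs_of_pos (pow_pos hε 2)]
          gcongr; exact (hb _).2
        refine (abs_add_le _ _).trans ?_
        rw [abs_mul, abs_mul, abs_mul, abs_of_nonneg (sqd_nonneg 0 z), abs_of_pos (by norm_num :
          (0 : ℝ) < 4)]
        calc _ ≤ 4 * (2 * ε ^ 2) * (C / ε ^ 2 / ε ^ 2) + 4 * (C / ε ^ 2) := by gcongr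
          _ = 12 * C / ε ^ 2 := by field_simp; ring
      · have h4 : 1 < sqd 0 z / ε ^ 2 - 1 := by
          rw [lt_sub_iff_add_lt, lt_div_iff₀ (by positivity)]; linarith
        have e1 := deriv_smoothTransition_zero (Or.inr h4)
        have e2 : deriv smoothTransition =ᶠ[𝓝 (sqd 0 z / ε ^ 2 - 1)] fun _ => 0 := by
          filter_upwards [lt_mem_nhds h4] with y hy
          rw [(deriv_smoothTransition_zero (Or.inr hy)).deriv_eq]; simp
        rw [e2.deriv_eq, e1.deriv_eq]; simp; positivity
  · have h1 := cut_eventually_one hε hz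
    refine ⟨hρ.trans hle, ?_, ?_, ?_⟩
    · rw [dx, h1.fderiv_eq]; simp; positivity
    · rw [dy, h1.fderiv_eq]; simp; positivity
    · rw [lapC_congr h1, lapC_const]; simp; positivity

lemma hasCompactSupport_lapC {η : ℂ → ℝ} (hc : HasCompactSupport η) :
    HasCompactSupport (lapC η) := by
  refine HasCompactSupport.of_support_subset_isCompact hc (fun z hz => ?_)
  by_contra h
  exact hz (lapC_eq_zero_of_notMem_tsupport h)

lemma continuous_lapC {η : ℂ → ℝ} (h : ContDiff ℝ 2 η) : Continuous (lapC η) := by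
  have : lapC η = fun z => fderiv ℝ (fderiv ℝ η) z 1 1
      + fderiv ℝ (fderiv ℝ η) z Complex.I Complex.I := by
    ext z; exact lapC_eq_sndFDeriv h.contDiffAt
  rw [this]
  have h2 : Continuous (fderiv ℝ (fderiv ℝ η)) :=
    (h.fderiv_right (m := 1) (by norm_num)).continuous_fderiv one_ne_zero
  fun_prop

lemma lapC_cut_eq_zero {ε : ℝ} (hε : 0 < ε) {z : ℂ} (h : z ∉ ball 0 (2 * ε)) :
    lapC (cut ε) z = 0 := by
  rw [lapC_congr (cut_eventually_one hε h), lapC_const]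

lemma integral_lapC_cut {ε : ℝ} (hε : 0 < ε) :
    Integrable (lapC (cut ε)) ∧ ∫ z, lapC (cut ε) z = 0 := by
  have hc : HasCompactSupport (fun z => 1 - cut ε z) := by
    refine HasCompactSupport.of_support_subset_isCompact (isCompact_closedBall 0 (2 * ε)) ?_
    intro z hz
    by_contra h
    exact hz (by simp [cut_eq_one hε (fun h' => h (ball_subset_closedBall h'))])
  have hcd : ContDiff ℝ 2 (fun z => 1 - cut ε z) := contDiff_const.sub (contDiff_cut ε)
  have hg := integral_green hcd hc (u := fun _ => 1) (fun z _ => contDiffAt_const)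
  have e : (fun z => (1 - cut ε z) * lapC (fun _ => 1) z - 1 * lapC (fun z => 1 - cut ε z) z)
      = lapC (cut ε) := by
    ext z
    rw [lapC_sub contDiffAt_const (contDiff_cut ε).contDiffAt, lapC_const]; ring
  rwa [e] at hg

lemma integrable_mul_of_tsupport {η f : ℂ → ℝ} (hη : Continuous η) (hc : HasCompactSupport η)
    (hf : IntegrableOn f (tsupport η)) : Integrable (fun z => η z * f z) := by
  obtain ⟨C, hC⟩ := hc.exists_bound_of_continuous hη
  have h1 : IntegrableOn (fun z => η z * f z) (tsupport η) :=
    hf.bdd_mul hη.aestronglyMeasurable (Eventually.of_forall hC)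
  refine (integrableOn_iff_integrable_of_support_subset ?_).mp h1
  intro z hz
  by_contra h
  exact hz (by simp [image_eq_zero_of_notMem_tsupport h])

lemma continuous_mul_of_tsupport {v g : ℂ → ℝ} {U : Set ℂ} (hU : IsOpen U)
    (hv : ContinuousOn v U) (hg : Continuous g) (hs : tsupport g ⊆ U) :
    Continuous (fun z => v z * g z) := by
  rw [continuous_iff_continuousAt]
  intro z
  by_cases hz : z ∈ U
  · exact (hv.continuousAt (hU.mem_nhds hz)).mul hg.continuousAt
  · have h1 : g =ᶠ[𝓝 z] fun _ => 0 := eventuallyEq_zero_of_notMem_tsupport fun h => hz (hs h)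
    have h2 : (fun z => v z * g z) =ᶠ[𝓝 z] fun _ => 0 := by
      filter_upwards [h1] with y hy; simp [hy]
    exact continuousAt_const.congr h2.symm

lemma tsupport_lapC_subset (η : ℂ → ℝ) : tsupport (lapC η) ⊆ tsupport η :=
  closure_minimal (fun z hz => by
    by_contra h; exact hz (lapC_eq_zero_of_notMem_tsupport h)) (isClosed_tsupport _)

lemma abs_integral_le_of_ball {E : ℂ → ℝ} {r D : ℝ} (hr : 0 < r)
    (h0 : ∀ z ∉ ball (0 : ℂ) r, E z = 0) (hb : ∀ z ∈ ball (0 : ℂ) r, |E z| ≤ D) :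
    |∫ z, E z| ≤ D * (π * r ^ 2) := by
  rw [← setIntegral_eq_integral_of_forall_compl_eq_zero h0]
  have := norm_setIntegral_le_of_norm_le_const (μ := (volume : Measure ℂ)) (s := ball (0 : ℂ) r)
    (C := D) (f := E) measure_ball_lt_top hb
  rw [Real.norm_eq_abs] at this
  convert this using 2
  simp [Measure.real, Complex.volume_ball, hr.le, mul_comm]

/-- The equation holds weakly across the origin. -/
lemma weak_form {v f η : ℂ → ℝ} {U : Set ℂ} (hU : IsOpen U) (h0 : (0 : ℂ) ∈ U)
    (hv : ContinuousOn v U) (hv2 : ∀ z ∈ U, z ≠ 0 → ContDiffAt ℝ 2 v z)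
    (hf : ∀ z ∈ U, z ≠ 0 → -lapC v z = f z) (hη : ContDiff ℝ 2 η) (hc : HasCompactSupport η)
    (hs : tsupport η ⊆ U) (hfi : IntegrableOn f (tsupport η)) :
    ∫ z, η z * f z = -∫ z, v z * lapC η z := by
  obtain ⟨C, hC, hcut⟩ := exists_cut_bounds
  have hi1 : Integrable (fun z => η z * f z) := integrable_mul_of_tsupport hη.continuous hc hfi
  have hi2 : Integrable (fun z => v z * lapC η z) :=
    (continuous_mul_of_tsupport hU hv (continuous_lapC hη)
      ((tsupport_lapC_subset η).trans hs)).integrable_of_hasCompactSupport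
      ((hasCompactSupport_lapC hc).mul_left)
  set v0 := v 0 * η 0 with hv0
  -- the error term concentrated at the origin
  set E : ℝ → ℂ → ℝ := fun ε z => (v z * η z - v0) * lapC (cut ε) z
      + 2 * v z * (dx (cut ε) z * dx η z + dy (cut ε) z * dy η z) with hE
  have ident : ∀ ε > 0, (∫ z, cut ε z * (η z * f z)) + (∫ z, cut ε z * (v z * lapC η z))
      + ∫ z, E ε z = 0 := by
    intro ε hε
    have hcc : ContDiff ℝ 2 (cut ε) := contDiff_cut ε
    have hcη : ContDiff ℝ 2 (fun z => cut ε z * η z) := hcc.mul hη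
    have hsub : tsupport (fun z => cut ε z * η z) ⊆ tsupport η := tsupport_mul_subset_right
    have hsub2 : tsupport (fun z => cut ε z * η z) ⊆ tsupport (cut ε) := tsupport_mul_subset_left
    obtain ⟨gi, g0⟩ := integral_green hcη hc.mul_left (u := v) (fun z hz =>
      hv2 z (hs (hsub hz)) (fun h => notMem_tsupport_cut hε (h ▸ hsub2 hz)))
    obtain ⟨li, l0⟩ := integral_lapC_cut hε
    have hbd : ∀ᵐ z : ℂ, ‖cut ε z‖ ≤ 1 := Eventually.of_forall fun z => by
      rw [Real.norm_eq_abs, abs_of_nonneg (cut_nonneg _ _)]; exact cut_le_one _ _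
    have i1 : Integrable (fun z => cut ε z * (η z * f z)) :=
      hi1.bdd_mul hcc.continuous.aestronglyMeasurable hbd
    have i2 : Integrable (fun z => cut ε z * (v z * lapC η z)) :=
      hi2.bdd_mul hcc.continuous.aestronglyMeasurable hbd
    have key : (fun z => cut ε z * η z * lapC v z - v z * lapC (fun z => cut ε z * η z) z)
        = fun z => -(cut ε z * (η z * f z) + cut ε z * (v z * lapC η z)
          + v0 * lapC (cut ε) z + E ε z) := by
      ext z
      rw [lapC_mul hcc.contDiffAt hη.contDiffAt]
      have e1 : cut ε z * η z * lapC v z = -(cut ε z * (η z * f z)) := by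
        by_cases hz : z ∈ U
        · by_cases h : z = 0
          · rw [cut_eq_zero hε (by simp [h, hε.le])]; ring
          · rw [← hf z hz h]; ring
        · rw [image_eq_zero_of_notMem_tsupport (fun h => hz (hs h))]; ring
      rw [e1]; simp only [hE]; ring
    rw [key] at gi g0
    have i3 : Integrable (fun z => v0 * lapC (cut ε) z) := li.const_mul _
    have i12 : Integrable (fun z => cut ε z * (η z * f z) + cut ε z * (v z * lapC η z)) :=
      i1.add i2
    have i123 : Integrable (fun z => cut ε z * (η z * f z) + cut ε z * (v z * lapC η z)
          + v0 * lapC (cut ε) z) := i12.add i3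
    have iE : Integrable (E ε) := by
      have := gi.neg.sub i123
      refine this.congr (Eventually.of_forall fun z => ?_)
      simp
    rw [integral_neg, neg_eq_zero, integral_add i123 iE, integral_add i12 i3,
      integral_add i1 i2, integral_const_mul, l0, mul_zero, add_zero] at g0
    exact g0
  have lim1 : ∀ g : ℂ → ℝ, Integrable g →
      Tendsto (fun ε => ∫ z, cut ε z * g z) (𝓝[>] 0) (𝓝 (∫ z, g z)) := by
    intro g hg
    refine tendsto_integral_filter_of_dominated_convergence (fun z => ‖g z‖) ?_ ?_ hg.norm ?_
    · exact Eventually.of_forall fun ε =>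
        (contDiff_cut ε (n := 0)).continuous.aestronglyMeasurable.mul hg.aestronglyMeasurable
    · refine Eventually.of_forall fun ε => Eventually.of_forall fun z => ?_
      rw [norm_mul, Real.norm_eq_abs, abs_of_nonneg (cut_nonneg _ _)]
      exact mul_le_of_le_one_left (norm_nonneg _) (cut_le_one _ _)
    · have : ∀ᵐ z : ℂ, z ≠ 0 := by simp [ae_iff, measure_singleton]
      filter_upwards [this] with z hz
      refine tendsto_const_nhds.congr' ?_
      filter_upwards [tendsto_cut hz] with ε hε
      simp [hε]
  have limE : Tendsto (fun ε => ∫ z, E ε z) (𝓝[>] 0) (𝓝 0) := by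
    -- local bounds near the origin
    have hvc : ContinuousAt v 0 := hv.continuousAt (hU.mem_nhds h0)
    set B := |v 0| + 1 with hB
    have hBev : ∀ᶠ z in 𝓝 (0 : ℂ), |v z| ≤ B := by
      have := hvc.abs.eventually (gt_mem_nhds (show |v 0| < B by simp [hB]))
      filter_upwards [this] with z hz using hz.le
    obtain ⟨D1, hD1⟩ := (hc.fderiv_apply (𝕜 := ℝ) 1).exists_bound_of_continuous
      ((hη.continuous_fderiv two_ne_zero).clm_apply continuous_const)
    obtain ⟨D2, hD2⟩ := (hc.fderiv_apply (𝕜 := ℝ) Complex.I).exists_bound_of_continuous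
      ((hη.continuous_fderiv two_ne_zero).clm_apply continuous_const)
    set D := max D1 D2 with hD
    have hDx : ∀ z, |dx η z| ≤ D := fun z => (hD1 z).trans (le_max_left _ _)
    have hDy : ∀ z, |dy η z| ≤ D := fun z => (hD2 z).trans (le_max_right _ _)
    have hD0 : 0 ≤ D := (abs_nonneg _).trans (hDx 0)
    have hB0 : 0 < B := by positivity
    rw [Metric.tendsto_nhds]
    intro δ' hδ'
    obtain ⟨δ, hδ, hδle⟩ : ∃ δ > 0, (C * δ + 4 * B * C * D * δ) * (π * 4) < δ' := by
      refine ⟨δ' / 2 / ((C + 4 * B * C * D) * (π * 4)), by positivity, ?_⟩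
      have : (C * (δ' / 2 / ((C + 4 * B * C * D) * (π * 4)))
        + 4 * B * C * D * (δ' / 2 / ((C + 4 * B * C * D) * (π * 4)))) * (π * 4) = δ' / 2 := by
        have : (C + 4 * B * C * D) * (π * 4) ≠ 0 := by positivity
        field_simp
      rw [this]; linarith
    have hgc : ∀ᶠ z in 𝓝 (0 : ℂ), |v z * η z - v0| ≤ δ := by
      have : ContinuousAt (fun z => v z * η z) 0 := hvc.mul hη.continuous.continuousAt
      filter_upwards [Metric.tendsto_nhds.mp this δ hδ] with z hz
      rw [Real.dist_eq] at hz; exact hz.le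
    obtain ⟨r, hr, hball⟩ := Metric.eventually_nhds_iff_ball.mp (hBev.and hgc)
    have e1 : ∀ᶠ ε in 𝓝[>] (0 : ℝ), ε < r / 2 :=
      (gt_mem_nhds (by positivity)).filter_mono nhdsWithin_le_nhds
    have e2 : ∀ᶠ ε in 𝓝[>] (0 : ℝ), ε < δ :=
      (gt_mem_nhds hδ).filter_mono nhdsWithin_le_nhds
    filter_upwards [e1, e2, self_mem_nhdsWithin] with ε hε1 hε2 hε
    have hε : 0 < ε := hε
    rw [dist_zero_right, Real.norm_eq_abs]
    refine lt_of_le_of_lt ?_ hδle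
    refine (abs_integral_le_of_ball (r := 2 * ε)
      (D := (C * δ + 4 * B * C * D * δ) / ε ^ 2) (by positivity) ?_ ?_).trans
      (le_of_eq (by field_simp; ring))
    · intro z hz
      have h1 := cut_eventually_one hε hz
      have h2 : dx (cut ε) z = 0 := by rw [dx, h1.fderiv_eq]; simp
      have h3 : dy (cut ε) z = 0 := by rw [dy, h1.fderiv_eq]; simp
      simp [hE, lapC_cut_eq_zero hε hz, h2, h3]
    · intro z hz
      obtain ⟨hv1, hv2'⟩ := hball z (ball_subset_ball (by linarith) hz)
      obtain ⟨-, c1, c2, c3⟩ := hcut ε hε z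
      simp only [hE]
      have t1 : |(v z * η z - v0) * lapC (cut ε) z| ≤ δ * (C / ε ^ 2) := by
        rw [abs_mul]; gcongr
      have t2 : |dx (cut ε) z * dx η z + dy (cut ε) z * dy η z| ≤ C / ε * D + C / ε * D := by
        refine (abs_add_le _ _).trans ?_
        rw [abs_mul, abs_mul]
        gcongr
        · exact hDx z
        · exact hDy z
      have t3 : |2 * v z * (dx (cut ε) z * dx η z + dy (cut ε) z * dy η z)|
          ≤ 2 * B * (C / ε * D + C / ε * D) := by
        rw [abs_mul, abs_mul, abs_two]; gcongr
      refine ((abs_add_le _ _).trans (add_le_add t1 t3)).trans ?_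
      have : 2 * B * (C / ε * D + C / ε * D) = 4 * B * C * D * ε / ε ^ 2 := by
        field_simp; ring
      rw [this, ← mul_div_assoc, ← add_div]
      refine div_le_div_of_nonneg_right (add_le_add (by rw [mul_comm])
        (mul_le_mul_of_nonneg_left hε2.le (by positivity))) (by positivity)
  have hlim := ((lim1 _ hi1).add (lim1 _ hi2)).add limE
  have hz : Tendsto (fun ε => (∫ z, cut ε z * (η z * f z)) + (∫ z, cut ε z * (v z * lapC η z))
      + ∫ z, E ε z) (𝓝[>] 0) (𝓝 0) := by
    refine tendsto_const_nhds.congr' ?_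
    filter_upwards [self_mem_nhdsWithin] with ε hε using (ident ε hε).symm
  have := tendsto_nhds_unique hlim hz
  linarith

/-- A positive weight on a closed disc which degenerates at most like a power at the origin. -/
structure IsWeight (W : ℂ → ℝ) (r β C₀ : ℝ) : Prop where
  r_pos : 0 < r
  r_lt : r < 1
  β_gt : -1 < β
  β_le : β ≤ 0
  C_pos : 0 < C₀
  contDiffAt : ∀ z ∈ closedBall (0 : ℂ) r, z ≠ 0 → ContDiffAt ℝ 1 W z
  pos : ∀ z ∈ closedBall (0 : ℂ) r, z ≠ 0 → 0 < W z
  le : ∀ z ∈ closedBall (0 : ℂ) r, z ≠ 0 → W z ≤ C₀ * ‖z‖ ^ (2 * β)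
  radial : ∀ z ∈ closedBall (0 : ℂ) r, z ≠ 0 → |z.re * dx W z + z.im * dy W z| ≤ C₀ * W z

/-- A positive solution of `-Δ v = W v ^ p` in the punctured unit disc, continuous at `0`. -/
structure IsSol (W v : ℂ → ℝ) (p : ℝ) : Prop where
  continuousOn : ContinuousOn v (ball 0 1)
  contDiffAt : ∀ z ∈ ball (0 : ℂ) 1, z ≠ 0 → ContDiffAt ℝ 2 v z
  pos : ∀ z ∈ ball (0 : ℂ) 1, 0 < v z
  eq : ∀ z ∈ ball (0 : ℂ) 1, z ≠ 0 → -lapC v z = W z * v z ^ p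

lemma ae_ne_zero : ∀ᵐ z : ℂ, z ≠ 0 := by simp [ae_iff, measure_singleton]

lemma integrableOn_rpow_norm {β : ℝ} (hβ : -1 < β) (r : ℝ) :
    IntegrableOn (fun z : ℂ => ‖z‖ ^ (2 * β)) (closedBall 0 r) := by
  refine (integrableOn_ball_of_norm_le_rpow (μ := volume) (C := 1) (α := -(2 * β)) (r := r + 1)
    (by simp) (by simp; linarith) ?_ ?_).mono_set (closedBall_subset_ball (by linarith))
  · refine Eventually.of_forall fun z => ?_
    rw [Real.norm_of_nonneg (by positivity)]; simp
  · exact (measurable_norm.pow_const _).aestronglyMeasurable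

lemma IsWeight.continuousOn {W : ℂ → ℝ} {r β C₀ : ℝ} (h : IsWeight W r β C₀) :
    ContinuousOn W (closedBall 0 r \ {0}) := fun z hz =>
  (h.contDiffAt z hz.1 hz.2).continuousAt.continuousWithinAt

lemma IsWeight.integrableOn {W : ℂ → ℝ} {r β C₀ : ℝ} (h : IsWeight W r β C₀) :
    IntegrableOn W (closedBall 0 r) := by
  have h1 := (integrableOn_rpow_norm h.β_gt r).const_mul C₀
  have hms : MeasurableSet (closedBall (0 : ℂ) r) := measurableSet_closedBall
  have hae : (closedBall (0 : ℂ) r \ {0} : Set ℂ) =ᵐ[volume] closedBall 0 r :=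
    sdiff_null_ae_eq_self (by simp)
  refine Integrable.mono' h1 ?_ ?_
  · have := h.continuousOn.aestronglyMeasurable (μ := volume)
      (hms.diff (measurableSet_singleton 0))
    rwa [Measure.restrict_congr_set hae] at this
  · rw [ae_restrict_iff' hms]
    filter_upwards [ae_ne_zero] with z hz hzr
    rw [Real.norm_of_nonneg (h.pos z hzr hz).le]
    exact h.le z hzr hz

lemma IsWeight.integrableOn_mul {W g : ℂ → ℝ} {r β C₀ : ℝ} (h : IsWeight W r β C₀)
    (hg : ContinuousOn g (closedBall 0 r)) :
    IntegrableOn (fun z => W z * g z) (closedBall 0 r) :=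
  h.integrableOn.mul_continuousOn hg (isCompact_closedBall _ _)

lemma IsSol.continuousOn_rpow {W v : ℂ → ℝ} {p q r : ℝ} (h : IsSol W v p) (hr : r < 1) :
    ContinuousOn (fun z => v z ^ q) (closedBall 0 r) := fun z hz =>
  ((h.continuousOn.mono (closedBall_subset_ball hr)) z hz).rpow_const
    (Or.inl (h.pos z (closedBall_subset_ball hr hz)).ne')

lemma IsSol.integrableOn {W v : ℂ → ℝ} {p r β C₀ : ℝ} (h : IsSol W v p) (hW : IsWeight W r β C₀)
    (q : ℝ) : IntegrableOn (fun z => W z * v z ^ q) (closedBall 0 r) :=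
  hW.integrableOn_mul (h.continuousOn_rpow hW.r_lt)

/-- The weak form of the equation, tested against functions supported in the disc. -/
lemma IsSol.weak_form {W v η : ℂ → ℝ} {p r β C₀ : ℝ} (h : IsSol W v p) (hW : IsWeight W r β C₀)
    (hη : ContDiff ℝ 2 η) (hs : tsupport η ⊆ closedBall 0 r) :
    ∫ z, η z * (W z * v z ^ p) = -∫ z, v z * lapC η z :=
  Henon.weak_form isOpen_ball (by simp) h.continuousOn h.contDiffAt h.eq hη
    ((isCompact_closedBall (0 : ℂ) r).of_isClosed_subset (isClosed_tsupport _) hs)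
    (hs.trans (closedBall_subset_ball hW.r_lt)) ((h.integrableOn hW p).mono_set hs)

lemma pohozaev_div {ζ G v : ℂ → ℝ} {z : ℂ} (hζ : DifferentiableAt ℝ ζ z)
    (hG : DifferentiableAt ℝ G z) (hv : ContDiffAt ℝ 2 v z) :
    dx (fun y => ζ y * ((y.re * dx v y + y.im * dy v y) * dx v y
        + y.re * (G y - (dx v y ^ 2 + dy v y ^ 2) / 2))) z
      + dy (fun y => ζ y * ((y.re * dx v y + y.im * dy v y) * dy v y
        + y.im * (G y - (dx v y ^ 2 + dy v y ^ 2) / 2))) z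
    = ζ z * ((z.re * dx v z + z.im * dy v z) * lapC v z
        + (z.re * dx G z + z.im * dy G z) + 2 * G z)
      + (dx ζ z * z.re + dy ζ z * z.im) * (G z - (dx v z ^ 2 + dy v z ^ 2) / 2)
      + (dx ζ z * dx v z + dy ζ z * dy v z) * (z.re * dx v z + z.im * dy v z) := by
  have hp := (differentiableAt_dx hv).hasFDerivAt
  have hq := (differentiableAt_dy hv).hasFDerivAt
  have hre : HasFDerivAt Complex.re Complex.reCLM z := Complex.reCLM.hasFDerivAt
  have him : HasFDerivAt Complex.im Complex.imCLM z := Complex.imCLM.hasFDerivAt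
  have hH := (hre.mul hp).add (him.mul hq)
  have hN := (((hp.pow 2).add (hq.pow 2)).mul_const (1/2 : ℝ))
  have hGN := hG.hasFDerivAt.sub hN
  have hP := hζ.hasFDerivAt.mul ((hH.mul hp).add (hre.mul hGN))
  have hQ := hζ.hasFDerivAt.mul ((hH.mul hq).add (him.mul hGN))
  have e1 : (fun y => ζ y * ((y.re * dx v y + y.im * dy v y) * dx v y
        + y.re * (G y - (dx v y ^ 2 + dy v y ^ 2) / 2)))
      = (fun y => ζ y * ((y.re * dx v y + y.im * dy v y) * dx v y
        + y.re * (G y - (dx v y ^ 2 + dy v y ^ 2) * (1 / 2)))) := by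
    ext y; ring
  have e2 : (fun y => ζ y * ((y.re * dx v y + y.im * dy v y) * dy v y
        + y.im * (G y - (dx v y ^ 2 + dy v y ^ 2) / 2)))
      = (fun y => ζ y * ((y.re * dx v y + y.im * dy v y) * dy v y
        + y.im * (G y - (dx v y ^ 2 + dy v y ^ 2) * (1 / 2)))) := by
    ext y; ring
  have hs : fderiv ℝ (dx v) z Complex.I = fderiv ℝ (dy v) z 1 := dy_dx_eq hv
  have hP' : HasFDerivAt (fun y => ζ y * ((y.re * dx v y + y.im * dy v y) * dx v y
        + y.re * (G y - (dx v y ^ 2 + dy v y ^ 2) * (1 / 2)))) _ z := hP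
  have hQ' : HasFDerivAt (fun y => ζ y * ((y.re * dx v y + y.im * dy v y) * dy v y
        + y.im * (G y - (dx v y ^ 2 + dy v y ^ 2) * (1 / 2)))) _ z := hQ
  rw [e1, e2, dx, dy, hP'.fderiv, hQ'.fderiv]
  simp [lapC, dx, dy] at hs ⊢
  simp [hs]
  ring

lemma volReal_closedBall (c : ℂ) {r : ℝ} (hr : 0 ≤ r) :
    (volume : Measure ℂ).real (closedBall c r) = π * r ^ 2 := by
  rw [Measure.real, Complex.volume_closedBall, ENNReal.toReal_mul, ENNReal.toReal_pow,
    ENNReal.toReal_ofReal hr, mul_comm]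
  rfl

/-- A nonnegative bump supported in the annulus `ε / 2 ≤ |z| ≤ 4 ε`, equal to one on
`ε ≤ |z| ≤ 2 ε`. -/
def ringBump (ε : ℝ) (z : ℂ) : ℝ := cut (ε / 2) z * (1 - cut (2 * ε) z)

lemma contDiff_ringBump (ε : ℝ) {n : ℕ∞} : ContDiff ℝ n (ringBump ε) :=
  (contDiff_cut _).mul (contDiff_const.sub (contDiff_cut _))

lemma ringBump_nonneg (ε : ℝ) (z : ℂ) : 0 ≤ ringBump ε z :=
  mul_nonneg (cut_nonneg _ _) (by linarith [cut_le_one (2 * ε) z])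

lemma ringBump_le_one (ε : ℝ) (z : ℂ) : ringBump ε z ≤ 1 :=
  mul_le_one₀ (cut_le_one _ _) (by linarith [cut_le_one (2 * ε) z])
    (by linarith [cut_nonneg (2 * ε) z])

lemma ringBump_eq_one {ε : ℝ} (hε : 0 < ε) {z : ℂ} (h1 : ε ≤ ‖z‖) (h2 : ‖z‖ ≤ 2 * ε) :
    ringBump ε z = 1 := by
  rw [ringBump, cut_eq_one (by positivity) (by simp; linarith),
    cut_eq_zero (by positivity) (by simpa using h2)]
  norm_num

lemma tsupport_ringBump {ε : ℝ} (hε : 0 < ε) :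
    tsupport (ringBump ε) ⊆ closedBall 0 (4 * ε) := by
  refine closure_minimal (fun z hz => ?_) isClosed_closedBall
  by_contra h
  refine hz ?_
  rw [ringBump, cut_eq_one (ε := 2 * ε) (by positivity)]
  · simp
  · simp at h ⊢; linarith

lemma notMem_tsupport_ringBump {ε : ℝ} (hε : 0 < ε) : (0 : ℂ) ∉ tsupport (ringBump ε) := fun h =>
  notMem_tsupport_cut (half_pos hε) (tsupport_mul_subset_left' _ _ h)

lemma exists_lapC_ringBump_le : ∃ C > 0, ∀ ε > 0, ∀ z : ℂ, |lapC (ringBump ε) z| ≤ C / ε ^ 2 := by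
  obtain ⟨C, hC, hcut⟩ := exists_cut_bounds
  refine ⟨5 * C + 4 * C ^ 2, by positivity, fun ε hε z => ?_⟩
  have ha : ContDiffAt ℝ 2 (cut (ε / 2)) z := (contDiff_cut _).contDiffAt
  have hb : ContDiffAt ℝ 2 (cut (2 * ε)) z := (contDiff_cut _).contDiffAt
  have h1 : ContDiffAt ℝ 2 (fun _ : ℂ => (1 : ℝ)) z := contDiffAt_const
  have e0 : lapC (fun y => 1 - cut (2 * ε) y) z = - lapC (cut (2 * ε)) z := by
    rw [lapC_sub h1 hb, lapC_const]; ring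
  have hd := hb.differentiableAt two_ne_zero
  have ex : dx (fun y => 1 - cut (2 * ε) y) z = - dx (cut (2 * ε)) z := by
    rw [dx_sub (differentiableAt_const _) hd]; simp [dx]
  have ey : dy (fun y => 1 - cut (2 * ε) y) z = - dy (cut (2 * ε)) z := by
    rw [dy_sub (differentiableAt_const _) hd]; simp [dy]
  have e : lapC (ringBump ε) z = _ := lapC_mul ha (h1.sub hb)
  rw [e, e0, ex, ey]
  obtain ⟨-, a1, a2, a3⟩ := hcut (ε / 2) (by positivity) z
  obtain ⟨-, b1, b2, b3⟩ := hcut (2 * ε) (by positivity) z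
  have n1 := cut_nonneg (ε / 2) z
  have n2 := cut_le_one (ε / 2) z
  have n3 := cut_nonneg (2 * ε) z
  have n4 := cut_le_one (2 * ε) z
  have t1 : |cut (ε / 2) z * -lapC (cut (2 * ε)) z| ≤ 1 * (C / (2 * ε) ^ 2) := by
    rw [abs_mul, abs_neg, abs_of_nonneg n1]; gcongr
  have t2 : |(1 - cut (2 * ε) z) * lapC (cut (ε / 2)) z| ≤ 1 * (C / (ε / 2) ^ 2) := by
    rw [abs_mul, abs_of_nonneg (by linarith)]; gcongr; linarith
  have t3 : |dx (cut (ε / 2)) z * -dx (cut (2 * ε)) z| ≤ C / (ε / 2) * (C / (2 * ε)) := by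
    rw [abs_mul, abs_neg]; gcongr
  have t4 : |dy (cut (ε / 2)) z * -dy (cut (2 * ε)) z| ≤ C / (ε / 2) * (C / (2 * ε)) := by
    rw [abs_mul, abs_neg]; gcongr
  have s1 : 1 * (C / (2 * ε) ^ 2) = C / 4 / ε ^ 2 := by field_simp; ring
  have s2 : 1 * (C / (ε / 2) ^ 2) = 4 * C / ε ^ 2 := by field_simp; norm_num
  have s3 : C / (ε / 2) * (C / (2 * ε)) = C ^ 2 / ε ^ 2 := by field_simp
  rw [s1] at t1; rw [s2] at t2; rw [s3] at t3 t4
  have hk : C / 4 / ε ^ 2 + 4 * C / ε ^ 2 + 2 * (C ^ 2 / ε ^ 2 + C ^ 2 / ε ^ 2)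
      ≤ (5 * C + 4 * C ^ 2) / ε ^ 2 := by
    rw [← add_div, ← add_div, ← mul_div_assoc, ← add_div]
    exact div_le_div_of_nonneg_right (by linarith) (by positivity)
  refine le_trans ?_ hk
  rw [abs_le] at *
  constructor <;> linarith [t1.1, t1.2, t2.1, t2.2, t3.1, t3.2, t4.1, t4.2]

/-- The Dirichlet energy near the origin is small at every scale. -/
lemma IsSol.caccioppoli {W v : ℂ → ℝ} {p r β C₀ : ℝ} (h : IsSol W v p) (hW : IsWeight W r β C₀)
    {δ : ℝ} (hδ : 0 < δ) : ∀ᶠ ε in 𝓝[>] (0 : ℝ),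
      Integrable (fun z => ringBump ε z * (dx v z ^ 2 + dy v z ^ 2)) ∧
      ∫ z, ringBump ε z * (dx v z ^ 2 + dy v z ^ 2) ≤ δ := by
  obtain ⟨C, hC, hlap⟩ := exists_lapC_ringBump_le
  set m := ∫ z in closedBall (0 : ℂ) r, W z * v z ^ p with hm
  have hfi := h.integrableOn hW p
  have hm0 : 0 ≤ m := by
    refine setIntegral_nonneg_of_ae_restrict ?_
    filter_upwards [ae_restrict_mem measurableSet_closedBall, ae_restrict_of_ae ae_ne_zero]
      with z hz h0
    exact mul_nonneg (hW.pos z hz h0).le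
      (rpow_nonneg (h.pos z (closedBall_subset_ball hW.r_lt hz)).le _)
  obtain ⟨d, hd, hd1, hdle⟩ : ∃ d > 0, d ≤ 1 ∧ d * (C * π * 8 + m) ≤ δ := by
    refine ⟨min 1 (δ / (C * π * 8 + m)), by positivity, min_le_left _ _, ?_⟩
    have : 0 < C * π * 8 + m := by positivity
    calc _ ≤ δ / (C * π * 8 + m) * (C * π * 8 + m) := by gcongr; exact min_le_right _ _
      _ = δ := by field_simp
  have hvc : ContinuousAt v 0 := h.continuousOn.continuousAt (ball_mem_nhds _ one_pos)
  obtain ⟨s, hs, hball⟩ := Metric.eventually_nhds_iff_ball.mp (Metric.tendsto_nhds.mp hvc d hd)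
  have e1 : ∀ᶠ ε in 𝓝[>] (0 : ℝ), ε < s / 8 :=
    (gt_mem_nhds (by positivity)).filter_mono nhdsWithin_le_nhds
  have e2 : ∀ᶠ ε in 𝓝[>] (0 : ℝ), ε < r / 8 :=
    (gt_mem_nhds (by linarith [hW.r_pos])).filter_mono nhdsWithin_le_nhds
  filter_upwards [e1, e2, self_mem_nhdsWithin] with ε hε1 hε2 hε
  have hε : 0 < ε := hε
  set ζ := ringBump ε with hζ
  have hsub := tsupport_ringBump hε
  have hsr : tsupport ζ ⊆ closedBall 0 r := hsub.trans (closedBall_subset_closedBall (by linarith))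
  have hζc : HasCompactSupport ζ :=
    (isCompact_closedBall (0 : ℂ) r).of_isClosed_subset (isClosed_tsupport _) hsr
  have hζ2 : ContDiff ℝ 2 ζ := contDiff_ringBump ε
  have hne : ∀ z ∈ tsupport ζ, z ≠ 0 := fun z hz h0 => notMem_tsupport_ringBump hε (h0 ▸ hz)
  have hv2 : ∀ z ∈ tsupport ζ, ContDiffAt ℝ 2 v z := fun z hz =>
    h.contDiffAt z (closedBall_subset_ball hW.r_lt (hsr hz)) (hne z hz)
  set w : ℂ → ℝ := fun z => v z - v 0 with hw
  have hw2 : ∀ z ∈ tsupport ζ, ContDiffAt ℝ 2 w z := fun z hz => (hv2 z hz).sub contDiffAt_const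
  obtain ⟨gi, g0⟩ := integral_green hζ2 hζc (u := fun z => w z * w z)
    (fun z hz => (hw2 z hz).mul (hw2 z hz))
  -- the energy density is continuous
  have hN : Continuous (fun z => ζ z * (dx v z ^ 2 + dy v z ^ 2)) := by
    refine (contDiff_of_contDiffAt_tsupport (n := 0) fun z hz => ?_).continuous
    have hz := tsupport_mul_subset_left' _ _ hz
    exact (hζ2.contDiffAt.of_le (by norm_num)).mul
      ((((contDiffAt_dx (hv2 z hz)).pow 2).add ((contDiffAt_dy (hv2 z hz)).pow 2)).of_le
        (by norm_num))
  have hNi : Integrable (fun z => ζ z * (dx v z ^ 2 + dy v z ^ 2)) :=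
    hN.integrable_of_hasCompactSupport hζc.mul_right
  refine ⟨hNi, ?_⟩
  have key : ∀ z, 2 * (ζ z * (dx v z ^ 2 + dy v z ^ 2))
      = (ζ z * lapC (fun z => w z * w z) z - w z * w z * lapC ζ z)
        + (w z * w z * lapC ζ z + 2 * (ζ z * w z * (W z * v z ^ p))) := by
    intro z
    by_cases hz : z ∈ tsupport ζ
    · rw [lapC_mul (hw2 z hz) (hw2 z hz)]
      have hdv := (hv2 z hz).differentiableAt two_ne_zero
      have d1 : dx w z = dx v z := by
        rw [hw, dx_sub hdv (differentiableAt_const _)]; simp [dx]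
      have d2 : dy w z = dy v z := by
        rw [hw, dy_sub hdv (differentiableAt_const _)]; simp [dy]
      have d3 : lapC w z = lapC v z := by
        rw [hw, lapC_sub (hv2 z hz) contDiffAt_const, lapC_const]; ring
      rw [d1, d2, d3, ← h.eq z (closedBall_subset_ball hW.r_lt (hsr hz)) (hne z hz)]
      ring
    · rw [image_eq_zero_of_notMem_tsupport hz, lapC_eq_zero_of_notMem_tsupport hz]; ring
  have hRi : Integrable (fun z => w z * w z * lapC ζ z + 2 * (ζ z * w z * (W z * v z ^ p))) := by
    have := (hNi.const_mul 2).sub gi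
    refine this.congr (Eventually.of_forall fun z => ?_)
    simp only [Pi.sub_apply]; rw [key z]; ring
  have hI : 2 * ∫ z, ζ z * (dx v z ^ 2 + dy v z ^ 2)
      = ∫ z, (w z * w z * lapC ζ z + 2 * (ζ z * w z * (W z * v z ^ p))) := by
    rw [← integral_const_mul]
    simp_rw [key]
    rw [integral_add gi hRi, g0, zero_add]
  have hball4 : MeasurableSet (closedBall (0 : ℂ) (4 * ε)) := measurableSet_closedBall
  have i1 : Integrable ((closedBall (0 : ℂ) (4 * ε)).indicator fun _ => d * (C / ε ^ 2)) :=
    (integrable_indicator_iff hball4).mpr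
      (integrableOn_const (isCompact_closedBall _ _).measure_lt_top.ne)
  have i2 : Integrable ((closedBall (0 : ℂ) r).indicator fun z => 2 * d * (W z * v z ^ p)) :=
    (integrable_indicator_iff measurableSet_closedBall).mpr (hfi.const_mul _)
  have hle : ∫ z, (w z * w z * lapC ζ z + 2 * (ζ z * w z * (W z * v z ^ p)))
      ≤ ∫ z, ((closedBall (0 : ℂ) (4 * ε)).indicator (fun _ => d * (C / ε ^ 2)) z
        + (closedBall (0 : ℂ) r).indicator (fun z => 2 * d * (W z * v z ^ p)) z) := by
    refine integral_mono_ae hRi (i1.add i2) ?_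
    filter_upwards [ae_ne_zero] with z h0
    have hf0 : ∀ hz : z ∈ closedBall (0 : ℂ) r, 0 ≤ W z * v z ^ p := fun hz =>
      mul_nonneg (hW.pos z hz h0).le
        (rpow_nonneg (h.pos z (closedBall_subset_ball hW.r_lt hz)).le _)
    by_cases hz : z ∈ tsupport ζ
    · have hwd : |w z| ≤ d := by
        have := hball z (ball_subset_ball (by linarith) (closedBall_subset_ball
          (show 4 * ε < 8 * ε by linarith) (hsub hz)))
        rw [Real.dist_eq] at this; exact this.le
      rw [indicator_of_mem (hsub hz), indicator_of_mem (hsr hz)]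
      have := hf0 (hsr hz)
      have hw1 : w z * w z ≤ d := by
        rw [← abs_mul_abs_self]; nlinarith [abs_nonneg (w z)]
      have hl := hlap ε hε z
      refine add_le_add ?_ ?_
      · calc w z * w z * lapC ζ z ≤ w z * w z * |lapC ζ z| :=
              mul_le_mul_of_nonneg_left (le_abs_self _) (mul_self_nonneg _)
          _ ≤ d * (C / ε ^ 2) := by gcongr
      · have z0 : 0 ≤ ζ z := ringBump_nonneg _ _
        have z1 : ζ z ≤ 1 := ringBump_le_one _ _
        have : ζ z * w z ≤ d := by nlinarith [le_abs_self (w z), neg_abs_le (w z)]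
        nlinarith [mul_le_mul_of_nonneg_right this (hf0 (hsr hz))]
    · rw [image_eq_zero_of_notMem_tsupport hz, lapC_eq_zero_of_notMem_tsupport hz]
      have q1 : 0 ≤ (closedBall (0 : ℂ) (4 * ε)).indicator (fun _ => d * (C / ε ^ 2)) z :=
        indicator_nonneg (fun _ _ => by positivity) _
      have q2 : 0 ≤ (closedBall (0 : ℂ) r).indicator (fun z => 2 * d * (W z * v z ^ p)) z := by
        by_cases hz : z ∈ closedBall (0 : ℂ) r
        · rw [indicator_of_mem hz]; have := hf0 hz; positivity
        · rw [indicator_of_notMem hz]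
      linarith
  rw [integral_add i1 i2, integral_indicator hball4, integral_indicator measurableSet_closedBall,
    setIntegral_const, integral_const_mul] at hle
  rw [volReal_closedBall _ (by positivity), smul_eq_mul] at hle
  have : π * (4 * ε) ^ 2 * (d * (C / ε ^ 2)) = 16 * d * C * π := by field_simp; ring
  rw [this, ← hI] at hle
  nlinarith

/-- Radial profile equal to one for `s ≤ a ^ 2` and to zero for `b ^ 2 ≤ s`. -/
def outρ (a b s : ℝ) : ℝ := 1 - smoothTransition ((s - a ^ 2) / (b ^ 2 - a ^ 2))

/-- The derivative of `outρ`. -/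
def outρ' (a b s : ℝ) : ℝ := -(deriv smoothTransition ((s - a ^ 2) / (b ^ 2 - a ^ 2))
  / (b ^ 2 - a ^ 2))

lemma contDiff_outρ (a b : ℝ) {n : ℕ∞} : ContDiff ℝ n (outρ a b) :=
  contDiff_const.sub (smoothTransition.contDiff.comp ((contDiff_id.sub contDiff_const).div_const _))

lemma hasDerivAt_outρ (a b s : ℝ) : HasDerivAt (outρ a b) (outρ' a b s) s := by
  have h1 : HasDerivAt (fun s : ℝ => (s - a ^ 2) / (b ^ 2 - a ^ 2)) (1 / (b ^ 2 - a ^ 2)) s :=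
    ((hasDerivAt_id s).sub_const _).div_const _
  have h2 : HasDerivAt smoothTransition (deriv smoothTransition ((s - a ^ 2) / (b ^ 2 - a ^ 2)))
      ((s - a ^ 2) / (b ^ 2 - a ^ 2)) :=
    ((smoothTransition.contDiff (n := 1)).differentiable one_ne_zero _).hasDerivAt
  have := (h2.comp s h1).const_sub 1
  exact this.congr_deriv (by unfold outρ'; ring)

lemma contDiff_outρ' (a b : ℝ) : ContDiff ℝ 1 (outρ' a b) := by
  have hc : ContDiff ℝ 2 smoothTransition := smoothTransition.contDiff
  have hc1 : ContDiff ℝ 1 (deriv smoothTransition) := hc.deriv'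
  exact ((hc1.comp ((contDiff_id.sub contDiff_const).div_const _)).div_const _).neg

section Annulus

variable {a b : ℝ}

lemma outρ_nonneg (s : ℝ) : 0 ≤ outρ a b s := by
  have := smoothTransition.le_one ((s - a ^ 2) / (b ^ 2 - a ^ 2)); rw [outρ]; linarith

lemma outρ_le_one (s : ℝ) : outρ a b s ≤ 1 := by
  have := smoothTransition.nonneg ((s - a ^ 2) / (b ^ 2 - a ^ 2)); rw [outρ]; linarith

lemma outρ_eq_one (ha : 0 ≤ a) (hab : a < b) {s : ℝ} (h : s ≤ a ^ 2) : outρ a b s = 1 := by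
  have : 0 < b ^ 2 - a ^ 2 := by nlinarith
  rw [outρ, smoothTransition.zero_of_nonpos
    (div_nonpos_of_nonpos_of_nonneg (by linarith) this.le), sub_zero]

lemma outρ_eq_zero (ha : 0 ≤ a) (hab : a < b) {s : ℝ} (h : b ^ 2 ≤ s) : outρ a b s = 0 := by
  have : 0 < b ^ 2 - a ^ 2 := by nlinarith
  rw [outρ, smoothTransition.one_of_one_le ((one_le_div this).mpr (by linarith)), sub_self]

lemma outρ'_nonpos (ha : 0 ≤ a) (hab : a < b) (s : ℝ) : outρ' a b s ≤ 0 := by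
  have : 0 < b ^ 2 - a ^ 2 := by nlinarith
  rw [outρ', neg_nonpos]
  exact div_nonneg smoothTransition.monotone.deriv_nonneg this.le

lemma outρ'_eq_zero (ha : 0 ≤ a) (hab : a < b) {s : ℝ} (h : s < a ^ 2 ∨ b ^ 2 < s) :
    outρ' a b s = 0 := by
  have hpos : 0 < b ^ 2 - a ^ 2 := by nlinarith
  rw [outρ', (deriv_smoothTransition_zero (x := (s - a ^ 2) / (b ^ 2 - a ^ 2)) ?_).deriv_eq]
  · simp
  · rcases h with h | h
    · exact Or.inl (div_neg_of_neg_of_pos (by linarith) hpos)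
    · exact Or.inr ((one_lt_div hpos).mpr (by linarith))

/-- The weight `-2 ρ'(|z|²)` localising to the annulus `a ≤ |z| ≤ b`. -/
def ring (a b : ℝ) (z : ℂ) : ℝ := -2 * outρ' a b (sqd 0 z)

lemma contDiff_ring : ContDiff ℝ 1 (ring a b) :=
  contDiff_const.mul ((contDiff_outρ' a b).comp (contDiff_sqd 0))

lemma ring_nonneg (ha : 0 ≤ a) (hab : a < b) (z : ℂ) : 0 ≤ ring a b z := by
  have := outρ'_nonpos ha hab (sqd 0 z); rw [ring]; linarith

lemma tsupport_ring (ha : 0 ≤ a) (hab : a < b) :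
    tsupport (ring a b) ⊆ {z : ℂ | a ≤ ‖z‖ ∧ ‖z‖ ≤ b} := by
  refine closure_minimal (fun z hz => ?_) ((isClosed_le continuous_const continuous_norm).inter
    (isClosed_le continuous_norm continuous_const))
  by_contra h
  refine hz ?_
  rw [ring, outρ'_eq_zero ha hab, mul_zero]
  rw [sqd_eq, sub_zero]
  simp only [mem_ofPred_eq, not_and_or, not_le] at h
  rcases h with h | h
  · left; gcongr
  · right; have := ha.trans hab.le; gcongr

lemma hasCompactSupport_ring (ha : 0 ≤ a) (hab : a < b) : HasCompactSupport (ring a b) :=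
  (isCompact_closedBall (0 : ℂ) b).of_isClosed_subset (isClosed_tsupport _)
    ((tsupport_ring ha hab).trans fun z hz => by simpa using hz.2)

/-- The angular part of the Pohozaev integrand. -/
def pohE (v : ℂ → ℝ) (z : ℂ) : ℝ :=
  (z.re * dx v z + z.im * dy v z) ^ 2 - sqd 0 z * (dx v z ^ 2 + dy v z ^ 2) / 2

lemma tsupport_outρ (ha : 0 ≤ a) (hab : a < b) :
    tsupport (fun z => outρ a b (sqd 0 z)) ⊆ closedBall 0 b := by
  refine closure_minimal (fun z hz => ?_) isClosed_closedBall
  by_contra h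
  refine hz (outρ_eq_zero ha hab ?_)
  rw [mem_closedBall_iff_sqd (ha.trans_lt hab)] at h
  linarith

lemma cutρ_deriv_eq_zero {ε : ℝ} (hε : 0 < ε) {z : ℂ} (h : ‖z‖ < ε ∨ 2 * ε < ‖z‖) :
    deriv smoothTransition (sqd 0 z / ε ^ 2 - 1) / ε ^ 2 = 0 := by
  rw [sqd_eq, sub_zero, (deriv_smoothTransition_zero (x := ‖z‖ ^ 2 / ε ^ 2 - 1) ?_).deriv_eq]
  · simp
  · rcases h with h | h
    · left
      rw [sub_neg, div_lt_one (by positivity)]; gcongr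
    · right
      rw [lt_sub_iff_add_lt, lt_div_iff₀ (by positivity)]
      nlinarith

lemma fderiv_rpow_mul {W v : ℂ → ℝ} {z : ℂ} {p : ℝ} (hp : 0 < p) (hW : DifferentiableAt ℝ W z)
    (hv : DifferentiableAt ℝ v z) (hv0 : 0 < v z) :
    HasFDerivAt (fun y => W y * (v y ^ (p + 1) / (p + 1)))
      (W z • (v z ^ p • fderiv ℝ v z) + (v z ^ (p + 1) / (p + 1)) • fderiv ℝ W z) z := by
  have h1 := (hv.hasFDerivAt.rpow_const (p := p + 1) (Or.inl hv0.ne')).mul_const (1 / (p + 1))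
  have h2 := hW.hasFDerivAt.mul h1
  have e : (1 / (p + 1)) • (((p + 1) * v z ^ (p + 1 - 1)) • fderiv ℝ v z)
      = v z ^ p • fderiv ℝ v z := by
    rw [smul_smul, add_sub_cancel_right]; congr 1; field_simp
  rw [e] at h2
  have e2 : (fun y => W y * (v y ^ (p + 1) / (p + 1)))
      = W * (fun y => v y ^ (p + 1) * (1 / (p + 1))) := by
    ext y; simp [div_eq_mul_inv]
  rw [e2]
  exact h2.congr_fderiv (by rw [mul_one_div])

/-- Divergence theorem for a field multiplied by a compactly supported cutoff. -/
lemma integral_div_mul_eq_zero {ζ P Q : ℂ → ℝ} (hζ : ContDiff ℝ 1 ζ) (hc : HasCompactSupport ζ)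
    (hP : ∀ z ∈ tsupport ζ, ContDiffAt ℝ 1 P z) (hQ : ∀ z ∈ tsupport ζ, ContDiffAt ℝ 1 Q z) :
    Integrable (fun z => dx (fun y => ζ y * P y) z + dy (fun y => ζ y * Q y) z) ∧
    ∫ z, (dx (fun y => ζ y * P y) z + dy (fun y => ζ y * Q y) z) = 0 :=
  integral_div_eq_zero
    (fun z hz => hζ.contDiffAt.mul (hP z (tsupport_mul_subset_left' ζ P hz)))
    (fun z hz => hζ.contDiffAt.mul (hQ z (tsupport_mul_subset_left' ζ Q hz)))
    hc.mul_right hc.mul_right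

/-- The divergence of the localised Pohozaev field. -/
def pohI (a b ε p : ℝ) (W v : ℂ → ℝ) (z : ℂ) : ℝ :=
  2 * (outρ' a b (sqd 0 z) * cutρ ε (sqd 0 z) + outρ a b (sqd 0 z)
      * (deriv smoothTransition (sqd 0 z / ε ^ 2 - 1) / ε ^ 2)) * (pohE v z
      + sqd 0 z * (W z * (v z ^ (p + 1) / (p + 1))))
    + outρ a b (sqd 0 z) * cutρ ε (sqd 0 z)
      * ((z.re * dx W z + z.im * dy W z + 2 * W z) * (v z ^ (p + 1) / (p + 1)))

/-- The Pohozaev identity, localised away from the origin. -/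
lemma IsSol.pohozaev_identity {W v : ℂ → ℝ} {p β C₀ : ℝ} (h : IsSol W v p)
    (hW : IsWeight W b β C₀) (hp : 0 < p) (ha : 0 ≤ a) (hab : a < b) {ε : ℝ} (hε : 0 < ε) :
    Integrable (pohI a b ε p W v) ∧ ∫ z, pohI a b ε p W v z = 0 := by
  set ρ : ℝ → ℝ := fun s => outρ a b s * cutρ ε s with hρ
  set ζ : ℂ → ℝ := fun z => ρ (sqd 0 z) with hζ
  set G : ℂ → ℝ := fun y => W y * (v y ^ (p + 1) / (p + 1)) with hG
  have hρ2 : ContDiff ℝ 2 ρ := (contDiff_outρ a b).mul (contDiff_cutρ ε)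
  have hζ2 : ContDiff ℝ 2 ζ := hρ2.comp (contDiff_sqd 0)
  have hs1 : tsupport ζ ⊆ closedBall 0 b :=
    (tsupport_mul_subset_left' (fun z => outρ a b (sqd 0 z)) (fun z => cutρ ε (sqd 0 z))).trans
      (tsupport_outρ ha hab)
  have hs2 : (0 : ℂ) ∉ tsupport ζ := fun h0 => notMem_tsupport_cut hε
    (tsupport_mul_subset_right' (fun z => outρ a b (sqd 0 z)) (cut ε) h0)
  have hc : HasCompactSupport ζ :=
    (isCompact_closedBall (0 : ℂ) b).of_isClosed_subset (isClosed_tsupport _) hs1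
  have hne : ∀ z ∈ tsupport ζ, z ≠ 0 := fun z hz h0 => hs2 (h0 ▸ hz)
  have hvz : ∀ z ∈ tsupport ζ, ContDiffAt ℝ 2 v z := fun z hz =>
    h.contDiffAt z (closedBall_subset_ball hW.r_lt (hs1 hz)) (hne z hz)
  have hv0 : ∀ z ∈ tsupport ζ, 0 < v z := fun z hz =>
    h.pos z (closedBall_subset_ball hW.r_lt (hs1 hz))
  have hWz : ∀ z ∈ tsupport ζ, ContDiffAt ℝ 1 W z := fun z hz =>
    hW.contDiffAt z (hs1 hz) (hne z hz)
  have hGz : ∀ z ∈ tsupport ζ, ContDiffAt ℝ 1 G z := fun z hz =>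
    (hWz z hz).mul ((((hvz z hz).of_le one_le_two).rpow_const_of_ne (hv0 z hz).ne').div_const _)
  have hNz : ∀ z ∈ tsupport ζ,
      ContDiffAt ℝ 1 (fun y => G y - (dx v y ^ 2 + dy v y ^ 2) / 2) z := fun z hz =>
    (hGz z hz).sub ((((contDiffAt_dx (hvz z hz)).pow 2).add
      ((contDiffAt_dy (hvz z hz)).pow 2)).div_const _)
  have hHz : ∀ z ∈ tsupport ζ,
      ContDiffAt ℝ 1 (fun y => y.re * dx v y + y.im * dy v y) z := fun z hz =>
    (contDiff_re.contDiffAt.mul (contDiffAt_dx (hvz z hz))).add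
      (contDiff_im.contDiffAt.mul (contDiffAt_dy (hvz z hz)))
  have hA : ∀ z ∈ tsupport ζ, ContDiffAt ℝ 1 (fun y => (y.re * dx v y + y.im * dy v y) * dx v y
      + y.re * (G y - (dx v y ^ 2 + dy v y ^ 2) / 2)) z := fun z hz =>
    ((hHz z hz).mul (contDiffAt_dx (hvz z hz))).add (contDiff_re.contDiffAt.mul (hNz z hz))
  have hB : ∀ z ∈ tsupport ζ, ContDiffAt ℝ 1 (fun y => (y.re * dx v y + y.im * dy v y) * dy v y
      + y.im * (G y - (dx v y ^ 2 + dy v y ^ 2) / 2)) z := fun z hz =>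
    ((hHz z hz).mul (contDiffAt_dy (hvz z hz))).add (contDiff_im.contDiffAt.mul (hNz z hz))
  have hdiv := integral_div_mul_eq_zero (hζ2.of_le one_le_two) hc hA hB
  suffices key : pohI a b ε p W v = fun z =>
      dx (fun y => ζ y * ((y.re * dx v y + y.im * dy v y) * dx v y
        + y.re * (G y - (dx v y ^ 2 + dy v y ^ 2) / 2))) z
      + dy (fun y => ζ y * ((y.re * dx v y + y.im * dy v y) * dy v y
        + y.im * (G y - (dx v y ^ 2 + dy v y ^ 2) / 2))) z by
    rw [key]; exact hdiv
  ext z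
  have hd : HasDerivAt ρ (outρ' a b (sqd 0 z) * cutρ ε (sqd 0 z) + outρ a b (sqd 0 z)
          * (deriv smoothTransition (sqd 0 z / ε ^ 2 - 1) / ε ^ 2)) (sqd 0 z) :=
    (hasDerivAt_outρ a b _).mul (hasDerivAt_cutρ ε _)
  by_cases hz : z ∈ tsupport ζ
  · have hGd := fderiv_rpow_mul hp ((hWz z hz).differentiableAt one_ne_zero)
      ((hvz z hz).differentiableAt two_ne_zero) (hv0 z hz)
    rw [pohozaev_div (hζ2.contDiffAt.differentiableAt two_ne_zero) hGd.differentiableAt (hvz z hz)]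
    have hGx : dx G z = W z * (v z ^ p * dx v z) + (v z ^ (p + 1) / (p + 1)) * dx W z := by
      rw [dx, hGd.fderiv]; rfl
    have hGy : dy G z = W z * (v z ^ p * dy v z) + (v z ^ (p + 1) / (p + 1)) * dy W z := by
      rw [dy, hGd.fderiv]; rfl
    have hl : lapC v z = -(W z * v z ^ p) := by
      rw [← h.eq z (closedBall_subset_ball hW.r_lt (hs1 hz)) (hne z hz)]; ring
    rw [hGx, hGy, hl, dx_radial hd, dy_radial hd]
    simp only [hζ, hρ, pohI, pohE, sqd, Complex.zero_re, Complex.zero_im]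
    ring
  · have hev := eventuallyEq_zero_of_notMem_tsupport hz
    have z1 : ζ z = 0 := hev.eq_of_nhds
    have zx : dx ζ z = 0 := by rw [dx, hev.fderiv_eq]; simp
    have zy : dy ζ z = 0 := by rw [dy, hev.fderiv_eq]; simp
    have hP : ∀ g : ℂ → ℝ, dx (fun y => ζ y * g y) z = 0 := fun g => by
      have : (fun y => ζ y * g y) =ᶠ[𝓝 z] fun _ => 0 := by
        filter_upwards [hev] with y hy; simp [hy]
      rw [dx, this.fderiv_eq]; simp
    have hQ : ∀ g : ℂ → ℝ, dy (fun y => ζ y * g y) z = 0 := fun g => by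
      have : (fun y => ζ y * g y) =ᶠ[𝓝 z] fun _ => 0 := by
        filter_upwards [hev] with y hy; simp [hy]
      rw [dy, this.fderiv_eq]; simp
    rw [hP, hQ, pohI]
    rw [dx_radial hd] at zx
    rw [dy_radial hd] at zy
    have z1' : outρ a b (sqd 0 z) * cutρ ε (sqd 0 z) = 0 := z1
    rw [z1']
    set D := outρ' a b (sqd 0 z) * cutρ ε (sqd 0 z) + outρ a b (sqd 0 z)
          * (deriv smoothTransition (sqd 0 z / ε ^ 2 - 1) / ε ^ 2)
    rcases eq_or_ne D 0 with hD | hD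
    · simp [hD]
    · have x0 : z.re = 0 := by simpa [hD] using zx
      have y0 : z.im = 0 := by simpa [hD] using zy
      simp [pohE, sqd, x0, y0]

lemma sq_radial_le (v : ℂ → ℝ) (z : ℂ) :
    (z.re * dx v z + z.im * dy v z) ^ 2 ≤ sqd 0 z * (dx v z ^ 2 + dy v z ^ 2) := by
  simp only [sqd, Complex.zero_re, Complex.zero_im, sub_zero]
  nlinarith [sq_nonneg (z.re * dy v z - z.im * dx v z)]

lemma abs_pohE_le (v : ℂ → ℝ) (z : ℂ) :
    |pohE v z| ≤ 3 / 2 * (sqd 0 z * (dx v z ^ 2 + dy v z ^ 2)) := by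
  have h1 := sq_radial_le v z
  have h2 := sq_nonneg (z.re * dx v z + z.im * dy v z)
  rw [pohE, abs_le]; constructor <;> linarith

lemma sq_deriv_cut_le {ε C : ℝ} (hε : 0 < ε) (hC : 0 ≤ C) {z : ℂ}
    (h : |deriv smoothTransition (sqd 0 z / ε ^ 2 - 1) / ε ^ 2| ≤ C / ε ^ 2) :
    |deriv smoothTransition (sqd 0 z / ε ^ 2 - 1) / ε ^ 2| * sqd 0 z ≤ 4 * C * ringBump ε z := by
  by_cases h1 : ‖z‖ < ε ∨ 2 * ε < ‖z‖
  · rw [cutρ_deriv_eq_zero hε h1, abs_zero, zero_mul]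
    have := ringBump_nonneg ε z; positivity
  · push Not at h1
    rw [ringBump_eq_one hε h1.1 h1.2, mul_one]
    have hS : sqd 0 z ≤ (2 * ε) ^ 2 := by rw [sqd_eq, sub_zero]; gcongr; exact h1.2
    calc _ ≤ C / ε ^ 2 * (2 * ε) ^ 2 := mul_le_mul h hS (sqd_nonneg _ _) (by positivity)
      _ = 4 * C := by field_simp; ring

lemma IsSol.integrable_ring_mul {W v g : ℂ → ℝ} {p : ℝ} (h : IsSol W v p) (ha : 0 < a)
    (hab : a < b) (hb : b < 1)
    (hg : ∀ z ∈ ball (0 : ℂ) 1, ContDiffAt ℝ 2 v z → ContDiffAt ℝ 1 g z) :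
    Integrable (fun z => ring a b z * g z) := by
  refine Continuous.integrable_of_hasCompactSupport ?_ (hasCompactSupport_ring ha.le hab).mul_right
  refine (contDiff_of_contDiffAt_tsupport (n := 1) fun z hz => ?_).continuous
  have hz' := tsupport_ring ha.le hab (tsupport_mul_subset_left' _ _ hz)
  have hz1 : z ∈ ball (0 : ℂ) 1 := by simpa using hz'.2.trans_lt hb
  have hz0 : z ≠ 0 := by rintro rfl; have := hz'.1; simp at this; linarith
  exact contDiff_ring.contDiffAt.mul (hg z hz1 (h.contDiffAt z hz1 hz0))

lemma IsSol.integrable_ring_pohE {W v : ℂ → ℝ} {p : ℝ} (h : IsSol W v p) (ha : 0 < a)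
    (hab : a < b) (hb : b < 1) : Integrable (fun z => ring a b z * pohE v z) := by
  refine h.integrable_ring_mul ha hab hb fun z _ hv => ?_
  exact (((contDiff_re.contDiffAt.mul (contDiffAt_dx hv)).add
      (contDiff_im.contDiffAt.mul (contDiffAt_dy hv))).pow 2).sub
    (((contDiff_sqd 0).contDiffAt.mul (((contDiffAt_dx hv).pow 2).add
      ((contDiffAt_dy hv).pow 2))).div_const _)

lemma exists_pohozaev_bound (ha : 0 < a) (hab : a < b) (hb : b < 1) {C₀ : ℝ} (hC₀ : 0 < C₀) :
    ∃ C > 0, ∀ (W v : ℂ → ℝ) (p β : ℝ), 0 < p → IsSol W v p → IsWeight W b β C₀ →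
      ∫ z, ring a b z * pohE v z
        ≤ C / (p + 1) * ∫ z in closedBall (0 : ℂ) b, W z * v z ^ (p + 1) := by
  obtain ⟨C, hC, hcut⟩ := exists_cut_bounds
  refine ⟨8 * C + C₀ + 2, by positivity, fun W v p β hp h hW => ?_⟩
  have hIE := h.integrable_ring_pohE ha hab hb
  have hfi := h.integrableOn hW (p + 1)
  refine le_of_forall_pos_le_add fun δ hδ => ?_
  have hca := h.caccioppoli hW (δ := δ / (12 * C)) (by positivity)
  have e1 : ∀ᶠ ε in 𝓝[>] (0 : ℝ), ε < a / 2 :=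
    (gt_mem_nhds (by positivity)).filter_mono nhdsWithin_le_nhds
  obtain ⟨ε, ⟨hNi, hN⟩, hεa, hε⟩ := (hca.and (e1.and self_mem_nhdsWithin)).exists
  have hε : 0 < ε := hε
  obtain ⟨hPi, hP⟩ := h.pohozaev_identity hW hp ha.le hab hε
  set i2 : ℂ → ℝ := (closedBall (0 : ℂ) b).indicator
    (fun z => (8 * C + C₀ + 2) / (p + 1) * (W z * v z ^ (p + 1))) with hi2
  have i2i : Integrable i2 :=
    (integrable_indicator_iff measurableSet_closedBall).mpr (hfi.const_mul _)
  have hle : ∫ z, ring a b z * pohE v z ≤ ∫ z, (12 * C * (ringBump ε z * (dx v z ^ 2 + dy v z ^ 2))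
      + i2 z - pohI a b ε p W v z) := by
    refine integral_mono_ae hIE (((hNi.const_mul _).add i2i).sub hPi) ?_
    filter_upwards [ae_ne_zero] with z h0
    have hk := hcut ε hε z
    have hk2 := sq_deriv_cut_le hε hC.le hk.1
    have hr0 := ringBump_nonneg ε z
    have hr1 := ringBump_le_one ε z
    have hS := sqd_nonneg 0 z
    have hN0 : 0 ≤ dx v z ^ 2 + dy v z ^ 2 := by positivity
    have hc : outρ' a b (sqd 0 z) * cutρ ε (sqd 0 z) = outρ' a b (sqd 0 z) := by
      by_cases hz : ‖z‖ < a
      · rw [outρ'_eq_zero ha.le hab, zero_mul]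
        left; rw [sqd_eq, sub_zero]; gcongr
      · have : cut ε z = 1 := cut_eq_one hε (by simp; linarith)
        rw [show cutρ ε (sqd 0 z) = 1 from this, mul_one]
    simp only [pohI]
    rw [hc, ring]
    set k := deriv smoothTransition (sqd 0 z / ε ^ 2 - 1) / ε ^ 2
    by_cases hz : z ∈ closedBall (0 : ℂ) b
    · have hW0 := (hW.pos z hz h0).le
      have hg : 0 ≤ v z ^ (p + 1) := rpow_nonneg (h.pos z (closedBall_subset_ball hb hz)).le _
      have hR := hW.radial z hz h0
      rw [hi2, indicator_of_mem hz]
      have o0 := outρ_nonneg (a := a) (b := b) (sqd 0 z)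
      have o1 := outρ_le_one (a := a) (b := b) (sqd 0 z)
      have o' := outρ'_nonpos ha.le hab (sqd 0 z)
      have c0 : 0 ≤ cutρ ε (sqd 0 z) := cut_nonneg ε z
      have c1 : cutρ ε (sqd 0 z) ≤ 1 := cut_le_one ε z
      set o := outρ a b (sqd 0 z)
      set S := sqd 0 z
      set N := dx v z ^ 2 + dy v z ^ 2
      set g := v z ^ (p + 1) / (p + 1) with hgdef
      have g0 : 0 ≤ g := by positivity
      have t1 : 2 * (o * k) * pohE v z ≤ 12 * C * (ringBump ε z * N) := by
        calc 2 * (o * k) * pohE v z ≤ |2 * (o * k) * pohE v z| := le_abs_self _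
          _ = 2 * o * (|k| * |pohE v z|) := by
            rw [abs_mul, abs_mul, abs_mul, abs_two, abs_of_nonneg o0]; ring
          _ ≤ 2 * 1 * (|k| * (3 / 2 * (S * N))) := by
            gcongr; exact abs_pohE_le v z
          _ = 3 * N * (|k| * S) := by ring
          _ ≤ 3 * N * (4 * C * ringBump ε z) := by gcongr
          _ = _ := by ring
      have t2 : 2 * outρ' a b S * (S * (W z * g)) ≤ 0 :=
        mul_nonpos_of_nonpos_of_nonneg (by linarith) (by positivity)
      have t3 : 2 * (o * k) * (S * (W z * g)) ≤ 8 * C * (W z * g) := by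
        have : k * S ≤ 4 * C := by
          calc k * S ≤ |k| * S := by gcongr; exact le_abs_self _
            _ ≤ 4 * C * ringBump ε z := hk2
            _ ≤ 4 * C * 1 := by gcongr
            _ = _ := by ring
        have h3 : o * (k * S) ≤ 4 * C := by nlinarith
        calc _ = 2 * (o * (k * S)) * (W z * g) := by ring
          _ ≤ 2 * (4 * C) * (W z * g) := by gcongr
          _ = _ := by ring
      have t4 : o * cutρ ε S * ((z.re * dx W z + z.im * dy W z + 2 * W z) * g)
          ≤ (C₀ + 2) * (W z * g) := by
        have q : z.re * dx W z + z.im * dy W z + 2 * W z ≤ (C₀ + 2) * W z := by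
          linarith [le_abs_self (z.re * dx W z + z.im * dy W z)]
        have oc : 0 ≤ o * cutρ ε S := by positivity
        have oc1 : o * cutρ ε S ≤ 1 := mul_le_one₀ o1 c0 c1
        calc _ ≤ o * cutρ ε S * (((C₀ + 2) * W z) * g) := by gcongr
          _ ≤ 1 * (((C₀ + 2) * W z) * g) := by gcongr
          _ = _ := by ring
      have e : (8 * C + C₀ + 2) / (p + 1) * (W z * v z ^ (p + 1))
          = (8 * C + C₀ + 2) * (W z * g) := by rw [hgdef]; ring
      rw [e]
      have t5 : 2 * outρ' a b S * (S * (W z * g)) = S * (2 * outρ' a b S * (W z * g)) := by ring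
      linarith
    · have hz' : b ^ 2 < sqd 0 z := by
        rw [mem_closedBall_iff_sqd (ha.trans hab)] at hz; linarith
      rw [hi2, indicator_of_notMem hz, outρ'_eq_zero ha.le hab (Or.inr hz'),
        outρ_eq_zero ha.le hab hz'.le]
      simp only [mul_zero, zero_mul, add_zero, sub_zero]
      positivity
  refine hle.trans ?_
  have i12 : Integrable (fun z => 12 * C * (ringBump ε z * (dx v z ^ 2 + dy v z ^ 2)) + i2 z) :=
    (hNi.const_mul _).add i2i
  rw [integral_sub i12 hPi, hP, sub_zero,
    integral_add (hNi.const_mul _) i2i, integral_const_mul, hi2,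
    integral_indicator measurableSet_closedBall, integral_const_mul]
  have : 12 * C * (δ / (12 * C)) = δ := by field_simp
  have h3 : 12 * C * ∫ z, ringBump ε z * (dx v z ^ 2 + dy v z ^ 2) ≤ 12 * C * (δ / (12 * C)) := by
    gcongr
  linarith

/-- The mass is a radial flux through the annulus. -/
lemma IsSol.flux {W v : ℂ → ℝ} {p β C₀ : ℝ} (h : IsSol W v p) (hW : IsWeight W b β C₀)
    (ha : 0 < a) (hab : a < b) :
    Integrable (fun z => ring a b z * (z.re * dx v z + z.im * dy v z)) ∧
    ∫ z, outρ a b (sqd 0 z) * (W z * v z ^ p)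
      = -∫ z, ring a b z * (z.re * dx v z + z.im * dy v z) := by
  have hIi : Integrable (fun z => ring a b z * (z.re * dx v z + z.im * dy v z)) :=
    h.integrable_ring_mul ha hab hW.r_lt fun z _ hv =>
      (contDiff_re.contDiffAt.mul (contDiffAt_dx hv)).add
        (contDiff_im.contDiffAt.mul (contDiffAt_dy hv))
  refine ⟨hIi, ?_⟩
  set χ : ℂ → ℝ := fun z => outρ a b (sqd 0 z) with hχ
  have hχ2 : ContDiff ℝ 2 χ := (contDiff_outρ a b).comp (contDiff_sqd 0)
  rw [h.weak_form hW hχ2 (tsupport_outρ ha.le hab)]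
  have hdx : dx χ = fun z => ring a b z * (-z.re) := by
    ext z; rw [hχ, dx_radial (hasDerivAt_outρ a b _), ring]; simp
  have hdy : dy χ = fun z => ring a b z * (-z.im) := by
    ext z; rw [hχ, dy_radial (hasDerivAt_outρ a b _), ring]; simp
  have hvz : ∀ z ∈ tsupport (ring a b), ContDiffAt ℝ 2 v z := fun z hz => by
    have hz' := tsupport_ring ha.le hab hz
    refine h.contDiffAt z (by simpa using hz'.2.trans_lt hW.r_lt) ?_
    rintro rfl; have := hz'.1; simp at this; linarith
  obtain ⟨di, d0⟩ := integral_div_mul_eq_zero (contDiff_ring (a := a) (b := b))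
    (hasCompactSupport_ring ha.le hab) (P := fun z => v z * (-z.re)) (Q := fun z => v z * (-z.im))
    (fun z hz => ((hvz z hz).of_le one_le_two).mul contDiff_re.contDiffAt.neg)
    (fun z hz => ((hvz z hz).of_le one_le_two).mul contDiff_im.contDiffAt.neg)
  have key : ∀ z, v z * lapC χ z = (dx (fun y => ring a b y * (v y * (-y.re))) z
      + dy (fun y => ring a b y * (v y * (-y.im))) z)
      + ring a b z * (z.re * dx v z + z.im * dy v z) := by
    intro z
    have ex : (fun y => ring a b y * (v y * (-y.re))) = fun y => v y * dx χ y := by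
      rw [hdx]; ext y; ring
    have ey : (fun y => ring a b y * (v y * (-y.im))) = fun y => v y * dy χ y := by
      rw [hdy]; ext y; ring
    rw [ex, ey]
    by_cases hz : z ∈ tsupport (ring a b)
    · have hd := (hvz z hz).differentiableAt two_ne_zero
      rw [dx_mul hd (differentiableAt_dx hχ2.contDiffAt),
        dy_mul hd (differentiableAt_dy hχ2.contDiffAt), lapC, hdx, hdy]
      ring
    · have hev := eventuallyEq_zero_of_notMem_tsupport hz
      have q1 : dx χ =ᶠ[𝓝 z] fun _ => 0 := by
        rw [hdx]; filter_upwards [hev] with y hy; simp [hy]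
      have q2 : dy χ =ᶠ[𝓝 z] fun _ => 0 := by
        rw [hdy]; filter_upwards [hev] with y hy; simp [hy]
      have q3 : (fun y => v y * dx χ y) =ᶠ[𝓝 z] fun _ => 0 := by
        filter_upwards [q1] with y hy; simp [hy]
      have q4 : (fun y => v y * dy χ y) =ᶠ[𝓝 z] fun _ => 0 := by
        filter_upwards [q2] with y hy; simp [hy]
      rw [lapC, dx, q1.fderiv_eq, dy, q2.fderiv_eq, dx, q3.fderiv_eq, dy, q4.fderiv_eq,
        hev.eq_of_nhds]
      simp
  simp_rw [key]
  rw [integral_add di hIi, d0, zero_add]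

end Annulus

lemma IsSol.integrable_outρ_mul {W v : ℂ → ℝ} {p β C₀ a b : ℝ} (h : IsSol W v p)
    (hW : IsWeight W b β C₀) (ha : 0 < a) (hab : a < b) :
    Integrable (fun z => outρ a b (sqd 0 z) * (W z * v z ^ p)) := by
  have h1 : IntegrableOn (fun z => outρ a b (sqd 0 z) * (W z * v z ^ p)) (closedBall 0 b) := by
    refine (h.integrableOn hW p).bdd_mul (c := 1) ?_ ?_
    · exact ((contDiff_outρ a b (n := 2)).continuous.comp
        (contDiff_sqd 0 (n := 2)).continuous).aestronglyMeasurable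
    · filter_upwards with z
      rw [norm_of_nonneg (outρ_nonneg _)]; exact outρ_le_one _
  refine (integrableOn_iff_integrable_of_support_subset fun z hz => ?_).mp h1
  refine tsupport_outρ ha.le hab (subset_tsupport _ fun h0 => hz ?_)
  simp only at h0 ⊢
  rw [h0, zero_mul]

lemma IsSol.nonneg_mul_rpow {W v : ℂ → ℝ} {p q β C₀ r : ℝ} (h : IsSol W v p)
    (hW : IsWeight W r β C₀) {z : ℂ} (hz : z ∈ closedBall (0 : ℂ) r) (h0 : z ≠ 0) :
    0 ≤ W z * v z ^ q :=
  mul_nonneg (hW.pos z hz h0).le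
    (rpow_nonneg (h.pos z (closedBall_subset_ball hW.r_lt hz)).le _)

/-- Pohozaev estimate: `p` times the mass is bounded linearly by the maximum. -/
lemma exists_mul_mass_le {a b : ℝ} (ha : 0 < a) (hab : a < b) (hb : b < 1) {C₀ C₁ c : ℝ}
    (hC₀ : 0 < C₀) (hC₁ : 0 < C₁) (hc : 0 < c) :
    ∃ C > 0, ∀ (W v : ℂ → ℝ) (p β M : ℝ), 0 < p → IsSol W v p → IsWeight W b β C₀ →
      (∀ z, a ≤ ‖z‖ → ‖z‖ ≤ b → c * (sqd 0 z * (dx v z ^ 2 + dy v z ^ 2)) ≤ pohE v z) →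
      (∀ z ∈ closedBall (0 : ℂ) b, v z ≤ M) →
      ∫ z in closedBall (0 : ℂ) b, W z * v z ^ p
        ≤ C₁ * ∫ z in closedBall (0 : ℂ) a, W z * v z ^ p →
      p * ∫ z in closedBall (0 : ℂ) a, W z * v z ^ p ≤ C * M := by
  obtain ⟨C, hC, hA⟩ := exists_pohozaev_bound ha hab hb hC₀
  set B := ∫ z, ring a b z with hB
  have hB0 : 0 ≤ B := integral_nonneg fun z => ring_nonneg ha.le hab z
  refine ⟨B * C * C₁ / c + 1, by positivity, fun W v p β M hp h hW hcone hM hmass => ?_⟩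
  have hM0 : 0 < M :=
    (h.pos 0 (by simp)).trans_le (hM 0 (by simpa using (ha.trans hab).le))
  set m := ∫ z in closedBall (0 : ℂ) a, W z * v z ^ p with hm
  have hm0 : 0 ≤ m := by
    refine integral_nonneg_of_ae ?_
    filter_upwards [ae_restrict_of_ae ae_ne_zero, ae_restrict_mem measurableSet_closedBall]
      with z h0 hz
    exact h.nonneg_mul_rpow hW (closedBall_subset_closedBall hab.le hz) h0
  obtain ⟨hfi, hflux⟩ := h.flux hW ha hab
  have hA' := hA W v p β hp h hW
  set A := ∫ z, ring a b z * pohE v z with hAdef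
  have hAm : A ≤ C / (p + 1) * (M * (C₁ * m)) := by
    refine hA'.trans ?_
    gcongr
    refine le_trans ?_ (mul_le_mul_of_nonneg_left hmass hM0.le)
    rw [← integral_const_mul]
    refine setIntegral_mono_ae_restrict (h.integrableOn hW _) ((h.integrableOn hW _).const_mul _) ?_
    filter_upwards [ae_restrict_of_ae ae_ne_zero, ae_restrict_mem measurableSet_closedBall]
      with z h0 hz
    have hv := h.pos z (closedBall_subset_ball hb hz)
    have := h.nonneg_mul_rpow (q := p) hW hz h0
    rw [rpow_add_one hv.ne']
    nlinarith [hM z hz]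
  have hmχ : m ≤ ∫ z, outρ a b (sqd 0 z) * (W z * v z ^ p) := by
    have hχi := h.integrable_outρ_mul hW ha hab
    have hχ0 : ∀ᵐ z, 0 ≤ outρ a b (sqd 0 z) * (W z * v z ^ p) := by
      filter_upwards [ae_ne_zero] with z h0
      by_cases hz : z ∈ closedBall (0 : ℂ) b
      · exact mul_nonneg (outρ_nonneg _) (h.nonneg_mul_rpow hW hz h0)
      · rw [outρ_eq_zero ha.le hab, zero_mul]
        rw [mem_closedBall_iff_sqd (ha.trans hab)] at hz; linarith
    refine le_trans (le_of_eq ?_) (setIntegral_le_integral (s := closedBall 0 a) hχi hχ0)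
    refine setIntegral_congr_fun measurableSet_closedBall fun z hz => ?_
    rw [outρ_eq_one ha.le hab ((mem_closedBall_iff_sqd ha).mp hz), one_mul]
  set δ := c * p / (C * C₁ * M) with hδ
  have hδ0 : 0 < δ := by positivity
  have hEi := h.integrable_ring_pohE ha hab hb
  have hRi : Integrable (ring a b) :=
    contDiff_ring.continuous.integrable_of_hasCompactSupport (hasCompactSupport_ring ha.le hab)
  have hle : ∫ z, outρ a b (sqd 0 z) * (W z * v z ^ p) ≤ δ / (2 * c) * A + 1 / (2 * δ) * B := by
    rw [hflux, ← integral_neg, hAdef, hB, ← integral_const_mul, ← integral_const_mul,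
      ← integral_add (hEi.const_mul _) (hRi.const_mul _)]
    refine integral_mono hfi.neg ((hEi.const_mul _).add (hRi.const_mul _)) fun z => ?_
    simp only
    by_cases hz : z ∈ tsupport (ring a b)
    · have hz' := tsupport_ring ha.le hab hz
      have h1 := hcone z hz'.1 hz'.2
      have h2 := sq_radial_le v z
      set H := z.re * dx v z + z.im * dy v z
      have h3 : c * H ^ 2 ≤ pohE v z := le_trans (by gcongr) h1
      have h4 : -H ≤ δ / (2 * c) * pohE v z + 1 / (2 * δ) := by
        have : δ / (2 * c) * (c * H ^ 2) ≤ δ / (2 * c) * pohE v z := by gcongr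
        have e : δ / (2 * c) * (c * H ^ 2) + 1 / (2 * δ) + H = (δ * H + 1) ^ 2 / (2 * δ) := by
          field_simp; ring
        have : 0 ≤ (δ * H + 1) ^ 2 / (2 * δ) := by positivity
        linarith
      have := mul_le_mul_of_nonneg_left h4 (ring_nonneg ha.le hab z)
      calc _ = ring a b z * -H := by ring
        _ ≤ _ := this
        _ = _ := by ring
    · rw [image_eq_zero_of_notMem_tsupport hz]; simp
  have h5 : δ / (2 * c) * A ≤ m / 2 := by
    calc δ / (2 * c) * A ≤ δ / (2 * c) * (C / (p + 1) * (M * (C₁ * m))) := by gcongr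
      _ = p / (p + 1) * (m / 2) := by rw [hδ]; field_simp
      _ ≤ 1 * (m / 2) := by gcongr; rw [div_le_one (by positivity)]; linarith
      _ = _ := one_mul _
  have h6 : m ≤ B / δ := by
    have : 1 / (2 * δ) * B = B / δ / 2 := by field_simp
    linarith
  calc p * m ≤ p * (B / δ) := by gcongr
    _ = B * C * C₁ / c * M := by rw [hδ]; field_simp
    _ ≤ _ := by gcongr; linarith

lemma hasDerivAt_ite_lt {f g : ℝ → ℝ} {f' g' : ℝ → ℝ} {c : ℝ}
    (hf : ∀ s, s ≤ c → HasDerivAt f (f' s) s) (hg : ∀ s, c ≤ s → HasDerivAt g (g' s) s)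
    (h : f c = g c) (h' : f' c = g' c) (s : ℝ) :
    HasDerivAt (fun s => if s < c then f s else g s) (if s < c then f' s else g' s) s := by
  rcases lt_trichotomy s c with hs | rfl | hs
  · rw [if_pos hs]
    refine (hf s hs.le).congr_of_eventuallyEq ?_
    filter_upwards [gt_mem_nhds hs] with y hy
    rw [if_pos hy]
  · rw [if_neg (lt_irrefl _)]
    have h1 : HasDerivWithinAt (fun y => if y < s then f y else g y) (g' s) (Iic s) s := by
      rw [← h']
      refine (hf s le_rfl).hasDerivWithinAt.congr (fun y hy => ?_) (by simp [h])
      rcases eq_or_lt_of_le (show y ≤ s from hy) with rfl | hy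
      · simp [h]
      · simp [hy]
    have h2 : HasDerivWithinAt (fun y => if y < s then f y else g y) (g' s) (Ici s) s := by
      refine (hg s le_rfl).hasDerivWithinAt.congr (fun y hy => ?_) (by simp)
      rw [if_neg (not_lt.mpr hy)]
    have := h1.union h2
    rwa [Iic_union_Ici, hasDerivWithinAt_univ] at this
  · rw [if_neg hs.not_gt]
    refine (hg s hs.le).congr_of_eventuallyEq ?_
    filter_upwards [lt_mem_nhds hs] with y hy
    rw [if_neg (not_lt.mpr hy.le)]

/-- `log`, regularised inside the unit interval so that `s ↦ logReg s` is `C²`. -/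
def logReg (s : ℝ) : ℝ := if s < 1 then -(1 - s) - (1 - s) ^ 2 / 2 else log s

def logReg' (s : ℝ) : ℝ := if s < 1 then 2 - s else s⁻¹

def logReg'' (s : ℝ) : ℝ := if s < 1 then -1 else -(s ^ 2)⁻¹

lemma hasDerivAt_logReg (s : ℝ) : HasDerivAt logReg (logReg' s) s := by
  refine hasDerivAt_ite_lt (f' := fun s => 2 - s) (g' := fun s => s⁻¹) (fun s _ => ?_)
    (fun s hs => ?_) (by simp) (by norm_num) s
  · have h1 := (hasDerivAt_id s).const_sub 1
    exact (h1.neg.sub ((h1.pow 2).div_const 2)).congr_deriv (by simp; ring)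
  · exact hasDerivAt_log (by linarith)

lemma hasDerivAt_logReg' (s : ℝ) : HasDerivAt logReg' (logReg'' s) s := by
  refine hasDerivAt_ite_lt (f' := fun _ => -1) (g' := fun s => -(s ^ 2)⁻¹) (fun s _ => ?_)
    (fun s hs => ?_) (by norm_num) (by norm_num) s
  · exact ((hasDerivAt_id s).const_sub 2).congr_deriv (by simp)
  · exact hasDerivAt_inv (by linarith)

lemma continuous_logReg'' : Continuous logReg'' := by
  have : logReg'' = fun s => -((max s 1) ^ 2)⁻¹ := by
    ext s; rw [logReg'']; split_ifs with h
    · rw [max_eq_right h.le]; norm_num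
    · rw [max_eq_left (not_lt.mp h)]
  rw [this]
  refine (Continuous.inv₀ (by fun_prop) fun s => ?_).neg
  have : (1 : ℝ) ≤ max s 1 := le_max_right _ _
  positivity

lemma contDiff_logReg : ContDiff ℝ 2 logReg := by
  have e1 : deriv logReg = logReg' := funext fun s => (hasDerivAt_logReg s).deriv
  have e2 : deriv logReg' = logReg'' := funext fun s => (hasDerivAt_logReg' s).deriv
  rw [show (2 : ℕ∞ω) = 1 + 1 by norm_num, contDiff_succ_iff_deriv, e1]
  refine ⟨fun s => (hasDerivAt_logReg s).differentiableAt, by simp, ?_⟩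
  rw [contDiff_one_iff_deriv, e2]
  exact ⟨fun s => (hasDerivAt_logReg' s).differentiableAt, continuous_logReg''⟩

/-- Difference of regularised logarithms at two consecutive dyadic scales. -/
def logDiff (t : ℝ) : ℝ := logReg t - logReg (4 * t) + log 4

lemma log_four_bounds : 1.38 < log 4 ∧ log 4 < 2 := by
  have : log 4 = 2 * log 2 := by
    rw [show (4 : ℝ) = 2 ^ 2 by norm_num, log_pow]; norm_num
  have := log_two_gt_d9
  have := log_two_lt_d9
  constructor <;> linarith

lemma log_le_logReg {t : ℝ} (h0 : 0 < t) : log t ≤ logReg t := by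
  rw [logReg]; split_ifs with h
  · have := sum_le_hasSum (Finset.range 2) (fun i _ => by have : 0 < 1 - t := by linarith
                                                          positivity)
      (hasSum_pow_div_log_of_abs_lt_one (x := 1 - t) (by rw [abs_lt]; constructor <;> linarith))
    simp [Finset.sum_range_succ] at this
    norm_num at this
    linarith
  · exact le_rfl

lemma logDiff_eq_zero {t : ℝ} (h : 1 ≤ t) : logDiff t = 0 := by
  rw [logDiff, logReg, logReg, if_neg (by linarith), if_neg (by linarith),
    log_mul (by norm_num) (by linarith)]
  ring

lemma logDiff_mem {t : ℝ} (h : 0 ≤ t) : 0 ≤ logDiff t ∧ logDiff t ≤ 2 := by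
  have h4 := log_four_bounds
  rcases le_or_gt 1 t with h1 | h1
  · rw [logDiff_eq_zero h1]; norm_num
  rcases lt_or_ge (4 * t) 1 with h2 | h2
  · rw [logDiff, logReg, logReg, if_pos h1, if_pos h2]
    constructor <;> nlinarith
  · have h5 := log_le_logReg (t := t) (by linarith)
    have h6 : logReg (4 * t) = log t + log 4 := by
      rw [logReg, if_neg (by linarith), log_mul (by norm_num) (by linarith)]; ring
    have h7 : logReg t ≤ 0 := by rw [logReg, if_pos h1]; nlinarith
    have h8 : -log 4 ≤ log t := by
      rw [← log_inv]; exact log_le_log (by norm_num) (by linarith)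
    rw [logDiff, h6]
    constructor <;> linarith

lemma one_le_four_mul_logDiff {t : ℝ} (h0 : 0 ≤ t) (h : t ≤ 1 / 4) : 1 / 4 ≤ logDiff t := by
  have h4 := log_four_bounds
  rcases eq_or_lt_of_le h with rfl | h2
  · rw [logDiff, logReg, logReg, if_pos (by norm_num), if_neg (by norm_num)]
    norm_num; linarith
  · rw [logDiff, logReg, logReg, if_pos (by linarith), if_pos (by linarith)]
    nlinarith

lemma contDiff_logDiff : ContDiff ℝ 2 logDiff :=
  (contDiff_logReg.sub (contDiff_logReg.comp (contDiff_const.mul contDiff_id))).add contDiff_const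

lemma lapC_logReg (μ : ℝ) (x z : ℂ) :
    lapC (fun y => logReg (μ * sqd x y)) z = 8 * μ * max (1 - μ * sqd x z) 0 := by
  have h1 : ∀ s, HasDerivAt (fun s => logReg (μ * s)) (μ * logReg' (μ * s)) s := fun s =>
    ((hasDerivAt_logReg (μ * s)).comp s ((hasDerivAt_id s).const_mul μ)).congr_deriv (by simp; ring)
  have h2 : ∀ s, HasDerivAt (fun s => μ * logReg' (μ * s)) (μ * (μ * logReg'' (μ * s))) s := fun s =>
    (((hasDerivAt_logReg' (μ * s)).comp s ((hasDerivAt_id s).const_mul μ)).const_mul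
      μ).congr_deriv (by ring)
  rw [lapC_radial (ρ := fun s => logReg (μ * s)) (Eventually.of_forall h1) (h2 _), logReg', logReg'']
  split_ifs with h
  · rw [max_eq_left (by linarith)]; ring
  · rw [max_eq_right (by linarith)]
    have : μ * sqd x z ≠ 0 := by linarith
    have h3 : μ ≠ 0 := left_ne_zero_of_mul this
    have h4 : sqd x z ≠ 0 := right_ne_zero_of_mul this
    field_simp; ring

/-- Test function adapted to the disc of radius `ρ` around `x`. -/
def logBump (x : ℂ) (ρ : ℝ) (z : ℂ) : ℝ := logDiff ((ρ ^ 2)⁻¹ * sqd x z)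

lemma contDiff_logBump (x : ℂ) (ρ : ℝ) : ContDiff ℝ 2 (logBump x ρ) :=
  contDiff_logDiff.comp (contDiff_const.mul (contDiff_sqd x))

/-- Normalised kernel of the averages. -/
def avgKer (x : ℂ) (ρ : ℝ) (z : ℂ) : ℝ := 8 * (ρ ^ 2)⁻¹ * max (1 - (ρ ^ 2)⁻¹ * sqd x z) 0

lemma lapC_logBump (x : ℂ) (ρ : ℝ) (z : ℂ) :
    lapC (logBump x ρ) z = avgKer x ρ z - avgKer x (ρ / 2) z := by
  have c1 : ∀ μ : ℝ, ContDiffAt ℝ 2 (fun y => logReg (μ * sqd x y)) z := fun μ =>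
    (contDiff_logReg.comp (contDiff_const.mul (contDiff_sqd x))).contDiffAt
  have e : logBump x ρ = fun y => (logReg ((ρ ^ 2)⁻¹ * sqd x y)
      - logReg (((ρ / 2) ^ 2)⁻¹ * sqd x y)) + log 4 := by
    ext y
    have : ((ρ / 2) ^ 2)⁻¹ = 4 * (ρ ^ 2)⁻¹ := by rw [div_pow, inv_div]; ring
    rw [logBump, logDiff, this, ← mul_assoc]
  rw [e, lapC_add ((c1 _).sub (c1 _)) contDiffAt_const, lapC_const, lapC_sub (c1 _) (c1 _),
    lapC_logReg, lapC_logReg, avgKer, avgKer, add_zero]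

lemma logBump_mem (x : ℂ) (ρ : ℝ) (z : ℂ) : 0 ≤ logBump x ρ z ∧ logBump x ρ z ≤ 2 :=
  logDiff_mem (mul_nonneg (by positivity) (sqd_nonneg _ _))

lemma logBump_eq_zero {x z : ℂ} {ρ : ℝ} (hρ : 0 < ρ) (h : z ∉ ball x ρ) : logBump x ρ z = 0 := by
  refine logDiff_eq_zero ?_
  rw [mem_ball_iff_sqd hρ, not_lt] at h
  rw [inv_mul_eq_div, one_le_div (by positivity)]; exact h

lemma le_logBump {x z : ℂ} {ρ : ℝ} (hρ : 0 < ρ) (h : z ∈ closedBall x (ρ / 2)) :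
    1 / 4 ≤ logBump x ρ z := by
  refine one_le_four_mul_logDiff (mul_nonneg (by positivity) (sqd_nonneg _ _)) ?_
  rw [mem_closedBall_iff_sqd (by positivity)] at h
  rw [inv_mul_eq_div, div_le_iff₀ (by positivity)]; linarith

lemma tsupport_logBump (x : ℂ) {ρ : ℝ} (hρ : 0 < ρ) : tsupport (logBump x ρ) ⊆ closedBall x ρ :=
  closure_minimal (fun z hz => by
    by_contra h
    exact hz (logBump_eq_zero hρ fun h' => h (ball_subset_closedBall h'))) isClosed_closedBall

lemma avgKer_nonneg (x : ℂ) (ρ : ℝ) (z : ℂ) : 0 ≤ avgKer x ρ z := by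
  rw [avgKer]; positivity

lemma continuous_avgKer (x : ℂ) (ρ : ℝ) : Continuous (avgKer x ρ) := by
  have := (contDiff_sqd x (n := 0)).continuous
  unfold avgKer; fun_prop

lemma avgKer_eq_zero {x z : ℂ} {ρ : ℝ} (hρ : 0 < ρ) (h : z ∉ ball x ρ) : avgKer x ρ z = 0 := by
  rw [mem_ball_iff_sqd hρ, not_lt] at h
  rw [avgKer, max_eq_right, mul_zero]
  rw [sub_nonpos, inv_mul_eq_div, one_le_div (by positivity)]; exact h

lemma tsupport_avgKer (x : ℂ) {ρ : ℝ} (hρ : 0 < ρ) : tsupport (avgKer x ρ) ⊆ closedBall x ρ :=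
  closure_minimal (fun z hz => by
    by_contra h
    exact hz (avgKer_eq_zero hρ fun h' => h (ball_subset_closedBall h'))) isClosed_closedBall

lemma hasCompactSupport_avgKer (x : ℂ) {ρ : ℝ} (hρ : 0 < ρ) : HasCompactSupport (avgKer x ρ) :=
  (isCompact_closedBall x ρ).of_isClosed_subset (isClosed_tsupport _) (tsupport_avgKer x hρ)

/-- Weighted average of `v` over the disc of radius `ρ` around `x`, up to normalisation. -/
def avg (v : ℂ → ℝ) (x : ℂ) (ρ : ℝ) : ℝ := ∫ z, v z * avgKer x ρ z

/-- Total mass of the averaging kernels. -/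
def kap : ℝ := ∫ z, avgKer 0 1 z

lemma integrable_avgKer (x : ℂ) {ρ : ℝ} (hρ : 0 < ρ) : Integrable (avgKer x ρ) :=
  (continuous_avgKer x ρ).integrable_of_hasCompactSupport (hasCompactSupport_avgKer x hρ)

lemma kap_pos : 0 < kap :=
  (continuous_avgKer 0 1).integral_pos_of_hasCompactSupport_nonneg_nonzero
    (hasCompactSupport_avgKer 0 one_pos) (fun z => avgKer_nonneg 0 1 z) (x := 0)
    (by simp [avgKer, sqd])

lemma integral_avgKer (x : ℂ) {ρ : ℝ} (hρ : 0 < ρ) : ∫ z, avgKer x ρ z = kap := by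
  have e : ∀ z, avgKer x ρ z = (ρ ^ 2)⁻¹ * avgKer 0 1 (ρ⁻¹ • (z - x)) := fun z => by
    rw [avgKer, avgKer, sqd_eq, sqd_eq, sub_zero, norm_smul, mul_pow, norm_inv, inv_pow,
      norm_of_nonneg hρ.le]
    ring_nf
  simp_rw [e]
  rw [integral_const_mul, integral_sub_right_eq_self (fun z => avgKer 0 1 (ρ⁻¹ • z)) x,
    Measure.integral_comp_inv_smul, Complex.finrank_real_complex, abs_of_nonneg (by positivity),
    smul_eq_mul, ← mul_assoc, inv_mul_cancel₀ (by positivity), one_mul, kap]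

lemma integrable_mul_avgKer {v : ℂ → ℝ} (hv : ContinuousOn v (ball 0 1)) {x : ℂ} {ρ : ℝ}
    (hρ : 0 < ρ) (hs : closedBall x ρ ⊆ ball 0 1) : Integrable (fun z => v z * avgKer x ρ z) :=
  (continuous_mul_of_tsupport isOpen_ball hv (continuous_avgKer x ρ)
    ((tsupport_avgKer x hρ).trans hs)).integrable_of_hasCompactSupport
    (hasCompactSupport_avgKer x hρ).mul_left

lemma abs_avg_sub_le {v : ℂ → ℝ} (hv : ContinuousOn v (ball 0 1)) {x : ℂ} {ρ ε : ℝ}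
    (hρ : 0 < ρ) (hs : closedBall x ρ ⊆ ball 0 1) (h : ∀ z ∈ ball x ρ, |v z - v x| ≤ ε) :
    |avg v x ρ - kap * v x| ≤ ε * kap := by
  have i1 := integrable_mul_avgKer hv hρ hs
  have i2 := integrable_avgKer x hρ
  have e : avg v x ρ - kap * v x = ∫ z, (v z * avgKer x ρ z - v x * avgKer x ρ z) := by
    rw [integral_sub i1 (i2.const_mul _), integral_const_mul, integral_avgKer x hρ, avg, mul_comm]
  rw [e, ← Real.norm_eq_abs]
  refine (norm_integral_le_integral_norm _).trans ?_
  rw [← integral_avgKer x hρ, ← integral_const_mul]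
  refine integral_mono (i1.sub (i2.const_mul _)).norm (i2.const_mul _) fun z => ?_
  simp only
  rw [← sub_mul, norm_mul, norm_of_nonneg (avgKer_nonneg x ρ z), Real.norm_eq_abs]
  by_cases hz : z ∈ ball x ρ
  · exact mul_le_mul_of_nonneg_right (h z hz) (avgKer_nonneg x ρ z)
  · rw [avgKer_eq_zero hρ hz]; simp

lemma tendsto_avg {v : ℂ → ℝ} (hv : ContinuousOn v (ball 0 1)) {x : ℂ} (hx : x ∈ ball (0 : ℂ) 1)
    (ρ : ℝ) (hρ : 0 < ρ) : Tendsto (fun n : ℕ => avg v x (ρ / 2 ^ n)) atTop (𝓝 (kap * v x)) := by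
  have hk := kap_pos
  have hcx := hv.continuousAt (isOpen_ball.mem_nhds hx)
  have hlim : Tendsto (fun n : ℕ => ρ / 2 ^ n) atTop (𝓝 0) :=
    tendsto_const_nhds.div_atTop (tendsto_pow_atTop_atTop_of_one_lt one_lt_two)
  rw [Metric.tendsto_atTop]
  intro ε hε
  obtain ⟨δ, hδ, hδv⟩ := Metric.continuousAt_iff.mp hcx (ε / (2 * kap)) (by positivity)
  obtain ⟨δ', hδ', hδb⟩ := Metric.isOpen_iff.mp (isOpen_ball (x := (0 : ℂ)) (ε := 1)) x hx
  obtain ⟨N, hN⟩ := Metric.tendsto_atTop.mp hlim (min δ δ') (lt_min hδ hδ')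
  refine ⟨N, fun n hn => ?_⟩
  have h1 := hN n hn
  have hp : 0 < ρ / 2 ^ n := by positivity
  rw [Real.dist_eq, sub_zero, abs_of_pos hp, lt_min_iff] at h1
  have := abs_avg_sub_le hv hp ((closedBall_subset_ball h1.2).trans hδb) (ε := ε / (2 * kap))
    fun z hz => (hδv ((mem_ball.mp hz).trans h1.1)).le
  rw [Real.dist_eq]
  refine this.trans_lt ?_
  rw [show ε / (2 * kap) * kap = ε / 2 by field_simp]; linarith

/-- Mass of `W v ^ p` in a disc. -/
def mass (W v : ℂ → ℝ) (p : ℝ) (x : ℂ) (ρ : ℝ) : ℝ := ∫ z in closedBall x ρ, W z * v z ^ p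

section
variable {W v : ℂ → ℝ} {p r β C₀ : ℝ}

lemma IsSol.ae_nonneg (h : IsSol W v p) (hW : IsWeight W r β C₀) {s : Set ℂ}
    (hs : s ⊆ closedBall 0 r) (hm : MeasurableSet s) (q : ℝ) :
    ∀ᵐ z ∂(volume.restrict s), 0 ≤ W z * v z ^ q := by
  filter_upwards [ae_restrict_of_ae ae_ne_zero, ae_restrict_mem hm] with z h0 hz
  exact h.nonneg_mul_rpow hW (hs hz) h0

lemma IsSol.mass_nonneg (h : IsSol W v p) (hW : IsWeight W r β C₀) {x : ℂ} {ρ : ℝ}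
    (hs : closedBall x ρ ⊆ closedBall 0 r) : 0 ≤ mass W v p x ρ :=
  integral_nonneg_of_ae (h.ae_nonneg hW hs measurableSet_closedBall p)

lemma IsSol.mass_mono (h : IsSol W v p) (hW : IsWeight W r β C₀) {x y : ℂ} {ρ σ : ℝ}
    (hs : closedBall y σ ⊆ closedBall 0 r) (hxy : closedBall x ρ ⊆ closedBall y σ) :
    mass W v p x ρ ≤ mass W v p y σ :=
  setIntegral_mono_set ((h.integrableOn hW p).mono_set hs)
    (h.ae_nonneg hW hs measurableSet_closedBall p) hxy.eventuallyLE

lemma IsSol.avg_half_sub (h : IsSol W v p) (hW : IsWeight W r β C₀) {x : ℂ} {ρ : ℝ} (hρ : 0 < ρ)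
    (hs : closedBall x ρ ⊆ closedBall 0 r) :
    avg v x (ρ / 2) - avg v x ρ = ∫ z, logBump x ρ z * (W z * v z ^ p) := by
  have hs1 : closedBall x ρ ⊆ ball 0 1 := hs.trans (closedBall_subset_ball hW.r_lt)
  have i1 := integrable_mul_avgKer h.continuousOn hρ hs1
  have i2 := integrable_mul_avgKer (ρ := ρ / 2) h.continuousOn (by positivity)
    ((closedBall_subset_closedBall (by linarith)).trans hs1)
  rw [h.weak_form hW (contDiff_logBump x ρ) ((tsupport_logBump x hρ).trans hs)]
  simp_rw [lapC_logBump, mul_sub]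
  rw [integral_sub i1 i2, avg, avg]; ring

lemma IsSol.integral_logBump_bounds (h : IsSol W v p) (hW : IsWeight W r β C₀) {x : ℂ} {ρ : ℝ}
    (hρ : 0 < ρ) (hs : closedBall x ρ ⊆ closedBall 0 r) :
    1 / 4 * mass W v p x (ρ / 2) ≤ ∫ z, logBump x ρ z * (W z * v z ^ p) ∧
    ∫ z, logBump x ρ z * (W z * v z ^ p) ≤ 2 * mass W v p x ρ := by
  have hfi := (h.integrableOn hW p).mono_set hs
  have hsub : closedBall x (ρ / 2) ⊆ closedBall x ρ := closedBall_subset_closedBall (by linarith)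
  have e : ∫ z, logBump x ρ z * (W z * v z ^ p)
      = ∫ z in closedBall x ρ, logBump x ρ z * (W z * v z ^ p) := by
    refine (setIntegral_eq_integral_of_forall_compl_eq_zero fun z hz => ?_).symm
    rw [logBump_eq_zero hρ fun h' => hz (ball_subset_closedBall h'), zero_mul]
  have hi : IntegrableOn (fun z => logBump x ρ z * (W z * v z ^ p)) (closedBall x ρ) := by
    refine hfi.bdd_mul (c := 2) (contDiff_logBump x ρ).continuous.aestronglyMeasurable ?_
    filter_upwards with z
    rw [norm_of_nonneg (logBump_mem x ρ z).1]; exact (logBump_mem x ρ z).2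
  have h0 := h.ae_nonneg hW hs measurableSet_closedBall p
  rw [e]
  constructor
  · rw [mass, ← integral_const_mul]
    refine le_trans ?_ (setIntegral_mono_set hi ?_ hsub.eventuallyLE)
    · refine setIntegral_mono_on_ae ((hfi.mono_set hsub).const_mul _) (hi.mono_set hsub)
        measurableSet_closedBall ?_
      filter_upwards [ae_ne_zero] with z hz0 hz
      exact mul_le_mul_of_nonneg_right (le_logBump hρ hz)
        (h.nonneg_mul_rpow hW (hs (hsub hz)) hz0)
    · filter_upwards [h0] with z hz using mul_nonneg (logBump_mem x ρ z).1 hz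
  · rw [mass, ← integral_const_mul]
    refine setIntegral_mono_ae_restrict hi (hfi.const_mul _) ?_
    filter_upwards [h0] with z hz using mul_le_mul_of_nonneg_right (logBump_mem x ρ z).2 hz

lemma IsSol.avg_bounds (h : IsSol W v p) (hW : IsWeight W r β C₀) {x : ℂ} {ρ : ℝ} (hρ : 0 < ρ)
    (hs : closedBall x ρ ⊆ closedBall 0 r) (N : ℕ) :
    avg v x ρ + 1 / 4 * ∑ j ∈ Finset.range N, mass W v p x (ρ / 2 ^ (j + 1)) ≤ avg v x (ρ / 2 ^ N) ∧
    avg v x (ρ / 2 ^ N) ≤ avg v x ρ + 2 * ∑ j ∈ Finset.range N, mass W v p x (ρ / 2 ^ j) := by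
  induction N with
  | zero => simp
  | succ N ih =>
    have hρN : 0 < ρ / 2 ^ N := by positivity
    have hsN : closedBall x (ρ / 2 ^ N) ⊆ closedBall 0 r :=
      (closedBall_subset_closedBall (div_le_self hρ.le (one_le_pow₀ one_le_two))).trans hs
    have h1 := h.avg_half_sub hW hρN hsN
    have h2 := h.integral_logBump_bounds hW hρN hsN
    have e : ρ / 2 ^ (N + 1) = ρ / 2 ^ N / 2 := by rw [pow_succ, div_div]
    rw [Finset.sum_range_succ, Finset.sum_range_succ, e]
    constructor <;> linarith [ih.1, ih.2, h2.1, h2.2]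

lemma IsSol.avg_add_le (h : IsSol W v p) (hW : IsWeight W r β C₀) {x : ℂ} {ρ : ℝ} (hρ : 0 < ρ)
    (hs : closedBall x ρ ⊆ closedBall 0 r) (N : ℕ) :
    avg v x ρ + 1 / 4 * ∑ j ∈ Finset.range N, mass W v p x (ρ / 2 ^ (j + 1)) ≤ kap * v x := by
  have hx : x ∈ ball (0 : ℂ) 1 := closedBall_subset_ball hW.r_lt (hs (mem_closedBall_self hρ.le))
  refine ge_of_tendsto (tendsto_avg h.continuousOn hx ρ hρ) ?_
  filter_upwards [eventually_ge_atTop N] with n hn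
  refine le_trans ?_ (h.avg_bounds hW hρ hs n).1
  gcongr with j
  intro j _ _
  exact h.mass_nonneg hW ((closedBall_subset_closedBall
    (div_le_self hρ.le (one_le_pow₀ one_le_two))).trans hs)

lemma IsSol.kap_mul_le (h : IsSol W v p) (hW : IsWeight W r β C₀) {x : ℂ} {ρ B : ℝ} (hρ : 0 < ρ)
    (hs : closedBall x ρ ⊆ closedBall 0 r)
    (hB : ∀ N, avg v x ρ + 2 * ∑ j ∈ Finset.range N, mass W v p x (ρ / 2 ^ j) ≤ B) :
    kap * v x ≤ B := by
  have hx : x ∈ ball (0 : ℂ) 1 := closedBall_subset_ball hW.r_lt (hs (mem_closedBall_self hρ.le))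
  exact le_of_tendsto (tendsto_avg h.continuousOn hx ρ hρ)
    (Eventually.of_forall fun n => (h.avg_bounds hW hρ hs n).2.trans (hB n))

lemma IsSol.avg_nonneg (h : IsSol W v p) {x : ℂ} {ρ : ℝ} (hρ : 0 < ρ)
    (hs : closedBall x ρ ⊆ ball 0 1) : 0 ≤ avg v x ρ := by
  refine integral_nonneg fun z => ?_
  by_cases hz : z ∈ ball x ρ
  · exact mul_nonneg (h.pos z (hs (ball_subset_closedBall hz))).le (avgKer_nonneg x ρ z)
  · simp [avgKer_eq_zero hρ hz]

end

lemma sum_inv_sqrt_le (n : ℕ) : ∑ j ∈ Finset.range n, (√(j + 1))⁻¹ ≤ 2 * √n := by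
  induction n with
  | zero => simp
  | succ n ih =>
    rw [Finset.sum_range_succ]
    push_cast
    have h1 : 0 < √((n : ℝ) + 1) := by positivity
    have h2 : √((n : ℝ) + 1) ^ 2 = n + 1 := sq_sqrt (by positivity)
    have h3 : √(n : ℝ) ^ 2 = n := sq_sqrt (by positivity)
    have h4 : (√((n : ℝ) + 1))⁻¹ ≤ 2 * (√((n : ℝ) + 1) - √n) := by
      rw [inv_le_iff_one_le_mul₀ h1]
      nlinarith [sq_nonneg (√((n : ℝ) + 1) - √n)]
    linarith

/-- A sequence controlled by harmonic decay, a linear bound and a geometric tail has partial sums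
of size at most the square root of the size parameter. -/
lemma exists_sum_le_sqrt {C q : ℝ} (hC : 0 < C) (hq0 : 0 < q) (hq1 : q < 1) :
    ∃ D > 0, ∀ (μ : ℕ → ℝ) (p M : ℝ), 1 ≤ p → 1 ≤ M → (∀ j, 0 ≤ μ j) →
      (∀ j : ℕ, (j : ℝ) ≤ p → (j + 1) * μ j ≤ C) → (∀ j, μ j ≤ C * M / p) →
      (∀ j : ℕ, p ≤ j → μ j ≤ C / p) → (∀ j, μ j ≤ C * M ^ p * q ^ j) →
      ∀ N, ∑ j ∈ Finset.range N, μ j ≤ D * √M := by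
  set L := -log q with hL
  have hL0 : 0 < L := by rw [hL]; linarith [log_neg hq0 hq1]
  refine ⟨2 * √2 * C + 2 * C * ((2 + L) / L), by positivity,
    fun μ p M hp hM h0 h1 h2 h3 h4 N => ?_⟩
  have hp0 : 0 < p := by linarith
  have hM0 : 0 < M := by linarith
  set a : ℕ → ℝ := fun j => C * √M / √p * (√(j + 1))⁻¹ with ha
  set t := q ^ (1 / (2 * p)) with ht
  have ht0 : 0 < t := rpow_pos_of_pos hq0 _
  have ht1 : t < 1 := rpow_lt_one hq0.le hq1 (by positivity)
  set b : ℕ → ℝ := fun j => 2 * C * √M / p * t ^ j with hb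
  have hμ : ∀ j, μ j ≤ (if (j : ℝ) ≤ p then a j else 0) + b j := by
    intro j
    have hbj : 0 ≤ b j := by positivity
    split_ifs with hj
    · have e1 : μ j ≤ C / (j + 1) := by
        rw [le_div_iff₀ (by positivity)]; linarith [h1 j hj]
      have e2 : μ j ^ 2 ≤ a j ^ 2 := by
        have : a j ^ 2 = C * M / p * (C / (j + 1)) := by
          simp only [ha]
          rw [mul_pow, div_pow, mul_pow, inv_pow, sq_sqrt hM0.le, sq_sqrt hp0.le,
            sq_sqrt (by positivity)]
          field_simp
        rw [this, sq]
        exact mul_le_mul (h2 j) e1 (h0 j) (by positivity)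
      have := (sq_le_sq₀ (h0 j) (by positivity)).mp e2
      linarith
    · push Not at hj
      rw [zero_add]
      rcases (h0 j).eq_or_lt with h00 | h00
      · rw [← h00]; exact hbj
      set θ := 1 / (2 * p) with hθ
      have hθ0 : 0 < θ := by positivity
      have hθ1 : θ < 1 := by rw [hθ, div_lt_one (by positivity)]; linarith
      calc μ j = μ j ^ (1 - θ) * μ j ^ θ := by rw [← rpow_add h00]; simp
        _ ≤ (C / p) ^ (1 - θ) * (C * M ^ p * q ^ j) ^ θ := by
          gcongr
          · exact h3 j hj.le
          · exact h4 j
        _ = (C ^ (1 - θ) * C ^ θ) * (p ^ (1 - θ))⁻¹ * (M ^ p) ^ θ * (q ^ j) ^ θ := by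
          rw [div_rpow hC.le hp0.le, mul_rpow (by positivity) (by positivity),
            mul_rpow (by positivity) (by positivity)]
          ring
        _ = C * (p ^ θ / p) * √M * t ^ j := by
          have e1 : C ^ (1 - θ) * C ^ θ = C := by rw [← rpow_add hC]; simp
          have e2 : (p ^ (1 - θ))⁻¹ = p ^ θ / p := by
            rw [rpow_sub hp0, rpow_one, inv_div]
          have e3 : (M ^ p) ^ θ = √M := by
            rw [← rpow_mul hM0.le, sqrt_eq_rpow, hθ]; congr 1; field_simp
          have e4 : (q ^ j) ^ θ = t ^ j := by
            rw [ht, ← rpow_natCast q, ← rpow_natCast (q ^ _), ← rpow_mul hq0.le,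
              ← rpow_mul hq0.le, mul_comm]
          rw [e1, e2, e3, e4]
        _ ≤ C * (2 / p) * √M * t ^ j := by
          gcongr
          have : p ≤ 2 ^ (2 * p) := by
            have := one_add_mul_self_le_rpow_one_add (s := 1) (by norm_num) (p := 2 * p)
              (by linarith)
            norm_num at this; linarith
          calc p ^ θ ≤ (2 ^ (2 * p)) ^ θ := by gcongr
            _ = 2 := by rw [← rpow_mul (by norm_num), hθ, mul_one_div_cancel (by positivity), rpow_one]
        _ = b j := by simp only [hb]; ring
  have hsa : ∑ j ∈ Finset.range N, (if (j : ℝ) ≤ p then a j else 0) ≤ 2 * √2 * C * √M := by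
    have ha0 : ∀ j, 0 ≤ a j := fun j => by positivity
    calc _ = ∑ j ∈ (Finset.range N).filter (fun j : ℕ => (j : ℝ) ≤ p), a j :=
          (Finset.sum_filter _ _).symm
      _ ≤ ∑ j ∈ Finset.range (⌊p⌋₊ + 1), a j := by
        refine Finset.sum_le_sum_of_subset_of_nonneg (fun j hj => ?_) fun j _ _ => ha0 j
        rw [Finset.mem_filter] at hj
        rw [Finset.mem_range, Nat.lt_succ_iff]
        exact Nat.le_floor hj.2
      _ = C * √M / √p * ∑ j ∈ Finset.range (⌊p⌋₊ + 1), (√(j + 1))⁻¹ := by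
        rw [Finset.mul_sum]
      _ ≤ C * √M / √p * (2 * √((⌊p⌋₊ + 1 : ℕ) : ℝ)) := by gcongr; exact sum_inv_sqrt_le _
      _ ≤ C * √M / √p * (2 * (√2 * √p)) := by
        gcongr
        rw [← sqrt_mul (by norm_num)]
        refine sqrt_le_sqrt ?_
        push_cast
        linarith [Nat.floor_le hp0.le]
      _ = _ := by field_simp
  have hsb : ∑ j ∈ Finset.range N, b j ≤ 2 * C * ((2 + L) / L) * √M := by
    have hg : ∑ j ∈ Finset.range N, t ^ j ≤ p * ((2 + L) / L) := by
      have h5 : ∑ j ∈ Finset.range N, t ^ j ≤ (1 - t)⁻¹ := by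
        rw [← tsum_geometric_of_lt_one ht0.le ht1]
        exact (summable_geometric_of_lt_one ht0.le ht1).sum_le_tsum _ fun j _ => by positivity
      refine h5.trans ?_
      have h6 : 1 + L / (2 * p) ≤ t⁻¹ := by
        have : t⁻¹ = exp (L / (2 * p)) := by
          rw [ht, rpow_def_of_pos hq0, ← exp_neg, hL]; congr 1; ring
        rw [this]; linarith [add_one_le_exp (L / (2 * p))]
      have h7 : t ≤ 2 * p / (2 * p + L) := by
        have := inv_anti₀ (by positivity) h6
        rw [inv_inv] at this
        refine this.trans (le_of_eq ?_)
        field_simp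
      have h8 : L / (p * (2 + L)) ≤ 1 - t := by
        have : L / (p * (2 + L)) ≤ L / (2 * p + L) := by
          gcongr; nlinarith
        have : 1 - 2 * p / (2 * p + L) = L / (2 * p + L) := by field_simp; ring
        linarith
      have := inv_anti₀ (by positivity) h8
      refine this.trans (le_of_eq ?_)
      field_simp
    calc _ = 2 * C * √M / p * ∑ j ∈ Finset.range N, t ^ j := by rw [Finset.mul_sum]
      _ ≤ 2 * C * √M / p * (p * ((2 + L) / L)) := by gcongr
      _ = _ := by field_simp
  calc _ ≤ ∑ j ∈ Finset.range N, ((if (j : ℝ) ≤ p then a j else 0) + b j) :=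
        Finset.sum_le_sum fun j _ => hμ j
    _ ≤ _ := by rw [Finset.sum_add_distrib, add_mul]; linarith

lemma exists_closedBall_away (x : ℂ) {ρ : ℝ} (hρ : 0 < ρ) :
    ∃ y, closedBall y (ρ / 4) ⊆ closedBall x ρ ∧ ∀ z ∈ closedBall y (ρ / 4), ρ / 4 ≤ ‖z‖ := by
  have key : ∀ y : ℂ, ‖y - x‖ = 3 * ρ / 4 → 3 * ρ / 4 ≤ ‖y‖ →
      closedBall y (ρ / 4) ⊆ closedBall x ρ ∧ ∀ z ∈ closedBall y (ρ / 4), ρ / 4 ≤ ‖z‖ := by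
    intro y h1 h2
    refine ⟨closedBall_subset_closedBall' (by rw [dist_eq_norm, h1]; linarith), fun z hz => ?_⟩
    rw [mem_closedBall, dist_eq_norm] at hz
    have := norm_sub_norm_le y z
    rw [norm_sub_rev] at this
    linarith
  have hn : ‖((3 * ρ / 4 : ℝ) : ℂ)‖ = 3 * ρ / 4 := by
    rw [Complex.norm_real, norm_of_nonneg (by positivity)]
  by_cases h : 3 * ρ / 4 ≤ ‖x + ((3 * ρ / 4 : ℝ) : ℂ)‖
  · exact ⟨_, key _ (by rw [add_sub_cancel_left, hn]) h⟩
  · refine ⟨x - ((3 * ρ / 4 : ℝ) : ℂ), key _ (by rw [sub_sub_cancel_left, norm_neg, hn]) ?_⟩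
    have := norm_sub_le (x + ((3 * ρ / 4 : ℝ) : ℂ)) (x - ((3 * ρ / 4 : ℝ) : ℂ))
    rw [show x + ((3 * ρ / 4 : ℝ) : ℂ) - (x - ((3 * ρ / 4 : ℝ) : ℂ))
      = (2 : ℝ) * ((3 * ρ / 4 : ℝ) : ℂ) by push_cast; ring, norm_mul, hn, Complex.norm_real,
      norm_of_nonneg zero_le_two] at this
    push Not at h
    linarith

lemma exists_lower_bound {γ c₀ p₀ R : ℝ} (hγ : 0 ≤ γ) (hc₀ : 0 < c₀) (hp₀ : 1 < p₀) (hR : 0 < R) :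
    ∃ C > 0, ∀ (W v : ℂ → ℝ) (p r A : ℝ) (x : ℂ) (k : ℕ), p₀ ≤ p → IsSol W v p → r < 1 →
      (∀ z ∈ closedBall (0 : ℂ) r, z ≠ 0 → c₀ * ‖z‖ ^ (2 * γ) ≤ W z) →
      closedBall x (R / 2 ^ k) ⊆ closedBall 0 r → (k : ℝ) ≤ p + 3 → 0 < A →
      (∀ z ∈ closedBall x (R / 2 ^ k), A ≤ v z) → A ≤ C := by
  set D := max 1 (32 / (c₀ * (R / 4) ^ (2 * γ + 2))) with hD
  have hD1 : 1 ≤ D := le_max_left _ _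
  set E : ℝ := 2 ^ (2 * γ + 2) with hE
  have hE1 : 1 ≤ E := one_le_rpow one_le_two (by linarith)
  refine ⟨D ^ (1 / (p₀ - 1)) * E ^ (1 + 4 / (p₀ - 1)), by positivity,
    fun W v p r A x k hp h hr hW hs hk hA hAv => ?_⟩
  obtain ⟨y, hy1, hy2⟩ := exists_closedBall_away x (ρ := R / 2 ^ k) (by positivity)
  set σ := R / 2 ^ k / 4 with hσ
  have hσ0 : 0 < σ := by positivity
  have hs' : closedBall y σ ⊆ ball 0 1 := hy1.trans (hs.trans (closedBall_subset_ball hr))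
  have hne : ∀ z ∈ closedBall y σ, z ≠ 0 := fun z hz => by
    have := hy2 z hz
    exact norm_pos_iff.mp (by linarith)
  have hsup := supersolution_bound (u := v) (x := y) (w := c₀ * σ ^ (2 * γ)) (A := A) (p := p) hσ0 hA
    (by positivity) (by linarith) (h.continuousOn.mono hs')
    (fun z hz => h.contDiffAt z (hs' (ball_subset_closedBall hz)) (hne z (ball_subset_closedBall hz)))
    (fun z hz => hAv z (hy1 hz)) fun z hz => by
      have hz' := ball_subset_closedBall hz
      rw [h.eq z (hs' hz') (hne z hz')]
      refine mul_le_mul_of_nonneg_right ?_ (rpow_nonneg (h.pos z (hs' hz')).le _)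
      refine le_trans ?_ (hW z (hs (hy1 hz')) (hne z hz'))
      gcongr
      exact hy2 z hz'
  have hp1 : 0 < p - 1 := by linarith
  have hp01 : 0 < p₀ - 1 := by linarith
  have e1 : σ ^ (2 * γ) * σ ^ 2 = (R / 4) ^ (2 * γ + 2) / E ^ (k : ℝ) := by
    rw [← rpow_natCast σ 2, ← rpow_add hσ0, hE, ← rpow_mul zero_le_two, mul_comm (2 * γ + 2) (k : ℝ),
      rpow_mul zero_le_two, rpow_natCast, ← div_rpow (by positivity) (by positivity), hσ]
    congr 1; ring
  have h1 : A ^ (p - 1) ≤ D * E ^ (k : ℝ) := by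
    have h2 : A ^ (p - 1) * ((c₀ * (R / 4) ^ (2 * γ + 2)) / E ^ (k : ℝ)) ≤ 32 := by
      refine le_trans (le_of_eq ?_) hsup
      rw [mul_div_assoc, ← e1]; ring
    have h3 : A ^ (p - 1) ≤ 32 / ((c₀ * (R / 4) ^ (2 * γ + 2)) / E ^ (k : ℝ)) := by
      rw [le_div_iff₀ (by positivity)]; exact h2
    refine h3.trans ?_
    rw [div_div_eq_mul_div, mul_div_right_comm]
    gcongr
    exact le_max_right _ _
  have h2 : A ^ (p - 1) ≤ D * E ^ (p + 3) := h1.trans (by gcongr)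
  calc A = (A ^ (p - 1)) ^ (1 / (p - 1)) := by
        rw [← rpow_mul hA.le, mul_one_div_cancel hp1.ne', rpow_one]
    _ ≤ (D * E ^ (p + 3)) ^ (1 / (p - 1)) := by gcongr
    _ = D ^ (1 / (p - 1)) * E ^ (1 + 4 / (p - 1)) := by
      rw [mul_rpow (by positivity) (by positivity), ← rpow_mul (by positivity)]
      congr 2; field_simp; ring
    _ ≤ _ := by
      gcongr

lemma exists_volume_bound {β : ℝ} (hβ : -1 < β) (hβ0 : β ≤ 0) : ∃ C > 0, ∀ (x : ℂ) (ρ : ℝ), 0 < ρ →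
    ∫ z in closedBall x ρ, ‖z‖ ^ (2 * β) ≤ C * ρ ^ (2 * β + 2) := by
  set I := ∫ z in closedBall (0 : ℂ) 1, ‖z‖ ^ (2 * β)
  have hI : 0 ≤ I := integral_nonneg fun z => by positivity
  refine ⟨π + I, by positivity, fun x ρ hρ => ?_⟩
  have hI2 : ∫ z in closedBall (0 : ℂ) ρ, ‖z‖ ^ (2 * β) = I * ρ ^ (2 * β + 2) := by
    have h1 := Measure.setIntegral_comp_smul_of_pos (volume : Measure ℂ)
      (fun z : ℂ => ‖z‖ ^ (2 * β)) (closedBall (0 : ℂ) 1) hρ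
    rw [_root_.smul_closedBall _ _ zero_le_one, smul_zero, mul_one, norm_of_nonneg hρ.le,
      Complex.finrank_real_complex] at h1
    have h2 : ∀ z : ℂ, ‖ρ • z‖ ^ (2 * β) = ρ ^ (2 * β) * ‖z‖ ^ (2 * β) := fun z => by
      rw [norm_smul, norm_of_nonneg hρ.le, mul_rpow hρ.le (norm_nonneg _)]
    simp_rw [h2] at h1
    rw [integral_const_mul, smul_eq_mul] at h1
    have h3 : ρ ^ (2 * β + 2) = ρ ^ (2 * β) * ρ ^ 2 := by
      rw [rpow_add hρ, ← rpow_natCast ρ 2]; norm_num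
    rw [h3]
    field_simp at h1
    linarith
  have i0 := integrableOn_rpow_norm hβ ρ
  have i1 : Integrable ((closedBall (0 : ℂ) ρ).indicator fun z => ‖z‖ ^ (2 * β)) :=
    (integrable_indicator_iff measurableSet_closedBall).mpr i0
  have i2 : IntegrableOn (fun _ : ℂ => ρ ^ (2 * β)) (closedBall x ρ) :=
    integrableOn_const measure_closedBall_lt_top.ne
  have ix : IntegrableOn (fun z : ℂ => ‖z‖ ^ (2 * β)) (closedBall x ρ) :=
    (integrableOn_rpow_norm hβ (dist x 0 + ρ)).mono_set
      (closedBall_subset_closedBall' (by rw [add_comm]))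
  calc ∫ z in closedBall x ρ, ‖z‖ ^ (2 * β)
      ≤ ∫ z in closedBall x ρ, (ρ ^ (2 * β)
        + (closedBall (0 : ℂ) ρ).indicator (fun z => ‖z‖ ^ (2 * β)) z) := by
        refine setIntegral_mono ix (i2.add i1.integrableOn) fun z => ?_
        simp only
        by_cases hz : z ∈ closedBall (0 : ℂ) ρ
        · rw [indicator_of_mem hz]
          have : 0 ≤ ρ ^ (2 * β) := by positivity
          linarith
        · rw [indicator_of_notMem hz, add_zero]
          exact rpow_le_rpow_of_nonpos hρ (by simpa using hz : ρ < ‖z‖).le (by linarith)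
    _ = ρ ^ (2 * β) * (π * ρ ^ 2)
        + ∫ z in closedBall x ρ, (closedBall (0 : ℂ) ρ).indicator (fun z => ‖z‖ ^ (2 * β)) z := by
      rw [integral_add i2 i1.integrableOn, setIntegral_const, volReal_closedBall x hρ.le,
        smul_eq_mul, mul_comm]
    _ ≤ ρ ^ (2 * β) * (π * ρ ^ 2)
        + ∫ z, (closedBall (0 : ℂ) ρ).indicator (fun z => ‖z‖ ^ (2 * β)) z := by
      gcongr
      · exact Eventually.of_forall fun z => indicator_nonneg (fun _ _ => by positivity) z
      · exact Measure.restrict_le_self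
    _ = _ := by
      rw [integral_indicator measurableSet_closedBall, hI2]
      have h3 : ρ ^ (2 * β + 2) = ρ ^ (2 * β) * ρ ^ 2 := by
        rw [rpow_add hρ, ← rpow_natCast ρ 2]; norm_num
      rw [h3]; ring

lemma avgKer_le {x y z : ℂ} {ρ : ℝ} (hρ : 0 < ρ) (hxy : y ∈ closedBall x (ρ / 2)) :
    avgKer x ρ z ≤ 10 * avgKer y (2 * ρ) z := by
  by_cases hz : z ∈ ball x ρ
  · have h1 : avgKer x ρ z ≤ 8 * (ρ ^ 2)⁻¹ * 1 := by
      rw [avgKer]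
      gcongr
      refine max_le ?_ zero_le_one
      have := mul_nonneg (by positivity : 0 ≤ (ρ ^ 2)⁻¹) (sqd_nonneg x z)
      linarith
    have h2 : sqd y z ≤ (3 / 2 * ρ) ^ 2 := by
      rw [sqd_eq]
      gcongr
      rw [← dist_eq_norm]
      have := dist_triangle z x y
      rw [mem_ball] at hz; rw [mem_closedBall, dist_comm] at hxy
      linarith
    have h3 : 7 / 16 ≤ 1 - ((2 * ρ) ^ 2)⁻¹ * sqd y z := by
      have : ((2 * ρ) ^ 2)⁻¹ * sqd y z ≤ ((2 * ρ) ^ 2)⁻¹ * (3 / 2 * ρ) ^ 2 := by gcongr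
      have e : ((2 * ρ) ^ 2)⁻¹ * (3 / 2 * ρ) ^ 2 = 9 / 16 := by field_simp; norm_num
      linarith
    have h4 : 8 * ((2 * ρ) ^ 2)⁻¹ * (7 / 16) ≤ avgKer y (2 * ρ) z := by
      rw [avgKer]; gcongr; exact h3.trans (le_max_left _ _)
    have e : 8 * ((2 * ρ) ^ 2)⁻¹ * (7 / 16) = 7 / 8 * (ρ ^ 2)⁻¹ := by field_simp; norm_num
    have : 0 < (ρ ^ 2)⁻¹ := by positivity
    linarith
  · rw [avgKer_eq_zero hρ hz]
    have := avgKer_nonneg y (2 * ρ) z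
    positivity

lemma IsSol.avg_le {W v : ℂ → ℝ} {p : ℝ} (h : IsSol W v p) {x y : ℂ} {ρ : ℝ} (hρ : 0 < ρ)
    (hxy : y ∈ closedBall x (ρ / 2)) (hx : closedBall x ρ ⊆ ball 0 1)
    (hy : closedBall y (2 * ρ) ⊆ ball 0 1) : avg v x ρ ≤ 10 * avg v y (2 * ρ) := by
  rw [avg, avg, ← integral_const_mul]
  refine integral_mono (integrable_mul_avgKer h.continuousOn hρ hx)
    ((integrable_mul_avgKer h.continuousOn (by positivity) hy).const_mul _) fun z => ?_
  simp only
  by_cases hz : z ∈ closedBall y (2 * ρ)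
  · rw [mul_left_comm]
    exact mul_le_mul_of_nonneg_left (avgKer_le hρ hxy) (h.pos z (hy hz)).le
  · have h1 : avgKer y (2 * ρ) z = 0 :=
      avgKer_eq_zero (by positivity) fun h' => hz (ball_subset_closedBall h')
    have h2 : avgKer x ρ z = 0 := le_antisymm (by simpa [h1] using avgKer_le (z := z) hρ hxy)
      (avgKer_nonneg x ρ z)
    simp [h1, h2]

/-- Interior maximum bound from a mass bound. -/
lemma exists_max_bound {R β γ C₀ c₀ p₀ C_P : ℝ} (hR : 0 < R) (hβ : -1 < β) (hβ0 : β ≤ 0)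
    (hγ : 0 ≤ γ) (hC₀ : 0 < C₀) (hc₀ : 0 < c₀) (hp₀ : 1 < p₀) (hC_P : 0 < C_P) :
    ∃ D > 0, ∀ (W v : ℂ → ℝ) (p r : ℝ) (x : ℂ), p₀ ≤ p → IsSol W v p → IsWeight W r β C₀ →
      (∀ z ∈ closedBall (0 : ℂ) r, z ≠ 0 → c₀ * ‖z‖ ^ (2 * γ) ≤ W z) →
      closedBall x R ⊆ closedBall 0 r → (∀ z ∈ closedBall (0 : ℂ) r, v z ≤ v x) → 1 ≤ v x →
      p * mass W v p x R ≤ C_P * v x → v x ≤ D := by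
  have hk := kap_pos
  obtain ⟨C₁, hC₁, hlow⟩ := exists_lower_bound hγ hc₀ hp₀ hR
  obtain ⟨CV, hCV, hvol⟩ := exists_volume_bound hβ hβ0
  set q : ℝ := 2 ^ (-(2 * β + 2)) with hq
  have hq0 : 0 < q := by positivity
  have hq1 : q < 1 := rpow_lt_one_of_one_lt_of_neg one_lt_two (by linarith)
  set C := 4 * kap * C₁ + C_P + C₀ * CV * (R / 8) ^ (2 * β + 2) with hC
  have hCa : 4 * kap * C₁ ≤ C := by
    have : 0 < C₀ * CV * (R / 8) ^ (2 * β + 2) := by positivity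
    linarith
  have hCb : C_P ≤ C := by
    have : 0 < C₀ * CV * (R / 8) ^ (2 * β + 2) := by positivity
    have : 0 < 4 * kap * C₁ := by positivity
    linarith
  have hCc : C₀ * CV * (R / 8) ^ (2 * β + 2) ≤ C := by
    have : 0 < 4 * kap * C₁ := by positivity
    linarith
  have hC0 : 0 < C := hC_P.trans_le hCb
  obtain ⟨D, hD, hsum⟩ := exists_sum_le_sqrt hC0 hq0 hq1
  refine ⟨((10 * kap * C₁ + 2 * D) / kap) ^ 2, by positivity,
    fun W v p r x hp h hW hWl hs hmax hM hP => ?_⟩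
  have hp1 : 1 < p := by linarith
  have hs1 : closedBall x R ⊆ ball 0 1 := hs.trans (closedBall_subset_ball hW.r_lt)
  set M := v x with hMdef
  have hM0 : 0 < M := by linarith
  have hsubR : ∀ k : ℕ, closedBall x (R / 2 ^ k) ⊆ closedBall x R := fun k =>
    closedBall_subset_closedBall (div_le_self hR.le (one_le_pow₀ one_le_two))
  set μ : ℕ → ℝ := fun j => mass W v p x (R / 2 ^ (j + 3)) with hμ
  have hμ0 : ∀ j, 0 ≤ μ j := fun j => h.mass_nonneg hW ((hsubR _).trans hs)
  have h1 : ∀ j : ℕ, (j : ℝ) ≤ p → (j + 1) * μ j ≤ 4 * kap * C₁ := by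
    intro j hj
    rcases (hμ0 j).eq_or_lt with h0 | h0
    · rw [← h0, mul_zero]; positivity
    have key : ∀ z ∈ closedBall x (R / 2 ^ (j + 3)), (j + 1) * μ j / (4 * kap) ≤ v z := by
      intro z hz
      rw [mem_closedBall] at hz
      have hsmall : R / 2 ^ (j + 3) ≤ R / 2 := by
        gcongr; exact le_self_pow₀ one_le_two (by omega)
      have hzs : closedBall z (R / 2) ⊆ closedBall 0 r :=
        (closedBall_subset_closedBall' (by linarith)).trans hs
      have h2 := h.avg_add_le hW (x := z) (ρ := R / 2) (by positivity) hzs (j + 1)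
      have h3 : ∑ _i ∈ Finset.range (j + 1), μ j
          ≤ ∑ i ∈ Finset.range (j + 1), mass W v p z (R / 2 / 2 ^ (i + 1)) := by
        refine Finset.sum_le_sum fun i hi => ?_
        rw [Finset.mem_range] at hi
        refine h.mass_mono hW ((closedBall_subset_closedBall (div_le_self (by positivity)
          (one_le_pow₀ one_le_two))).trans hzs) ?_
        refine closedBall_subset_closedBall' ?_
        rw [dist_comm]
        have e : R / 2 / 2 ^ (j + 1) = 2 * (R / 2 ^ (j + 3)) := by
          field_simp; ring
        have : R / 2 / 2 ^ (j + 1) ≤ R / 2 / 2 ^ (i + 1) := by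
          gcongr
          · norm_num
          · omega
        linarith
      rw [Finset.sum_const, Finset.card_range, nsmul_eq_mul] at h3
      push_cast at h3
      have h4 := h.avg_nonneg (x := z) (ρ := R / 2) (by positivity)
        (hzs.trans (closedBall_subset_ball hW.r_lt))
      rw [div_le_iff₀ (by positivity)]
      linarith
    have := hlow W v p r _ x (j + 3) hp h hW.r_lt hWl ((hsubR _).trans hs) (by push_cast; linarith)
      (by positivity) key
    rw [div_le_iff₀ (by positivity)] at this
    linarith
  have ha : avg v x (R / 8) ≤ 10 * kap * C₁ := by
    have hs8 : closedBall x (R / 8) ⊆ closedBall x R := closedBall_subset_closedBall (by linarith)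
    rcases (h.avg_nonneg (x := x) (ρ := R / 8) (by positivity) (hs8.trans hs1)).eq_or_lt with h0 | h0
    · rw [← h0]; positivity
    have key : ∀ z ∈ closedBall x (R / 2 ^ 4), avg v x (R / 8) / (10 * kap) ≤ v z := by
      intro z hz
      have hz' : dist z x ≤ R / 2 ^ 4 := hz
      norm_num at hz'
      have hzs : closedBall z (2 * (R / 8)) ⊆ closedBall 0 r :=
        (closedBall_subset_closedBall' (by linarith)).trans hs
      have h2 := h.avg_le (x := x) (y := z) (ρ := R / 8) (by positivity)
        (by rw [mem_closedBall]; linarith) (hs8.trans hs1)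
        (hzs.trans (closedBall_subset_ball hW.r_lt))
      have h3 := h.avg_add_le hW (by positivity) hzs 0
      rw [Finset.sum_range_zero, mul_zero, add_zero] at h3
      rw [div_le_iff₀ (by positivity)]
      linarith
    have := hlow W v p r _ x 4 hp h hW.r_lt hWl ((hsubR _).trans hs) (by norm_num; linarith)
      (by positivity) key
    rw [div_le_iff₀ (by positivity)] at this
    linarith
  have h3 : ∀ j : ℕ, p ≤ j → μ j ≤ C / p := by
    intro j hj
    have hf := Nat.floor_le (by linarith : 0 ≤ p)
    have hf2 := Nat.lt_floor_add_one p
    have e1 := h1 ⌊p⌋₊ hf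
    have hle : μ j ≤ μ ⌊p⌋₊ := by
      refine h.mass_mono hW ((hsubR _).trans hs) (closedBall_subset_closedBall ?_)
      have : ⌊p⌋₊ ≤ j := Nat.floor_le_of_le hj
      gcongr
      norm_num
    rw [le_div_iff₀ (by linarith)]
    have : μ j * p ≤ μ ⌊p⌋₊ * (⌊p⌋₊ + 1) := mul_le_mul hle hf2.le (by linarith) (hμ0 _)
    linarith
  have h2 : ∀ j, μ j ≤ C * M / p := by
    intro j
    rw [le_div_iff₀ (by linarith)]
    have : μ j ≤ mass W v p x R := h.mass_mono hW hs (hsubR _)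
    calc μ j * p ≤ mass W v p x R * p := by gcongr
      _ ≤ C_P * M := by linarith
      _ ≤ C * M := by gcongr
  have h4 : ∀ j, μ j ≤ C * M ^ p * q ^ j := by
    intro j
    have hsj := (hsubR (j + 3)).trans hs
    have hiW := hW.integrableOn.mono_set hsj
    have hip := (integrableOn_rpow_norm hβ r).mono_set hsj
    calc μ j ≤ ∫ z in closedBall x (R / 2 ^ (j + 3)), (C₀ * M ^ p) * ‖z‖ ^ (2 * β) := by
          refine setIntegral_mono_on_ae ((h.integrableOn hW p).mono_set hsj) (hip.const_mul _)
            measurableSet_closedBall ?_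
          filter_upwards [ae_ne_zero] with z hz0 hz
          have hv := h.pos z (closedBall_subset_ball hW.r_lt (hsj hz))
          have e1 : v z ^ p ≤ M ^ p := rpow_le_rpow hv.le (hmax z (hsj hz)) (by linarith)
          calc W z * v z ^ p ≤ (C₀ * ‖z‖ ^ (2 * β)) * M ^ p :=
                mul_le_mul (hW.le z (hsj hz) hz0) e1 (rpow_nonneg hv.le _) (by positivity)
            _ = _ := by ring
      _ ≤ (C₀ * M ^ p) * (CV * (R / 2 ^ (j + 3)) ^ (2 * β + 2)) := by
          rw [integral_const_mul]; gcongr; exact hvol x _ (by positivity)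
      _ = (C₀ * CV * (R / 8) ^ (2 * β + 2)) * M ^ p * q ^ j := by
          have e : R / 2 ^ (j + 3) = R / 8 * (2 ^ (j : ℝ))⁻¹ := by
            rw [rpow_natCast, pow_add]; field_simp; norm_num
          rw [e, mul_rpow (by positivity) (by positivity), ← rpow_neg zero_le_two,
            ← rpow_mul zero_le_two, hq, ← rpow_natCast (2 ^ (-(2 * β + 2))) j,
            ← rpow_mul zero_le_two]
          ring_nf
      _ ≤ _ := by gcongr
  have hfin : kap * M ≤ (10 * kap * C₁ + 2 * D) * √M := by
    have hsM : 1 ≤ √M := one_le_sqrt.mpr hM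
    refine h.kap_mul_le hW (ρ := R / 8) (by positivity)
      ((closedBall_subset_closedBall (by linarith)).trans hs) fun N => ?_
    have e : ∀ j : ℕ, R / 8 / 2 ^ j = R / 2 ^ (j + 3) := fun j => by rw [pow_add]; field_simp; norm_num
    simp_rw [e]
    have := hsum μ p M hp1.le hM hμ0 (fun j hj => (h1 j hj).trans hCa) h2 h3 h4 N
    have : 10 * kap * C₁ ≤ 10 * kap * C₁ * √M := le_mul_of_one_le_right (by positivity) hsM
    linarith
  have hsq : √M ≤ (10 * kap * C₁ + 2 * D) / kap := by
    rw [le_div_iff₀ hk]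
    have h5 : 0 < √M := sqrt_pos.mpr hM0
    have h6 : √M * √M = M := mul_self_sqrt hM0.le
    have : √M * (√M * kap) ≤ √M * (10 * kap * C₁ + 2 * D) := by
      rw [← mul_assoc, h6]; linarith
    exact le_of_mul_le_mul_left this h5
  calc M = √M ^ 2 := (sq_sqrt hM0.le).symm
    _ ≤ _ := by gcongr

/-- Montel's theorem, along an ultrafilter. -/
lemma exists_tendstoLocallyUniformlyOn {U : Set ℂ} (hU : IsOpen U) {F : ℕ → ℂ → ℂ}
    (hF : ∀ n, DifferentiableOn ℂ (F n) U) (hM : ∀ n, ∀ z ∈ U, ‖F n z‖ ≤ 1) :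
    ∃ l : Filter ℕ, l.NeBot ∧ l ≤ atTop ∧ ∃ f : ℂ → ℂ, TendstoLocallyUniformlyOn F f l U := by
  let l : Ultrafilter ℕ := Ultrafilter.of atTop
  have hlim : ∀ z ∈ U, ∃ w, Tendsto (fun n => F n z) l (𝓝 w) := by
    intro z hz
    have h := (isCompact_closedBall (0 : ℂ) 1).ultrafilter_le_nhds (l.map (fun n => F n z)) (by
      rw [le_principal_iff]
      rw [Ultrafilter.coe_map, Filter.mem_map]
      refine Filter.univ_mem' fun n => ?_
      simpa using hM n z hz)
    obtain ⟨w, -, hw⟩ := h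
    exact ⟨w, hw⟩
  choose! f hf using hlim
  refine ⟨l, l.neBot, Ultrafilter.of_le _, f, ?_⟩
  rw [Metric.tendstoLocallyUniformlyOn_iff]
  intro ε hε z hz
  obtain ⟨r, hr, hrU⟩ := Metric.isOpen_iff.1 hU z hz
  have hlip : ∀ n, ∀ w ∈ ball z r, dist (F n w) (F n z) ≤ 2 / r * dist w z := by
    intro n w hw
    refine Complex.dist_le_div_mul_dist_of_mapsTo_ball ((hF n).mono hrU) ?_ hw
    intro y hy
    rw [mem_closedBall, dist_eq_norm]
    calc ‖F n y - F n z‖ ≤ ‖F n y‖ + ‖F n z‖ := norm_sub_le _ _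
      _ ≤ 2 := by linarith [hM n y (hrU hy), hM n z hz]
  have hlipf : ∀ w ∈ ball z r, dist (f w) (f z) ≤ 2 / r * dist w z := by
    intro w hw
    exact le_of_tendsto ((hf w (hrU hw)).dist (hf z hz)) (Eventually.of_forall fun n => hlip n w hw)
  set δ := min r (r * ε / 8) with hδ
  have hδ0 : 0 < δ := lt_min hr (by positivity)
  refine ⟨ball z δ, mem_nhdsWithin_of_mem_nhds (ball_mem_nhds _ hδ0), ?_⟩
  have h1 := (Metric.tendsto_nhds.1 (hf z hz)) (ε / 4) (by positivity)
  filter_upwards [h1] with n hn w hw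
  have hwr : w ∈ ball z r := ball_subset_ball (min_le_left _ _) hw
  have hd : 2 / r * dist w z ≤ ε / 4 := by
    have : dist w z ≤ r * ε / 8 := (mem_ball.1 hw).le.trans (min_le_right _ _)
    calc 2 / r * dist w z ≤ 2 / r * (r * ε / 8) := by gcongr
      _ = ε / 4 := by field_simp; ring
  have h2 := hlip n w hwr
  have h3 := hlipf w hwr
  have h4 := dist_triangle4 (f w) (f z) (F n z) (F n w)
  rw [dist_comm (f z), dist_comm (F n z) (F n w)] at h4
  linarith

/-- Hurwitz's theorem, local form. -/
lemma eventually_eq_zero_of_tendstoLocallyUniformlyOn {U : Set ℂ} (hU : IsOpen U) {F : ℕ → ℂ → ℂ}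
    {f : ℂ → ℂ} {l : Filter ℕ} [l.NeBot] (hT : TendstoLocallyUniformlyOn F f l U)
    (hF : ∀ n, DifferentiableOn ℂ (F n) U) (hne : ∀ n, ∀ z ∈ U, F n z ≠ 0) {z : ℂ} (hz : z ∈ U)
    (hfz : f z = 0) : ∀ᶠ w in 𝓝 z, f w = 0 := by
  have hfd : DifferentiableOn ℂ f U := hT.differentiableOn (Eventually.of_forall hF) hU
  have hfa : AnalyticAt ℂ f z := hfd.analyticAt (hU.mem_nhds hz)
  refine hfa.eventually_eq_zero_or_eventually_ne_zero.resolve_right fun h => ?_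
  rw [eventually_nhdsWithin_iff] at h
  obtain ⟨r, hr, hrU⟩ := Metric.eventually_nhds_iff_ball.1 (h.and (hU.mem_nhds hz))
  set ρ := r / 2 with hρ
  have hρ0 : 0 < ρ := by positivity
  have hcl : closedBall z ρ ⊆ ball z r := closedBall_subset_ball (by rw [hρ]; linarith)
  have hclU : closedBall z ρ ⊆ U := fun w hw => (hrU w (hcl hw)).2
  have hsne : ∀ w ∈ sphere z ρ, f w ≠ 0 := fun w hw =>
    (hrU w (hcl (sphere_subset_closedBall hw))).1 (ne_of_mem_sphere hw hρ0.ne')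
  obtain ⟨w₀, hw₀, hmin⟩ := (isCompact_sphere z ρ).exists_isMinOn
    (NormedSpace.sphere_nonempty.2 hρ0.le)
    (f := fun w => ‖f w‖) ((hfd.continuousOn.mono (sphere_subset_closedBall.trans hclU)).norm)
  set m := ‖f w₀‖ with hm
  have hm0 : 0 < m := norm_pos_iff.2 (hsne w₀ hw₀)
  have hunif := (tendstoLocallyUniformlyOn_iff_forall_isCompact hU).1 hT _ hclU
    (isCompact_closedBall z ρ)
  rw [Metric.tendstoUniformlyOn_iff] at hunif
  obtain ⟨n, hn⟩ := (hunif (m / 2) (by positivity)).exists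
  have hsph : ∀ w ∈ sphere z ρ, m / 2 ≤ ‖F n w‖ := by
    intro w hw
    have h1 := hn w (sphere_subset_closedBall hw)
    have h2 : m ≤ ‖f w‖ := hmin hw
    rw [dist_eq_norm] at h1
    have h3 := norm_sub_norm_le (f w) (F n w)
    linarith
  have hlt : ‖F n z‖ < m / 2 := by
    have h1 := hn z (mem_closedBall_self hρ0.le)
    rwa [hfz, dist_zero_left] at h1
  have hdc : DiffContOnCl ℂ (fun w => (F n w)⁻¹) (ball z ρ) := by
    refine DifferentiableOn.diffContOnCl ?_
    rw [closure_ball _ hρ0.ne']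
    exact ((hF n).mono hclU).inv fun w hw => hne n w (hclU hw)
  have := Complex.norm_le_of_forall_mem_frontier_norm_le (z := z) (C := (m / 2)⁻¹)
    isBounded_ball hdc (fun w hw => by
      rw [frontier_ball _ hρ0.ne'] at hw
      rw [norm_inv]
      exact inv_anti₀ (by positivity) (hsph w hw)) (subset_closure (mem_ball_self hρ0))
  rw [norm_inv] at this
  have h4 : (m / 2)⁻¹ < ‖F n z‖⁻¹ := by
    have : 0 < ‖F n z‖ := norm_pos_iff.2 (hne n z hz)
    gcongr
  linarith

/-- The disc automorphism vanishing at `a`. -/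
def mob (a z : ℂ) : ℂ := (z - a) / (1 - star a * z)

lemma mob_den_ne {a z : ℂ} (ha : ‖a‖ < 1) (hz : ‖z‖ < 1) : 1 - star a * z ≠ 0 := by
  intro h
  have h1 : star a * z = 1 := (sub_eq_zero.1 h).symm
  have h2 : ‖a‖ * ‖z‖ = 1 := by rw [← norm_star a, ← norm_mul, h1, norm_one]
  nlinarith [norm_nonneg a, norm_nonneg z]

lemma norm_mob_lt {a z : ℂ} (ha : ‖a‖ < 1) (hz : ‖z‖ < 1) : ‖mob a z‖ < 1 := by
  have hd := mob_den_ne ha hz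
  rw [mob, norm_div, div_lt_one (norm_pos_iff.2 hd)]
  have key : ‖1 - star a * z‖ ^ 2 - ‖z - a‖ ^ 2 = (1 - ‖a‖ ^ 2) * (1 - ‖z‖ ^ 2) := by
    simp only [Complex.sq_norm, Complex.normSq_apply]
    simp
    ring
  have hpos : 0 < (1 - ‖a‖ ^ 2) * (1 - ‖z‖ ^ 2) := by
    apply mul_pos <;> nlinarith [norm_nonneg a, norm_nonneg z]
  exact lt_of_pow_lt_pow_left₀ 2 (norm_nonneg _) (by linarith)

lemma hasDerivAt_mob {a z : ℂ} (ha : ‖a‖ < 1) (hz : ‖z‖ < 1) :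
    HasDerivAt (mob a) ((1 - star a * a) / (1 - star a * z) ^ 2) z := by
  have hd := mob_den_ne ha hz
  have h := ((hasDerivAt_id z).sub_const a).div
    (((hasDerivAt_id z).const_mul (star a)).const_sub 1) hd
  refine h.congr_deriv ?_
  congr 1
  simp
  ring

lemma one_sub_star_mul_self (a : ℂ) : 1 - star a * a = ((1 - ‖a‖ ^ 2 : ℝ) : ℂ) := by
  have := Complex.conj_mul' a
  simp only [Complex.star_def]
  rw [this]; push_cast; ring

lemma one_sub_star_ne {a : ℂ} (ha : ‖a‖ < 1) : 1 - star a * a ≠ 0 := mob_den_ne ha ha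

lemma mob_injOn {a : ℂ} (ha : ‖a‖ < 1) : InjOn (mob a) (ball 0 1) := by
  intro z hz w hw h
  rw [mem_ball_zero_iff] at hz hw
  rw [mob, mob, div_eq_div_iff (mob_den_ne ha hz) (mob_den_ne ha hw)] at h
  have : (1 - star a * a) * (z - w) = 0 := by linear_combination h
  exact sub_eq_zero.1 ((mul_eq_zero.1 this).resolve_left (one_sub_star_ne ha))

lemma mob_self (a : ℂ) : mob a a = 0 := by simp [mob]
lemma mob_zero (a : ℂ) : mob a 0 = -a := by simp [mob]
lemma mob_eq_zero {a z : ℂ} (ha : ‖a‖ < 1) (hz : ‖z‖ < 1) (h : mob a z = 0) : z = a := by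
  rw [mob, div_eq_zero_iff] at h
  exact sub_eq_zero.1 (h.resolve_right (mob_den_ne ha hz))

/-- Injective holomorphic maps into the unit disc fixing the origin. -/
structure IsRM (U : Set ℂ) (f : ℂ → ℂ) : Prop where
  zero : f 0 = 0
  diff : DifferentiableOn ℂ f U
  mapsTo : ∀ z ∈ U, ‖f z‖ < 1
  inj : InjOn f U
  deriv_ne : ∀ z ∈ U, deriv f z ≠ 0

/-- Koebe's square root trick. -/
lemma IsRM.exists_larger {U : Set ℂ} (hU : IsOpen U) (hsc : IsSimplyConnected U) (h0 : (0 : ℂ) ∈ U)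
    {f : ℂ → ℂ} (hf : IsRM U f) {w : ℂ} (hw : ‖w‖ < 1) (hwf : ∀ z ∈ U, f z ≠ w) :
    ∃ h, IsRM U h ∧ ‖deriv f 0‖ < ‖deriv h 0‖ := by
  have hfd : ∀ z ∈ U, HasDerivAt f (deriv f z) z := fun z hz =>
    (hf.diff.differentiableAt (hU.mem_nhds hz)).hasDerivAt
  have hg : ∀ z ∈ U, HasDerivAt (fun z => mob w (f z))
      ((1 - star w * w) / (1 - star w * f z) ^ 2 * deriv f z) z := fun z hz =>
    (hasDerivAt_mob hw (hf.mapsTo z hz)).comp z (hfd z hz)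
  have hgne : ∀ z ∈ U, mob w (f z) ≠ 0 := fun z hz h =>
    hwf z hz (mob_eq_zero hw (hf.mapsTo z hz) h)
  obtain ⟨s, hsc', hs⟩ := Complex.exists_continuousOn_pow_eq hsc hU
    (g := fun z => mob w (f z)) (fun z hz => (hg z hz).continuousAt.continuousWithinAt)
    (by rintro ⟨z, hz, h⟩; exact hgne z hz h) two_ne_zero
  have hsne : ∀ z ∈ U, s z ≠ 0 := fun z hz h => hgne z hz (by rw [← hs z, h]; simp)
  have hs1 : ∀ z ∈ U, ‖s z‖ < 1 := by
    intro z hz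
    have h1 := norm_mob_lt hw (hf.mapsTo z hz)
    rw [← hs z, norm_pow] at h1
    nlinarith [norm_nonneg (s z)]
  have hsd : ∀ z ∈ U, HasDerivAt s
      ((1 - star w * w) / (1 - star w * f z) ^ 2 * deriv f z / (2 * s z)) z := by
    intro z hz
    refine HasDerivAt.of_comp_left (f := fun x => x ^ 2) (hsc'.continuousAt (hU.mem_nhds hz)) ?_
      (hg z hz) ?_ (Eventually.of_forall hs)
    · simpa using hasDerivAt_pow 2 (s z)
    · simpa using hsne z hz
  have ha := hs1 0 h0
  set a := s 0 with ha_def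
  have hhd : ∀ z ∈ U, HasDerivAt (fun z => mob a (s z)) ((1 - star a * a) / (1 - star a * s z) ^ 2 *
      ((1 - star w * w) / (1 - star w * f z) ^ 2 * deriv f z / (2 * s z))) z := fun z hz =>
    (hasDerivAt_mob ha (hs1 z hz)).comp z (hsd z hz)
  refine ⟨fun z => mob a (s z), ⟨mob_self a, fun z hz =>
    (hhd z hz).differentiableAt.differentiableWithinAt, fun z hz => norm_mob_lt ha (hs1 z hz), ?_,
    ?_⟩, ?_⟩
  · intro z hz y hy h
    have h1 : s z = s y := mob_injOn ha (by simpa using hs1 z hz) (by simpa using hs1 y hy) h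
    have h2 : mob w (f z) = mob w (f y) := by rw [← hs z, ← hs y, h1]
    exact hf.inj hz hy (mob_injOn hw (by simpa using hf.mapsTo z hz)
      (by simpa using hf.mapsTo y hy) h2)
  · intro z hz
    rw [(hhd z hz).deriv]
    have e1 := one_sub_star_ne ha
    have e2 := one_sub_star_ne hw
    have e3 := mob_den_ne ha (hs1 z hz)
    have e4 := mob_den_ne hw (hf.mapsTo z hz)
    have e5 := hsne z hz
    have e6 := hf.deriv_ne z hz
    exact mul_ne_zero (div_ne_zero e1 (pow_ne_zero 2 e3)) (div_ne_zero
      (mul_ne_zero (div_ne_zero e2 (pow_ne_zero 2 e4)) e6) (mul_ne_zero two_ne_zero e5))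
  · rw [(hhd 0 h0).deriv, hf.zero]
    have hane : a ≠ 0 := hsne 0 h0
    have hpa : 0 < ‖a‖ := norm_pos_iff.2 hane
    have hwa : ‖w‖ = ‖a‖ ^ 2 := by
      have := hs 0
      simp only [hf.zero, mob_zero] at this
      rw [ha_def, ← norm_pow, this, norm_neg]
    have hda : 0 < 1 - ‖a‖ ^ 2 := by nlinarith
    rw [← ha_def, one_sub_star_mul_self, one_sub_star_mul_self]
    simp only [norm_mul, norm_div, norm_pow, mul_zero, sub_zero, Complex.norm_real,
      Real.norm_eq_abs, Complex.norm_ofNat, one_pow, div_one]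
    have hd0 : 0 < ‖deriv f 0‖ := norm_pos_iff.2 (hf.deriv_ne 0 h0)
    rw [abs_of_pos hda, abs_of_pos (by rw [hwa]; nlinarith), hwa]
    have : (1 - ‖a‖ ^ 2) / (1 - ‖a‖ ^ 2) ^ 2 * ((1 - (‖a‖ ^ 2) ^ 2) * ‖deriv f 0‖ / (2 * ‖a‖))
        = ‖deriv f 0‖ * ((1 + ‖a‖ ^ 2) / (2 * ‖a‖)) := by
      field_simp
      ring
    rw [this]
    have h1 : 1 < (1 + ‖a‖ ^ 2) / (2 * ‖a‖) := by
      rw [one_lt_div (by positivity)]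
      nlinarith [sq_nonneg (1 - ‖a‖), sq_pos_of_pos (sub_pos.2 ha)]
    nlinarith

/-- The Riemann mapping theorem for bounded simply connected domains. -/
theorem exists_riemann_map {U : Set ℂ} (hU : IsOpen U) (hsc : IsSimplyConnected U)
    (hb : Bornology.IsBounded U) (h0 : (0 : ℂ) ∈ U) :
    ∃ f, IsRM U f ∧ ∀ w : ℂ, ‖w‖ < 1 → ∃ z ∈ U, f z = w := by
  obtain ⟨R, hR, hRU⟩ := hb.subset_ball_lt 0 (0 : ℂ)
  have hstart : IsRM U (fun z => z / R) := by
    have hRc : (R : ℂ) ≠ 0 := by exact_mod_cast hR.ne'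
    refine ⟨by simp, by fun_prop, fun z hz => ?_, fun z _ w _ h => ?_, fun z _ => ?_⟩
    · rw [norm_div, Complex.norm_real, Real.norm_of_nonneg hR.le, div_lt_one hR]
      simpa using hRU hz
    · exact (div_left_inj' hRc).1 h
    · simpa using hRc
  let S : Set ℝ := {t | ∃ f, IsRM U f ∧ ‖deriv f 0‖ = t}
  obtain ⟨r, hr, hrU⟩ := Metric.isOpen_iff.1 hU 0 h0
  have hSb : BddAbove S := by
    refine ⟨1 / r, ?_⟩
    rintro t ⟨f, hf, rfl⟩
    refine Complex.norm_deriv_le_div_of_mapsTo_ball (hf.diff.mono hrU) (fun z hz => ?_) hr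
    rw [hf.zero]
    simpa using (hf.mapsTo z (hrU hz)).le
  have hSne : S.Nonempty := ⟨_, _, hstart, rfl⟩
  obtain ⟨t, -, ht, htS⟩ := exists_seq_tendsto_sSup hSne hSb
  choose F hF hFt using htS
  obtain ⟨l, hl, hla, f, hT⟩ := exists_tendstoLocallyUniformlyOn hU (fun n => (hF n).diff)
    (fun n z hz => ((hF n).mapsTo z hz).le)
  have hfd : DifferentiableOn ℂ f U :=
    hT.differentiableOn (Eventually.of_forall fun n => (hF n).diff) hU
  have hTd := hT.deriv (Eventually.of_forall fun n => (hF n).diff) hU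
  have hd0 : ‖deriv f 0‖ = sSup S := by
    have h1 : Tendsto (fun n => ‖deriv (F n) 0‖) l (𝓝 ‖deriv f 0‖) := (hTd.tendsto_at h0).norm
    simp only [hFt] at h1
    exact tendsto_nhds_unique h1 (ht.mono_left hla)
  have hpos : 0 < ‖deriv f 0‖ := by
    rw [hd0]
    refine lt_of_lt_of_le ?_ (le_csSup hSb ⟨_, hstart, rfl⟩)
    exact norm_pos_iff.2 (hstart.deriv_ne 0 h0)
  have hfa : AnalyticOnNhd ℂ f U := hfd.analyticOnNhd hU
  have hpc : IsPreconnected U := hsc.isPathConnected.isConnected.isPreconnected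
  have hnc : ∀ z ∈ U, ∀ c, ¬ ∀ᶠ w in 𝓝 z, f w = c := by
    intro z hz c h
    have h1 : EqOn f (fun _ => c) U :=
      hfa.eqOn_of_preconnected_of_eventuallyEq analyticOnNhd_const hpc hz h
    have h2 : f =ᶠ[𝓝 0] fun _ => c := h1.eventuallyEq_of_mem (hU.mem_nhds h0)
    rw [h2.deriv_eq] at hpos
    simp at hpos
  have hfz : ∀ z ∈ U, Tendsto (fun n => F n z) l (𝓝 (f z)) := fun z hz => hT.tendsto_at hz
  have hle : ∀ z ∈ U, ‖f z‖ ≤ 1 := fun z hz =>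
    le_of_tendsto (hfz z hz).norm (Eventually.of_forall fun n => ((hF n).mapsTo z hz).le)
  have hlt : ∀ z ∈ U, ‖f z‖ < 1 := by
    intro z hz
    refine lt_of_le_of_ne (hle z hz) fun h => ?_
    refine hnc z hz (f z) (Complex.eventually_eq_of_isLocalMax_norm ?_ ?_)
    · filter_upwards [hU.mem_nhds hz] with w hw using hfd.differentiableAt (hU.mem_nhds hw)
    · filter_upwards [hU.mem_nhds hz] with w hw
      simpa [h] using hle w hw
  have hf : IsRM U f := by
    refine ⟨?_, hfd, hlt, ?_, ?_⟩
    · have := hfz 0 h0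
      simp only [(hF _).zero] at this
      exact (tendsto_nhds_unique this tendsto_const_nhds)
    · intro z hz y hy h
      by_contra hne
      have hTy : TendstoLocallyUniformlyOn (fun n w => F n w - F n y) (fun w => f w - f y) l
          (U \ {y}) := by
        rw [Metric.tendstoLocallyUniformlyOn_iff] at hT ⊢
        intro ε hε x hx
        obtain ⟨t, ht, hn⟩ := hT (ε / 2) (by positivity) x hx.1
        refine ⟨t, nhdsWithin_mono _ sdiff_subset ht, ?_⟩
        filter_upwards [hn, Metric.tendsto_nhds.1 (hfz y hy) (ε / 2) (by positivity)]
          with n hn1 hn2 w hw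
        have := dist_sub_sub_le (f w) (f y) (F n w) (F n y)
        rw [dist_comm (f y)] at this
        linarith [hn1 w hw]
      have := eventually_eq_zero_of_tendstoLocallyUniformlyOn (hU.sdiff isClosed_singleton) hTy
        (fun n => ((hF n).diff.sub_const _).mono sdiff_subset)
        (fun n w hw h' => hw.2 ((hF n).inj hw.1 hy (sub_eq_zero.1 h'))) ⟨hz, hne⟩
        (sub_eq_zero.2 h)
      exact hnc z hz (f y) (this.mono fun w hw => sub_eq_zero.1 hw)
    · intro z hz h
      have h1 := eventually_eq_zero_of_tendstoLocallyUniformlyOn hU hTd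
        (fun n => (hF n).diff.deriv hU) (fun n => (hF n).deriv_ne) hz h
      have hda : AnalyticOnNhd ℂ (deriv f) U := hfa.deriv
      have h2 : EqOn (deriv f) 0 U :=
        hda.eqOn_of_preconnected_of_eventuallyEq analyticOnNhd_const hpc hz h1
      rw [h2 h0] at hpos
      simp at hpos
  refine ⟨f, hf, fun w hw => ?_⟩
  by_contra hcon
  push Not at hcon
  obtain ⟨h, hh, hlt'⟩ := hf.exists_larger hU hsc h0 hw hcon
  rw [hd0] at hlt'
  exact absurd (le_csSup hSb ⟨h, hh, rfl⟩) (not_le.2 hlt')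

/-- Reflection in the circle of centre `c` and radius `lam`. -/
def refl (c : ℂ) (lam : ℝ) (x : ℂ) : ℂ := c + (lam : ℂ) ^ 2 / (starRingEnd ℂ) (x - c)

lemma refl_eq {c x : ℂ} (lam : ℝ) (hx : x ≠ c) :
    refl c lam x = c + ((lam / ‖x - c‖) ^ 2 : ℝ) • (x - c) := by
  have h : x - c ≠ 0 := sub_ne_zero.2 hx
  have h1 : (starRingEnd ℂ) (x - c) ≠ 0 := (map_ne_zero _).2 h
  have h2 : ((‖x - c‖ : ℝ) : ℂ) ≠ 0 := by exact_mod_cast norm_ne_zero_iff.2 h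
  rw [refl, Complex.real_smul]
  congr 1
  have h3 := Complex.mul_conj' (x - c)
  push_cast
  rw [div_pow, ← h3]
  field_simp

lemma norm_refl_sub {c x : ℂ} (lam : ℝ) : ‖refl c lam x - c‖ = lam ^ 2 / ‖x - c‖ := by
  rw [refl, add_sub_cancel_left, norm_div, norm_pow, Complex.norm_conj, Complex.norm_real,
    Real.norm_eq_abs, sq_abs]

lemma refl_self {c x : ℂ} (hx : x ≠ c) : refl c ‖x - c‖ x = x := by
  rw [refl_eq _ hx, div_self (norm_ne_zero_iff.2 (sub_ne_zero.2 hx))]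
  simp

lemma continuousAt_refl {c : ℂ} {q : ℝ × ℂ} (hq : q.2 ≠ c) :
    ContinuousAt (fun q : ℝ × ℂ => refl c q.1 q.2) q := by
  unfold refl
  refine continuousAt_const.add (ContinuousAt.div (by fun_prop) ?_ ?_)
  · exact (Complex.continuous_conj.comp (continuous_snd.sub continuous_const)).continuousAt
  · exact (map_ne_zero _).2 (sub_ne_zero.2 hq)

lemma lapC_comp_refl {u : ℂ → ℝ} {c x : ℂ} {lam : ℝ} (hx : x ≠ c)
    (hu : ContDiffAt ℝ 2 u (refl c lam x)) :
    ContDiffAt ℝ 2 (fun y => u (refl c lam y)) x ∧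
    lapC (fun y => u (refl c lam y)) x = (lam / ‖x - c‖) ^ 4 * lapC u (refl c lam x) := by
  set φ : ℂ → ℂ := fun w => c + (lam : ℂ) ^ 2 / (w - (starRingEnd ℂ) c) with hφdef
  have hφc : ∀ y, φ ((starRingEnd ℂ) y) = refl c lam y := by
    intro y; simp [hφdef, refl, map_sub]
  have hne : (starRingEnd ℂ) x - (starRingEnd ℂ) c ≠ 0 := by
    rw [← map_sub]; exact (map_ne_zero _).2 (sub_ne_zero.2 hx)
  have hφ : AnalyticAt ℂ φ ((starRingEnd ℂ) x) :=
    analyticAt_const.add (analyticAt_const.div (analyticAt_id.sub analyticAt_const) hne)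
  have hd : HasDerivAt φ (-(lam : ℂ) ^ 2 / ((starRingEnd ℂ) x - (starRingEnd ℂ) c) ^ 2)
      ((starRingEnd ℂ) x) := by
    have := (((hasDerivAt_id ((starRingEnd ℂ) x)).sub_const ((starRingEnd ℂ) c)).inv hne).const_mul
      ((lam : ℂ) ^ 2) |>.const_add c
    refine (this.congr_deriv ?_).congr_of_eventuallyEq (Eventually.of_forall fun y => ?_)
    · simp; ring
    · simp [hφdef, div_eq_mul_inv]
  obtain ⟨h1, -, h2⟩ := lapC_comp_holomorphic hφ (u := u) (by rwa [hφc])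
  obtain ⟨h3, h4⟩ := lapC_comp_conj (u := fun w => u (φ w)) h1
  simp only [hφc] at h2 h3 h4
  refine ⟨h3, ?_⟩
  rw [h4, h2, hd.deriv, norm_div, norm_neg, norm_pow, norm_pow, ← map_sub, Complex.norm_conj,
    Complex.norm_real, Real.norm_eq_abs, sq_abs]
  ring

/-- The geometric situation in which the method of moving spheres can be run. -/
structure SphereGeom (O : Set ℂ) (c : ℂ) (t₀ L : ℝ) : Prop where
  isOpen : IsOpen O
  bdd : Bornology.IsBounded O
  pos : 0 < t₀
  le : t₀ ≤ L
  dist : ∀ x ∈ closure O, ‖x - c‖ ≤ L → t₀ ≤ ‖x - c‖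
  refl_mem : ∀ lam ≤ L, ∀ x ∈ closure O, ‖x - c‖ < lam → refl c lam x ∈ O

namespace SphereGeom
variable {O : Set ℂ} {c : ℂ} {t₀ L : ℝ}

lemma ne (h : SphereGeom O c t₀ L) {x : ℂ} (hx : x ∈ closure O) (hxL : ‖x - c‖ ≤ L) : x ≠ c := by
  rintro rfl
  have := h.dist _ hx hxL
  simp only [sub_self, norm_zero] at this
  linarith [h.pos]

lemma refl_mem_closure (h : SphereGeom O c t₀ L) {lam : ℝ} (hl : lam ≤ L) {x : ℂ}
    (hx : x ∈ closure O) (hxl : ‖x - c‖ ≤ lam) : refl c lam x ∈ closure O := by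
  rcases hxl.lt_or_eq with h1 | h1
  · exact subset_closure (h.refl_mem lam hl x hx h1)
  · rw [← h1, refl_self (h.ne hx (hxl.trans hl))]; exact hx

lemma norm_refl_le (h : SphereGeom O c t₀ L) {lam : ℝ} (hl : lam ≤ L) {x : ℂ}
    (hx : x ∈ closure O) (hxl : ‖x - c‖ ≤ lam) : ‖refl c lam x - c‖ ≤ L ^ 2 / t₀ := by
  rw [norm_refl_sub]
  have h1 := h.dist x hx (hxl.trans hl)
  have h2 := h.pos
  have : 0 ≤ lam := (norm_nonneg _).trans hxl
  gcongr

lemma le_sq_div (h : SphereGeom O c t₀ L) : L ≤ L ^ 2 / t₀ := by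
  rw [le_div_iff₀ h.pos]
  nlinarith [h.pos, h.le]

lemma continuousOn_refl (h : SphereGeom O c t₀ L) {S : Set ℂ} {u : ℂ → ℝ} (hu : ContinuousOn u S)
    (hS : ∀ lam ≤ L, ∀ x ∈ closure O, ‖x - c‖ ≤ lam → refl c lam x ∈ S) :
    ContinuousOn (fun q : ℝ × ℂ => u (refl c q.1 q.2))
      {q | q.1 ≤ L ∧ q.2 ∈ closure O ∧ ‖q.2 - c‖ ≤ q.1} := by
  refine hu.comp (fun q hq => ?_) fun q hq => hS q.1 hq.1 q.2 hq.2.1 hq.2.2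
  exact (continuousAt_refl (h.ne hq.2.1 (hq.2.2.trans hq.1))).continuousWithinAt

lemma continuousOn_refl_slice (h : SphereGeom O c t₀ L) {S : Set ℂ} {u : ℂ → ℝ}
    (hu : ContinuousOn u S)
    (hS : ∀ lam ≤ L, ∀ x ∈ closure O, ‖x - c‖ ≤ lam → refl c lam x ∈ S) {lam : ℝ} (hl : lam ≤ L) :
    ContinuousOn (fun x => u (refl c lam x)) (closure O ∩ closedBall c lam) := by
  refine (h.continuousOn_refl hu hS).comp (f := fun x : ℂ => (lam, x))
    (Continuous.continuousOn (by fun_prop)) fun x hx => ⟨hl, hx.1, ?_⟩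
  simpa [dist_eq_norm] using hx.2

/-- Reflection comparison for positive harmonic functions vanishing on the boundary. -/
lemma le_refl_of_harmonic (h : SphereGeom O c t₀ L) {g : ℂ → ℝ}
    (hgc : ContinuousOn g (closure O ∩ closedBall c (L ^ 2 / t₀)))
    (hg : ∀ x ∈ O, ‖x - c‖ ≤ L ^ 2 / t₀ → ContDiffAt ℝ 2 g x ∧ lapC g x = 0)
    (hpos : ∀ x ∈ O, 0 ≤ g x) (hzero : ∀ x ∈ closure O, x ∉ O → g x = 0)
    {lam : ℝ} (hl : lam ≤ L) {x : ℂ} (hx : x ∈ O) (hxl : ‖x - c‖ ≤ lam) :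
    g x ≤ g (refl c lam x) := by
  have hS : ∀ lam ≤ L, ∀ x ∈ closure O, ‖x - c‖ ≤ lam →
      refl c lam x ∈ closure O ∩ closedBall c (L ^ 2 / t₀) := fun lam hl x hx hxl =>
    ⟨h.refl_mem_closure hl hx hxl, by simpa [dist_eq_norm] using h.norm_refl_le hl hx hxl⟩
  have hZ : IsCompact (closure O ∩ closedBall c lam) :=
    (isCompact_closedBall c lam).inter_left isClosed_closure
  have hgc' : ContinuousOn g (closure O ∩ closedBall c lam) :=
    hgc.mono (inter_subset_inter_right _ (closedBall_subset_closedBall (hl.trans h.le_sq_div)))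
  have hgnn : ∀ y ∈ closure O, 0 ≤ g y := fun y hy => by
    by_cases hyO : y ∈ O
    · exact hpos y hyO
    · rw [hzero y hy hyO]
  have key : ∀ ε : ℝ, 0 < ε → -(ε * lam ^ 2) ≤ g (refl c lam x) - g x := by
    intro ε hε
    set F : ℂ → ℝ := fun y => g (refl c lam y) - g y - ε * sqd c y with hF
    have hFc : ContinuousOn F (closure O ∩ closedBall c lam) :=
      ((h.continuousOn_refl_slice hgc hS hl).sub hgc').sub
        ((contDiff_sqd c (n := 0)).continuous.continuousOn.const_smul ε)
    obtain ⟨y, hy, hmin⟩ := hZ.exists_isMinOn ⟨x, subset_closure hx, by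
      simpa [dist_eq_norm] using hxl⟩ hFc
    have hyl : ‖y - c‖ ≤ lam := by simpa [dist_eq_norm] using hy.2
    have hsq : sqd c y ≤ lam ^ 2 := by
      rw [sqd_eq]; gcongr
    have hFx : F y ≤ F x := hmin ⟨subset_closure hx, by simpa [dist_eq_norm] using hxl⟩
    have hsx := sqd_nonneg c x
    suffices hs : 0 ≤ g (refl c lam y) - g y by
      have : -(ε * lam ^ 2) ≤ F y := by simp only [hF]; nlinarith
      have : F x ≤ g (refl c lam x) - g x := by simp only [hF]; nlinarith
      linarith
    by_cases hyO : y ∈ O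
    swap
    · rw [hzero y hy.1 hyO, sub_zero]
      exact hgnn _ (h.refl_mem_closure hl hy.1 hyl)
    rcases hyl.lt_or_eq with hlt | heq
    swap
    · rw [← heq, refl_self (h.ne hy.1 (hyl.trans hl)), sub_self]
    exfalso
    have hyc := h.ne hy.1 (hyl.trans hl)
    obtain ⟨hg1, hg2⟩ := hg y hyO ((hyl.trans hl).trans h.le_sq_div)
    obtain ⟨hg3, hg4⟩ := hg _ (h.refl_mem lam hl y hy.1 hlt) (h.norm_refl_le hl hy.1 hyl)
    obtain ⟨hr1, hr2⟩ := lapC_comp_refl hyc hg3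
    have hs1 : ContDiffAt ℝ 2 (fun y => ε * sqd c y) y :=
      contDiffAt_const.mul (contDiff_sqd c).contDiffAt
    have hloc : IsLocalMin F y := by
      have : O ∩ ball c lam ∈ 𝓝 y := (h.isOpen.inter isOpen_ball).mem_nhds
        ⟨hyO, by simpa [dist_eq_norm] using hlt⟩
      filter_upwards [this] with z hz
      exact hmin ⟨subset_closure hz.1, ball_subset_closedBall hz.2⟩
    have hlap := lapC_nonneg_of_isLocalMin ((hr1.sub hg1).sub hs1) hloc
    have hsqd : lapC (sqd c) y = 4 := by
      have := lapC_radial (ρ := fun s => s) (ρ' := fun _ => 1) (ρ'' := 0) (c := c) (z := y)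
        (Eventually.of_forall fun s => hasDerivAt_id s) (hasDerivAt_const _ _)
      simpa using this
    have e : lapC F y = -(ε * 4) := by
      simp only [hF]
      rw [lapC_sub (hr1.sub hg1) hs1, lapC_sub hr1 hg1, hr2, hg2, hg4,
        lapC_const_mul (contDiff_sqd c).contDiffAt, hsqd]
      ring
    rw [e] at hlap
    linarith
  by_contra hcon
  push Not at hcon
  have hd : 0 < g x - g (refl c lam x) := by linarith
  have := key ((g x - g (refl c lam x)) / (2 * (lam ^ 2 + 1))) (by positivity)
  have h2 : (g x - g (refl c lam x)) / (2 * (lam ^ 2 + 1)) * lam ^ 2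
      ≤ (g x - g (refl c lam x)) / 2 := by
    rw [div_mul_eq_mul_div, div_le_div_iff₀ (by positivity) (by positivity)]
    nlinarith
  linarith

end SphereGeom

lemma rpow_sub_rpow_le {a b p : ℝ} (ha : 0 < a) (hb : 0 ≤ b) (hp : 1 ≤ p) :
    a ^ p - b ^ p ≤ p * a ^ (p - 1) * (a - b) := by
  have h := one_add_mul_self_le_rpow_one_add (s := b / a - 1)
    (by linarith [div_nonneg hb ha.le]) hp
  have h1 : 1 + (b / a - 1) = b / a := by ring
  rw [h1, div_rpow hb ha.le] at h
  have hap : 0 < a ^ p := rpow_pos_of_pos ha p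
  have h2 := mul_le_mul_of_nonneg_left h hap.le
  rw [mul_div_cancel₀ _ hap.ne'] at h2
  have h3 : a ^ p = a ^ (p - 1) * a := by
    rw [← rpow_add_one ha.ne']; ring_nf
  have h4 : a ^ p * (1 + p * (b / a - 1)) = a ^ p + p * a ^ (p - 1) * (b - a) := by
    rw [h3]; field_simp
  linarith

/-- The barrier used near the reflecting circle. -/
def barrier (κ A : ℝ) (c y : ℂ) : ℝ := exp (-(κ * (sqd c y - A) ^ 2))

lemma barrier_pos (κ A : ℝ) (c y : ℂ) : 0 < barrier κ A c y := exp_pos _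

lemma contDiff_barrier (κ A : ℝ) (c : ℂ) : ContDiff ℝ 2 (barrier κ A c) := by
  unfold barrier
  exact ((contDiff_const.mul (((contDiff_sqd c).sub contDiff_const).pow 2)).neg).exp

lemma lapC_barrier (κ A : ℝ) (c y : ℂ) : lapC (barrier κ A c) y = barrier κ A c y *
    (4 * sqd c y * (-2 * κ + 4 * κ ^ 2 * (sqd c y - A) ^ 2) - 8 * κ * (sqd c y - A)) := by
  have h0 : ∀ s, HasDerivAt (fun s : ℝ => -(κ * (s - A) ^ 2)) (-2 * κ * (s - A)) s := fun s =>
    ((((hasDerivAt_id s).sub_const A).fun_pow 2).const_mul κ).fun_neg.congr_deriv (by simp; ring)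
  have h1 : ∀ s, HasDerivAt (fun s : ℝ => exp (-(κ * (s - A) ^ 2)))
      (exp (-(κ * (s - A) ^ 2)) * (-2 * κ * (s - A))) s := fun s => (h0 s).exp
  have h2 : HasDerivAt (fun s : ℝ => exp (-(κ * (s - A) ^ 2)) * (-2 * κ * (s - A)))
      (exp (-(κ * (sqd c y - A) ^ 2)) * (-2 * κ + 4 * κ ^ 2 * (sqd c y - A) ^ 2)) (sqd c y) := by
    have h3 : HasDerivAt (fun s : ℝ => -2 * κ * (s - A)) (-2 * κ) (sqd c y) := by
      simpa using ((hasDerivAt_id (sqd c y)).sub_const A).const_mul (-2 * κ)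
    refine ((h1 (sqd c y)).fun_mul h3).congr_deriv ?_
    ring
  unfold barrier
  rw [lapC_radial (Eventually.of_forall h1) h2]
  ring

lemma sub_le_of_barrier {t₀ L C₀ κ s A : ℝ} (ht : 0 < t₀) (hC₀0 : 0 ≤ C₀)
    (hκ : κ = (C₀ + 1) / (4 * t₀ ^ 2)) (hst : t₀ ^ 2 ≤ s) (hsl : s ≤ A) (hlL : A ≤ L ^ 2)
    (hE : 0 ≤ C₀ + (4 * s * (-2 * κ + 4 * κ ^ 2 * (s - A) ^ 2) - 8 * κ * (s - A))) :
    s ≤ A - 1 / (16 * L ^ 4 * κ ^ 2 + 8 * κ) := by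
  have hκ0 : 0 < κ := by rw [hκ]; positivity
  have hB0 : 0 < 16 * L ^ 4 * κ ^ 2 + 8 * κ := by positivity
  have hκs : 2 * (C₀ + 1) ≤ 8 * κ * s := by
    have : κ * t₀ ^ 2 = (C₀ + 1) / 4 := by rw [hκ]; field_simp
    nlinarith
  set d := A - s with hd
  have hd0 : 0 ≤ d := by linarith
  have hdL : d ≤ L ^ 2 := by linarith [sq_nonneg t₀]
  have h1 : 2 ≤ 16 * s * κ ^ 2 * d ^ 2 + 8 * κ * d := by
    have e : s - A = -d := by ring
    rw [e] at hE
    nlinarith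
  have h2 : 16 * s * κ ^ 2 * d ^ 2 + 8 * κ * d ≤ (16 * L ^ 4 * κ ^ 2 + 8 * κ) * d := by
    have e1 : s * d ≤ L ^ 2 * L ^ 2 := mul_le_mul (hsl.trans hlL) hdL hd0 (by positivity)
    have e2 : 16 * s * κ ^ 2 * d ^ 2 = 16 * κ ^ 2 * (s * d) * d := by ring
    rw [e2]
    have : 16 * κ ^ 2 * (s * d) * d ≤ 16 * κ ^ 2 * (L ^ 2 * L ^ 2) * d := by gcongr
    nlinarith
  have h3 : 1 / (16 * L ^ 4 * κ ^ 2 + 8 * κ) ≤ d := by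
    rw [div_le_iff₀ hB0]; linarith
  linarith

namespace SphereGeom
variable {O : Set ℂ} {c : ℂ} {t₀ L : ℝ} {u V : ℂ → ℝ} {p : ℝ}

/-- The equation and weight hypotheses for the method of moving spheres. -/
structure Sol (O : Set ℂ) (c : ℂ) (t₀ L : ℝ) (u V : ℂ → ℝ) (p : ℝ) : Prop where
  one_le : 1 ≤ p
  cont : ContinuousOn u (closure O)
  pos : ∀ x ∈ O, 0 < u x
  zero : ∀ x ∈ closure O, x ∉ O → u x = 0
  reg : ∀ x ∈ O, ‖x - c‖ ≤ L ^ 2 / t₀ → ContDiffAt ℝ 2 u x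
  eq : ∀ x ∈ O, ‖x - c‖ ≤ L ^ 2 / t₀ → -lapC u x = V x * u x ^ p
  mono : ∀ lam ≤ L, ∀ x ∈ O, ‖x - c‖ < lam → V x < (lam / ‖x - c‖) ^ 4 * V (refl c lam x)

lemma Sol.nonneg (hs : Sol O c t₀ L u V p) {x : ℂ} (hx : x ∈ closure O) : 0 ≤ u x := by
  by_cases h : x ∈ O
  · exact (hs.pos x h).le
  · rw [hs.zero x hx h]

lemma contDiffAt_diff (h : SphereGeom O c t₀ L) (hs : Sol O c t₀ L u V p) {lam : ℝ} (hl : lam ≤ L)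
    {y : ℂ} (hy : y ∈ O) (hyl : ‖y - c‖ < lam) :
    ContDiffAt ℝ 2 (fun y => u (refl c lam y) - u y) y ∧
    lapC (fun y => u (refl c lam y) - u y) y
      = V y * u y ^ p - (lam / ‖y - c‖) ^ 4 * V (refl c lam y) * u (refl c lam y) ^ p := by
  have hyc := subset_closure hy
  have h1 := h.norm_refl_le hl hyc hyl.le
  have h2 := h.refl_mem lam hl y hyc hyl
  have h3 := (hyl.le.trans hl).trans h.le_sq_div
  obtain ⟨hr1, hr2⟩ := lapC_comp_refl (h.ne hyc (hyl.le.trans hl)) (hs.reg _ h2 h1)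
  have hu := hs.reg y hy h3
  refine ⟨hr1.sub hu, ?_⟩
  have e1 := hs.eq _ h2 h1
  have e2 := hs.eq y hy h3
  rw [lapC_sub hr1 hu, hr2, show lapC u (refl c lam y) = -(V (refl c lam y) * u (refl c lam y) ^ p)
    by linarith, show lapC u y = -(V y * u y ^ p) by linarith]
  ring

/-- If the comparison fails for some radius, then it fails at a definite distance from the
reflecting circle. -/
lemma exists_bad_point (h : SphereGeom O c t₀ L) (hs : Sol O c t₀ L u V p) {V₁ : ℝ}
    (hV0 : ∀ x ∈ O, ‖x - c‖ ≤ L → 0 < V x) (hV₁ : ∀ x ∈ O, ‖x - c‖ ≤ L → V x ≤ V₁) :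
    ∃ δ > 0, ∀ lam ≤ L, (∃ x ∈ O, ‖x - c‖ < lam ∧ u (refl c lam x) < u x) →
      ∃ x ∈ O, ‖x - c‖ < lam ∧ u (refl c lam x) < u x ∧ sqd c x ≤ lam ^ 2 - δ := by
  have hcl : IsCompact (closure O) := h.bdd.isCompact_closure
  obtain ⟨M, hM⟩ := hcl.bddAbove_image hs.cont
  have hM' : ∀ x ∈ closure O, u x ≤ M := fun x hx => hM (mem_image_of_mem u hx)
  set C₀ := |p * V₁ * M ^ (p - 1)| with hC₀
  have hC₀0 : 0 ≤ C₀ := abs_nonneg _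
  set κ := (C₀ + 1) / (4 * t₀ ^ 2) with hκ
  have ht := h.pos
  have hLpos : 0 < L := ht.trans_le h.le
  have hκ0 : 0 < κ := by positivity
  set B := 16 * L ^ 4 * κ ^ 2 + 8 * κ with hB
  have hB0 : 0 < B := by positivity
  refine ⟨1 / B, by positivity, fun lam hl hbad => ?_⟩
  obtain ⟨x, hx, hxl, hux⟩ := hbad
  have hlam : 0 < lam := (norm_nonneg _).trans_lt hxl
  set b := barrier κ (lam ^ 2) c with hb
  have hbpos : ∀ y, 0 < b y := barrier_pos _ _ _
  have hbd : ContDiff ℝ 2 b := contDiff_barrier _ _ _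
  have hZ : IsCompact (closure O ∩ closedBall c lam) :=
    (isCompact_closedBall c lam).inter_left isClosed_closure
  have hxZ : x ∈ closure O ∩ closedBall c lam :=
    ⟨subset_closure hx, by simpa [dist_eq_norm] using hxl.le⟩
  set w : ℂ → ℝ := fun y => u (refl c lam y) - u y with hw
  have hwc : ContinuousOn w (closure O ∩ closedBall c lam) :=
    (h.continuousOn_refl_slice hs.cont (fun l hl y hy hyl => h.refl_mem_closure hl hy hyl) hl).sub
      (hs.cont.mono inter_subset_left)
  obtain ⟨y, hy, hmin⟩ := hZ.exists_isMinOn ⟨x, hxZ⟩ (f := fun y => w y / b y)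
    (hwc.div hbd.continuous.continuousOn fun y _ => (hbpos y).ne')
  have hyl : ‖y - c‖ ≤ lam := by simpa [dist_eq_norm] using hy.2
  have hwx : w x < 0 := by simp only [hw]; linarith
  have hQ : w y / b y < 0 :=
    (show w y / b y ≤ w x / b x from hmin hxZ).trans_lt (div_neg_of_neg_of_pos hwx (hbpos x))
  set m := -(w y / b y) with hm
  have hm0 : 0 < m := by linarith
  have hwy : w y = -(m * b y) := by
    have := (hbpos y).ne'
    simp only [hm]; field_simp
  have hwy0 : w y < 0 := by have := mul_pos hm0 (hbpos y); linarith
  have hyO : y ∈ O := by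
    by_contra hyO
    have : 0 ≤ w y := by
      simp only [hw, hs.zero y hy.1 hyO, sub_zero]
      exact hs.nonneg (h.refl_mem_closure hl hy.1 hyl)
    linarith
  have hylt : ‖y - c‖ < lam := by
    rcases hyl.lt_or_eq with h1 | h1
    · exact h1
    · simp only [hw, ← h1, refl_self (h.ne hy.1 (hyl.trans hl)), sub_self, lt_irrefl] at hwy0
  refine ⟨y, hyO, hylt, by simp only [hw] at hwy0; linarith, ?_⟩
  obtain ⟨hw1, hw2⟩ := h.contDiffAt_diff hs hl hyO hylt
  have hmb : ContDiffAt ℝ 2 (fun y => m * b y) y := contDiffAt_const.mul hbd.contDiffAt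
  have hloc : IsLocalMin (fun z => w z + m * b z) y := by
    have : O ∩ ball c lam ∈ 𝓝 y := (h.isOpen.inter isOpen_ball).mem_nhds
      ⟨hyO, by simpa [dist_eq_norm] using hylt⟩
    filter_upwards [this] with z hz
    have h1 : w y / b y ≤ w z / b z := hmin ⟨subset_closure hz.1, ball_subset_closedBall hz.2⟩
    have h2 : -m ≤ w z / b z := by linarith
    rw [le_div_iff₀ (hbpos z)] at h2
    rw [hwy]; linarith
  have hlap := lapC_nonneg_of_isLocalMin (hw1.add hmb) hloc
  have hlap' : 0 ≤ V y * u y ^ p - (lam / ‖y - c‖) ^ 4 * V (refl c lam y) * u (refl c lam y) ^ p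
      + m * (b y * (4 * sqd c y * (-2 * κ + 4 * κ ^ 2 * (sqd c y - lam ^ 2) ^ 2)
        - 8 * κ * (sqd c y - lam ^ 2))) := by
    rw [← lapC_barrier, ← hw2, ← lapC_const_mul hbd.contDiffAt, ← lapC_add hw1 hmb]
    exact hlap
  have huR : 0 ≤ u (refl c lam y) := hs.nonneg (h.refl_mem_closure hl hy.1 hyl)
  have huy := hs.pos y hyO
  have hVy := hV0 y hyO (hyl.trans hl)
  have hVy1 := hV₁ y hyO (hyl.trans hl)
  have hstep1 : V y * u y ^ p - (lam / ‖y - c‖) ^ 4 * V (refl c lam y) * u (refl c lam y) ^ p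
      ≤ C₀ * (m * b y) := by
    have e1 := mul_le_mul_of_nonneg_right (hs.mono lam hl y hyO hylt).le (rpow_nonneg huR p)
    have e2 := rpow_sub_rpow_le huy huR hs.one_le
    have e3 : u y - u (refl c lam y) = m * b y := by simp only [hw] at hwy; linarith
    have hmb0 : 0 < m * b y := mul_pos hm0 (hbpos y)
    have hp0 : 0 ≤ p := by linarith [hs.one_le]
    have e4 : u y ^ (p - 1) ≤ M ^ (p - 1) :=
      rpow_le_rpow huy.le (hM' y hy.1) (by linarith [hs.one_le])
    calc _ ≤ V y * (u y ^ p - u (refl c lam y) ^ p) := by linarith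
      _ ≤ V y * (p * u y ^ (p - 1) * (m * b y)) := by rw [← e3]; gcongr
      _ ≤ V₁ * (p * M ^ (p - 1) * (m * b y)) := by
          have : 0 ≤ V₁ := hVy.le.trans hVy1
          gcongr
      _ = (p * V₁ * M ^ (p - 1)) * (m * b y) := by ring
      _ ≤ _ := by gcongr; exact le_abs_self _
  set s := sqd c y with hsdef
  have hE : 0 ≤ C₀ + (4 * s * (-2 * κ + 4 * κ ^ 2 * (s - lam ^ 2) ^ 2) - 8 * κ * (s - lam ^ 2)) := by
    have hmb0 : 0 < m * b y := mul_pos hm0 (hbpos y)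
    have : 0 ≤ (m * b y) * (C₀ +
        (4 * s * (-2 * κ + 4 * κ ^ 2 * (s - lam ^ 2) ^ 2) - 8 * κ * (s - lam ^ 2))) := by linarith
    exact nonneg_of_mul_nonneg_right this hmb0
  have hst : t₀ ^ 2 ≤ s := by
    rw [hsdef, sqd_eq]
    have := h.dist y hy.1 (hyl.trans hl)
    gcongr
  have hsl : s ≤ lam ^ 2 := by rw [hsdef, sqd_eq]; gcongr
  have hlL : lam ^ 2 ≤ L ^ 2 := by gcongr
  rw [hB]
  exact sub_le_of_barrier ht hC₀0 hκ hst hsl hlL hE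

/-- The method of moving spheres. -/
theorem le_refl (h : SphereGeom O c t₀ L) (hs : Sol O c t₀ L u V p) {V₁ : ℝ}
    (hV0 : ∀ x ∈ O, ‖x - c‖ ≤ L → 0 < V x) (hV₁ : ∀ x ∈ O, ‖x - c‖ ≤ L → V x ≤ V₁)
    {lam : ℝ} (hl : lam ≤ L) {x : ℂ} (hx : x ∈ O) (hxl : ‖x - c‖ ≤ lam) :
    u x ≤ u (refl c lam x) := by
  rcases hxl.lt_or_eq with hlt | heq
  swap
  · rw [← heq, refl_self (h.ne (subset_closure hx) (hxl.trans hl))]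
  by_contra hcon
  push Not at hcon
  obtain ⟨δ, hδ, hbadpt⟩ := h.exists_bad_point hs hV0 hV₁
  set Bad : Set ℝ := {l | l ≤ L ∧ ∃ x ∈ O, ‖x - c‖ < l ∧ u (refl c l x) < u x} with hBad
  have hne : Bad.Nonempty := ⟨lam, hl, x, hx, hlt, hcon⟩
  have hlow : ∀ l ∈ Bad, t₀ ≤ l := by
    rintro l ⟨hlL, y, hy, hyl, -⟩
    exact (h.dist y (subset_closure hy) (hyl.le.trans hlL)).trans hyl.le
  have hbb : BddBelow Bad := ⟨t₀, hlow⟩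
  obtain ⟨ls, -, hls, hlsB⟩ := exists_seq_tendsto_sInf hne hbb
  set lb := sInf Bad with hlb
  have hlbL : lb ≤ L := (csInf_le hbb ⟨hl, x, hx, hlt, hcon⟩).trans hl
  have hlb0 : 0 < lb := h.pos.trans_le (le_csInf hne hlow)
  choose y hyO hyl hyu hyd using fun n => hbadpt (ls n) (hlsB n).1 (hlsB n).2
  have hcl : IsCompact (closure O) := h.bdd.isCompact_closure
  obtain ⟨z, hz, φ, hφ, hyz⟩ := hcl.tendsto_subseq fun n => subset_closure (hyO n)
  have hlsφ : Tendsto (fun n => ls (φ n)) atTop (𝓝 lb) := hls.comp hφ.tendsto_atTop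
  have hzd : sqd c z ≤ lb ^ 2 - δ := by
    refine le_of_tendsto_of_tendsto (((contDiff_sqd c (n := 0)).continuous.tendsto z).comp hyz)
      ((hlsφ.pow 2).sub_const δ) (Eventually.of_forall fun n => hyd (φ n))
  have hzl : ‖z - c‖ < lb := by
    rw [sqd_eq] at hzd
    exact lt_of_pow_lt_pow_left₀ 2 hlb0.le (by linarith)
  have hcont := h.continuousOn_refl hs.cont (fun l hl y hy hyl => h.refl_mem_closure hl hy hyl)
  have hzw : u (refl c lb z) ≤ u z := by
    have h1 : Tendsto (fun n => u (refl c (ls (φ n)) (y (φ n)))) atTop (𝓝 (u (refl c lb z))) := by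
      have h2 := hcont (lb, z) ⟨hlbL, hz, hzl.le⟩
      refine h2.tendsto.comp (f := fun n => (ls (φ n), y (φ n))) (tendsto_nhdsWithin_iff.2
        ⟨hlsφ.prodMk_nhds hyz, Eventually.of_forall fun n =>
          ⟨(hlsB (φ n)).1, subset_closure (hyO _), (hyl _).le⟩⟩)
    have h3 : Tendsto (fun n => u (y (φ n))) atTop (𝓝 (u z)) :=
      (hs.cont z hz).tendsto.comp (tendsto_nhdsWithin_iff.2
        ⟨hyz, Eventually.of_forall fun n => subset_closure (hyO _)⟩)
    exact le_of_tendsto_of_tendsto h1 h3 (Eventually.of_forall fun n => (hyu (φ n)).le)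
  have hnn : ∀ y ∈ O, ‖y - c‖ < lb → u y ≤ u (refl c lb y) := by
    intro y hy hyl
    have h1 : Tendsto (fun l => u (refl c l y)) (𝓝[<] lb) (𝓝 (u (refl c lb y))) := by
      have h2 := hcont (lb, y) ⟨hlbL, subset_closure hy, hyl.le⟩
      refine h2.tendsto.comp (f := fun l : ℝ => (l, y)) (tendsto_nhdsWithin_iff.2 ⟨?_, ?_⟩)
      · exact (tendsto_nhdsWithin_of_tendsto_nhds tendsto_id).prodMk_nhds tendsto_const_nhds
      · filter_upwards [Ioo_mem_nhdsLT hyl] with l hl'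
        exact ⟨hl'.2.le.trans hlbL, subset_closure hy, hl'.1.le⟩
    refine ge_of_tendsto h1 ?_
    filter_upwards [Ioo_mem_nhdsLT hyl] with l hl'
    by_contra hc
    push Not at hc
    exact absurd (csInf_le hbb (show l ∈ Bad from ⟨hl'.2.le.trans hlbL, y, hy, hl'.1, hc⟩))
      (not_le.2 hl'.2)
  have hRz := h.refl_mem lb hlbL z hz hzl
  by_cases hzO : z ∈ O
  swap
  · have := hs.pos _ hRz
    rw [hs.zero z hz hzO] at hzw
    linarith
  have hzeq : u (refl c lb z) = u z := le_antisymm hzw (hnn z hzO hzl)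
  obtain ⟨hw1, hw2⟩ := h.contDiffAt_diff hs hlbL hzO hzl
  have hloc : IsLocalMin (fun y => u (refl c lb y) - u y) z := by
    have : O ∩ ball c lb ∈ 𝓝 z := (h.isOpen.inter isOpen_ball).mem_nhds
      ⟨hzO, by simpa [dist_eq_norm] using hzl⟩
    filter_upwards [this] with y hy
    have := hnn y hy.1 (by simpa [dist_eq_norm] using hy.2)
    simp only [hzeq, sub_self]
    linarith
  have hlap := lapC_nonneg_of_isLocalMin hw1 hloc
  rw [hw2, hzeq] at hlap
  have h1 := mul_lt_mul_of_pos_right (hs.mono lb hlbL z hzO hzl) (rpow_pos_of_pos (hs.pos z hzO) p)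
  linarith

end SphereGeom

/-- Uniform cone condition: near every boundary point, `O` is stable under translations by vectors
of a wide fixed cone. -/
def HasCone {E : Type*} [NormedAddCommGroup E] [InnerProductSpace ℝ E] (O : Set E) (ε r : ℝ) :
    Prop :=
  ∀ y ∈ frontier O, ∃ n : E, ‖n‖ = 1 ∧ ∀ z ∈ ball y r, ∀ z' ∈ ball y r, z ∈ closure O → z' ≠ z →
    ε * ‖z' - z‖ ≤ inner ℝ n (z' - z) → z' ∈ O

lemma exists_hasCone {Ω : Set Plane} (hΩo : IsOpen Ω) (hΩb : Bornology.IsBounded Ω)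
    (hΩsm : SmoothBoundary Ω) {ε : ℝ} (hε : 0 < ε) : ∃ r > 0, HasCone Ω ε r := by
  have hloc : ∀ x ∈ frontier Ω, ∃ r > 0, ∃ n : Plane, ‖n‖ = 1 ∧ ∀ z ∈ ball x r, ∀ z' ∈ ball x r,
      z ∈ closure Ω → z' ≠ z → ε * ‖z' - z‖ ≤ inner ℝ n (z' - z) → z' ∈ Ω := by
    intro x hx
    obtain ⟨U, f, hU, hxU, hf, hfd, hΩU, hfrU⟩ := hΩsm x hx
    have hfx : ContDiffAt ℝ 1 f x := ((hf.contDiffAt (hU.mem_nhds hxU)).of_le (by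
      exact_mod_cast le_top))
    have hst : HasStrictFDerivAt f (fderiv ℝ f x) x := hfx.hasStrictFDerivAt (by simp)
    set g : Plane := (InnerProductSpace.toDual ℝ Plane).symm (fderiv ℝ f x) with hg
    have hgi : ∀ v, fderiv ℝ f x v = inner ℝ g v := fun v => by
      rw [hg, InnerProductSpace.toDual_symm_apply]
    have hg0 : g ≠ 0 := by
      rw [hg]; simpa using hfd x hxU
    have hgn : 0 < ‖g‖ := norm_pos_iff.2 hg0
    have hsmall := (hst.isLittleO).def (c := ε / 2 * ‖g‖) (by positivity)
    rw [nhds_prod_eq] at hsmall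
    obtain ⟨s, hs, t, ht, hst'⟩ := Filter.eventually_prod_iff.1 hsmall
    have hev : ∀ᶠ y in 𝓝 x, s y ∧ t y ∧ y ∈ U := hs.and (ht.and (hU.mem_nhds hxU))
    obtain ⟨r, hr, hball⟩ := Metric.eventually_nhds_iff_ball.1 hev
    refine ⟨r, hr, -(‖g‖⁻¹ • g), ?_, ?_⟩
    · rw [norm_neg, norm_smul, norm_inv, norm_norm, inv_mul_cancel₀ hgn.ne']
    · intro z hz z' hz' hzc hne hin
      obtain ⟨-, hzt, hzU⟩ := hball z hz
      obtain ⟨hzs', -, hzU'⟩ := hball z' hz'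
      have h1 : ‖f z' - f z - fderiv ℝ f x (z' - z)‖ ≤ ε / 2 * ‖g‖ * ‖z' - z‖ := hst' hzs' hzt
      have hfz : f z ≤ 0 := by
        by_cases hzΩ : z ∈ Ω
        · have : z ∈ Ω ∩ U := ⟨hzΩ, hzU⟩
          rw [hΩU] at this
          exact this.2.le
        · have : z ∈ frontier Ω ∩ U := ⟨⟨hzc, by rwa [hΩo.interior_eq]⟩, hzU⟩
          rw [hfrU] at this
          exact this.2.le
      rw [hgi, Real.norm_eq_abs] at h1
      rw [inner_neg_left, real_inner_smul_left] at hin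
      have h2 : ε * ‖g‖ * ‖z' - z‖ ≤ -inner ℝ g (z' - z) := by
        have := mul_le_mul_of_nonneg_left hin hgn.le
        rw [mul_neg, ← mul_assoc, ← mul_assoc, mul_inv_cancel₀ hgn.ne', one_mul] at this
        linarith
      have h3 : 0 < ‖z' - z‖ := norm_pos_iff.2 (sub_ne_zero.2 hne)
      have h4 : 0 < ε * ‖g‖ * ‖z' - z‖ := by positivity
      have h5 := (abs_le.1 h1).2
      have : z' ∈ {y ∈ U | f y < 0} := ⟨hzU', by linarith⟩
      rw [← hΩU] at this
      exact this.1
  choose! ρ hρ n hn hcone using hloc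
  have hcpt : IsCompact (frontier Ω) :=
    Metric.isCompact_of_isClosed_isBounded isClosed_frontier
      (hΩb.closure.subset frontier_subset_closure)
  obtain ⟨δ, hδ, hleb⟩ := lebesgue_number_lemma_of_metric (c := fun x : frontier Ω =>
    ball (x : Plane) (ρ x)) hcpt (fun _ => isOpen_ball) (fun x hx =>
      mem_iUnion.2 ⟨⟨x, hx⟩, mem_ball_self (hρ x hx)⟩)
  refine ⟨δ, hδ, fun y hy => ?_⟩
  obtain ⟨x, hx⟩ := hleb y hy
  exact ⟨n x, hn x x.2, fun z hz z' hz' => hcone x x.2 z (hx hz) z' (hx hz')⟩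

lemma HasCone.image {E F : Type*} [NormedAddCommGroup E] [InnerProductSpace ℝ E]
    [NormedAddCommGroup F] [InnerProductSpace ℝ F] {O : Set E} {ε r : ℝ} (h : HasCone O ε r)
    (e : E ≃ₗᵢ[ℝ] F) : HasCone (e '' O) ε r := by
  intro y hy
  have hfr : frontier (e '' O) = e '' frontier O := (e.toHomeomorph.image_frontier O).symm
  have hcl : closure (e '' O) = e '' closure O := (e.toHomeomorph.image_closure O).symm
  rw [hfr] at hy
  obtain ⟨y, hy, rfl⟩ := hy
  obtain ⟨n, hn, hc⟩ := h y hy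
  refine ⟨e n, by simpa using hn, fun z hz z' hz' hzc hne hin => ?_⟩
  rw [hcl] at hzc
  obtain ⟨z, hzc, rfl⟩ := hzc
  obtain ⟨z', rfl⟩ := e.surjective z'
  refine mem_image_of_mem e (hc z (by simpa using hz) z' (by simpa using hz') hzc
    (fun h => hne (by rw [h])) ?_)
  rwa [← map_sub, e.norm_map, e.inner_map_map] at hin

/-- `n` is an inner cone direction for `O` at its boundary point `y`. -/
structure ConeAt (O : Set ℂ) (y n : ℂ) (r : ℝ) : Prop where
  isOpen : IsOpen O
  mem : y ∈ frontier O
  norm : ‖n‖ = 1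
  cone : ∀ z ∈ ball y r, ∀ z' ∈ ball y r, z ∈ closure O → z' ≠ z →
    1 / 50 * ‖z' - z‖ ≤ inner ℝ n (z' - z) → z' ∈ O

lemma ConeAt.not_mem {O : Set ℂ} {y n : ℂ} {r : ℝ} (h : ConeAt O y n r) : y ∉ O := by
  have := h.mem
  rw [h.isOpen.frontier_eq] at this
  exact this.2

lemma ConeAt.neg_le_inner {O : Set ℂ} {y n : ℂ} {r : ℝ} (h : ConeAt O y n r) {x : ℂ}
    (hx : x ∈ closure O) (hxr : x ∈ ball y r) : -(1 / 50 * ‖x - y‖) ≤ inner ℝ n (x - y) := by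
  by_contra hc
  push Not at hc
  rcases eq_or_ne y x with rfl | hne
  · simp at hc
  refine h.not_mem (h.cone x hxr y (mem_ball_self ?_) hx hne ?_)
  · exact (dist_nonneg).trans_lt (mem_ball.1 hxr)
  · rw [← neg_sub x y, inner_neg_right, norm_neg]; linarith

lemma ConeAt.sphereGeom {O : Set ℂ} {y n x e : ℂ} {r s : ℝ} (h : ConeAt O y n r)
    (hb : Bornology.IsBounded O) (hs : 0 < s) (hr : 24 * s ≤ r) (hxy : ‖x - y‖ ≤ s / 20)
    (he : ‖e‖ = 1) (hne : 3 / 10 ≤ inner ℝ n e) :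
    SphereGeom O (x - s • e) (9 / 50 * s) (2 * s) := by
  have hcy : ‖(x - s • e) - y‖ ≤ 21 / 20 * s := by
    calc ‖(x - s • e) - y‖ = ‖(x - y) - s • e‖ := by congr 1; abel
      _ ≤ ‖x - y‖ + ‖s • e‖ := norm_sub_le _ _
      _ ≤ s / 20 + s := by rw [norm_smul, he, Real.norm_of_nonneg hs.le]; linarith
      _ = _ := by ring
  have hcn : inner ℝ n ((x - s • e) - y) ≤ -(1 / 4 * s) := by
    have h1 : inner ℝ n ((x - s • e) - y) = inner ℝ n (x - y) - s * inner ℝ n e := by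
      rw [show (x - s • e) - y = (x - y) - s • e by abel, inner_sub_right, inner_smul_right]
    have h2 := real_inner_le_norm n (x - y)
    rw [h.norm] at h2
    nlinarith
  have key : ∀ x' ∈ closure O, ‖x' - (x - s • e)‖ ≤ 2 * s →
      x' ∈ ball y r ∧ 9 / 50 * s + s / 200 ≤ inner ℝ n (x' - (x - s • e)) := by
    intro x' hx' hxL
    have h1 : ‖x' - y‖ ≤ 61 / 20 * s := by
      calc ‖x' - y‖ = ‖(x' - (x - s • e)) + ((x - s • e) - y)‖ := by congr 1; abel
        _ ≤ _ := norm_add_le _ _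
        _ ≤ 2 * s + 21 / 20 * s := add_le_add hxL hcy
        _ = _ := by ring
    have h2 : x' ∈ ball y r := by rw [mem_ball, dist_eq_norm]; linarith
    refine ⟨h2, ?_⟩
    have h3 := h.neg_le_inner hx' h2
    have h4 : inner ℝ n (x' - (x - s • e)) = inner ℝ n (x' - y) - inner ℝ n ((x - s • e) - y) := by
      rw [← inner_sub_right]; congr 1; abel
    rw [h4]; linarith
  have hdist : ∀ x' ∈ closure O, ‖x' - (x - s • e)‖ ≤ 2 * s → 9 / 50 * s ≤ ‖x' - (x - s • e)‖ := by
    intro x' hx' hxL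
    have h1 := (key x' hx' hxL).2
    have h2 := real_inner_le_norm n (x' - (x - s • e))
    rw [h.norm] at h2
    linarith
  refine ⟨h.isOpen, hb, by positivity, by linarith, hdist, ?_⟩
  intro lam hlam x' hx' hxl
  have hxL : ‖x' - (x - s • e)‖ ≤ 2 * s := hxl.le.trans hlam
  obtain ⟨hxb, hin⟩ := key x' hx' hxL
  have hd := hdist x' hx' hxL
  have hpos : 0 < ‖x' - (x - s • e)‖ := by linarith
  have hne' : x' ≠ x - s • e := by rintro h0; simp [h0] at hpos
  have hk : 1 < (lam / ‖x' - (x - s • e)‖) ^ 2 := by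
    have : 1 < lam / ‖x' - (x - s • e)‖ := (one_lt_div hpos).2 hxl
    nlinarith
  have hdiff : refl (x - s • e) lam x' - x' =
      ((lam / ‖x' - (x - s • e)‖) ^ 2 - 1 : ℝ) • (x' - (x - s • e)) := by
    rw [refl_eq _ hne', sub_smul, one_smul]; abel
  refine h.cone x' hxb _ ?_ hx' ?_ ?_
  · rw [mem_ball, dist_eq_norm]
    calc ‖refl (x - s • e) lam x' - y‖
        = ‖(refl (x - s • e) lam x' - (x - s • e)) + ((x - s • e) - y)‖ := by congr 1; abel
      _ ≤ _ := norm_add_le _ _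
      _ ≤ (2 * s) ^ 2 / (9 / 50 * s) + 21 / 20 * s := by
          refine add_le_add ?_ hcy
          rw [norm_refl_sub]
          have : 0 ≤ lam := hpos.le.trans hxl.le
          gcongr
      _ < r := by
          have : (2 * s) ^ 2 / (9 / 50 * s) = 200 / 9 * s := by field_simp; norm_num
          rw [this]; linarith
  · intro h0
    rw [h0, sub_self] at hdiff
    rcases smul_eq_zero.1 hdiff.symm with h1 | h1
    · linarith
    · exact hne' (sub_eq_zero.1 h1)
  · rw [hdiff, inner_smul_right, norm_smul, Real.norm_of_nonneg (by linarith)]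
    have : 1 / 50 * ‖x' - (x - s • e)‖ ≤ inner ℝ n (x' - (x - s • e)) := by linarith
    nlinarith

/-- Bounds for the potential near the boundary of the domain. -/
structure PotBounds (O : Set ℂ) (V : ℂ → ℝ) (d A B G : ℝ) : Prop where
  A_pos : 0 < A
  G_pos : 0 < G
  le : ∀ x ∈ O, d ≤ ‖x‖ → A ≤ V x
  ge : ∀ x ∈ O, d ≤ ‖x‖ → V x ≤ B
  diff : ∀ x ∈ O, d ≤ ‖x‖ → DifferentiableAt ℝ V x
  grad : ∀ x ∈ O, d ≤ ‖x‖ → ‖fderiv ℝ V x‖ ≤ G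

lemma PotBounds.log_le {O : Set ℂ} {V : ℂ → ℝ} {d A B G : ℝ} (h : PotBounds O V d A B G)
    {x x' : ℂ} (hseg : ∀ z ∈ segment ℝ x x', z ∈ O ∧ d ≤ ‖z‖) :
    Real.log (V x) - Real.log (V x') ≤ G / A * ‖x' - x‖ := by
  have h1 : ∀ z ∈ segment ℝ x x', HasFDerivAt (fun z => Real.log (V z))
      ((V z)⁻¹ • fderiv ℝ V z) z := fun z hz =>
    (h.diff z (hseg z hz).1 (hseg z hz).2).hasFDerivAt.log
      (h.A_pos.trans_le (h.le z (hseg z hz).1 (hseg z hz).2)).ne'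
  have := (convex_segment x x').norm_image_sub_le_of_norm_hasFDerivWithin_le
    (f := fun z => Real.log (V z)) (C := G / A) (fun z hz => (h1 z hz).hasFDerivWithinAt)
    (fun z hz => ?_) (left_mem_segment ℝ x x') (right_mem_segment ℝ x x')
  · rw [Real.norm_eq_abs, abs_le] at this
    linarith [this.1]
  · obtain ⟨hz1, hz2⟩ := hseg z hz
    have hA := h.le z hz1 hz2
    have hVp := h.A_pos.trans_le hA
    rw [norm_smul, norm_inv, Real.norm_of_nonneg hVp.le, div_eq_inv_mul]
    exact mul_le_mul (inv_anti₀ h.A_pos hA) (h.grad z hz1 hz2) (norm_nonneg _)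
      (inv_nonneg.2 h.A_pos.le)

lemma PotBounds.mono {O : Set ℂ} {V : ℂ → ℝ} {d A B G : ℝ} (h : PotBounds O V d A B G)
    {c x : ℂ} {lam s : ℝ} (hs : 0 < s) (hsG : 25 * s * (G / A) < 4) (hlam : lam ≤ 2 * s)
    (hx : 9 / 50 * s ≤ ‖x - c‖) (hxl : ‖x - c‖ < lam)
    (hseg : ∀ z ∈ segment ℝ x (refl c lam x), z ∈ O ∧ d ≤ ‖z‖) :
    V x < (lam / ‖x - c‖) ^ 4 * V (refl c lam x) := by
  have hpos : 0 < ‖x - c‖ := by linarith [mul_pos (by norm_num : (0:ℝ) < 9 / 50) hs]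
  have hxc : x ≠ c := by rintro h0; simp [h0] at hpos
  have hl0 : 0 < lam := hpos.trans hxl
  have hV := h.A_pos.trans_le (h.le x (hseg x (left_mem_segment ℝ _ _)).1
    (hseg x (left_mem_segment ℝ _ _)).2)
  have hV' := h.A_pos.trans_le (h.le _ (hseg _ (right_mem_segment ℝ x (refl c lam x))).1
    (hseg _ (right_mem_segment ℝ _ _)).2)
  have hlog := h.log_le hseg
  have hdiff : refl c lam x - x = ((lam / ‖x - c‖) ^ 2 - 1 : ℝ) • (x - c) := by
    rw [refl_eq _ hxc, sub_smul, one_smul]; abel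
  have hq : 1 < lam / ‖x - c‖ := (one_lt_div hpos).2 hxl
  rw [hdiff, norm_smul, Real.norm_of_nonneg (by nlinarith)] at hlog
  set t := ‖x - c‖ with ht
  have h1 : ((lam / t) ^ 2 - 1) * t = (1 - t / lam) * (lam * (lam + t) / t) := by
    field_simp; ring
  have h2 : lam * (lam + t) / t ≤ 25 * s := by
    rw [div_le_iff₀ hpos]; nlinarith
  have h3 : 0 < 1 - t / lam := by
    have := (div_lt_one hl0).2 hxl; linarith
  have h4 : 1 - t / lam ≤ Real.log (lam / t) := by
    have := Real.one_sub_inv_le_log_of_pos (div_pos hl0 hpos)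
    rwa [inv_div] at this
  have hGA : 0 < G / A := div_pos h.G_pos h.A_pos
  have h5 : Real.log (V x) < 4 * Real.log (lam / t) + Real.log (V (refl c lam x)) := by
    have : G / A * (((lam / t) ^ 2 - 1) * t) < 4 * (1 - t / lam) := by
      rw [h1]
      calc G / A * ((1 - t / lam) * (lam * (lam + t) / t))
          ≤ G / A * ((1 - t / lam) * (25 * s)) := by gcongr
        _ = (25 * s * (G / A)) * (1 - t / lam) := by ring
        _ < 4 * (1 - t / lam) := by gcongr
    linarith
  have hq0 : 0 < lam / t := div_pos hl0 hpos
  rw [← Real.log_lt_log_iff hV (by positivity), Real.log_mul (by positivity) hV'.ne', Real.log_pow]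
  exact_mod_cast h5

/-- A positive solution of `-Δu = V u ^ p` in the part `d ≤ ‖x‖` of `O` which vanishes on the
boundary. -/
structure OuterSol (O : Set ℂ) (d : ℝ) (u V : ℂ → ℝ) (p : ℝ) : Prop where
  one_le : 1 ≤ p
  cont : ContinuousOn u (closure O)
  pos : ∀ x ∈ O, 0 < u x
  zero : ∀ x ∈ closure O, x ∉ O → u x = 0
  reg : ∀ x ∈ O, d ≤ ‖x‖ → ContDiffAt ℝ 2 u x
  eq : ∀ x ∈ O, d ≤ ‖x‖ → -lapC u x = V x * u x ^ p

lemma refl_sub_smul {x e : ℂ} {s τ : ℝ} (hs : 0 < s) (he : ‖e‖ = 1) (hτ : 0 ≤ τ) :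
    refl (x - s • e) (√(s * (s + τ))) x = x + τ • e := by
  have h0 : x - (x - s • e) = s • e := by abel
  have hne : x ≠ x - s • e := by
    intro h
    have h1 : s • e = 0 := by rw [← h0, sub_eq_zero]; exact h
    have h2 : ‖s • e‖ = s := by rw [norm_smul, he, Real.norm_of_nonneg hs.le, mul_one]
    rw [h1, norm_zero] at h2
    linarith
  rw [refl_eq _ hne, h0, norm_smul, he, Real.norm_of_nonneg hs.le, mul_one, div_pow,
    Real.sq_sqrt (by positivity), smul_smul]
  have : s * (s + τ) / s ^ 2 * s = s + τ := by field_simp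
  rw [this, add_smul]
  abel

lemma norm_ge_of_near {y x e : ℂ} {s d : ℝ}
    (hyd : 2 * d ≤ ‖y‖) (hs : 0 < s) (hsd : 24 * s ≤ d) (hxy : ‖x - y‖ ≤ s / 20) (he : ‖e‖ = 1)
    {z : ℂ} (hz : ‖z - (x - s • e)‖ ≤ (2 * s) ^ 2 / (9 / 50 * s)) : d ≤ ‖z‖ := by
  have h1 : (2 * s) ^ 2 / (9 / 50 * s) = 200 / 9 * s := by field_simp; norm_num
  rw [h1] at hz
  have h2 : ‖z - y‖ ≤ 200 / 9 * s + (s / 20 + s) := by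
    calc ‖z - y‖ = ‖(z - (x - s • e)) + ((x - y) - s • e)‖ := by congr 1; abel
      _ ≤ _ := (norm_add_le _ _).trans (add_le_add hz (norm_sub_le _ _))
      _ ≤ _ := by rw [norm_smul, he, Real.norm_of_nonneg hs.le]; linarith
  have h3 : ‖y‖ ≤ ‖z‖ + ‖z - y‖ := by
    have := norm_sub_le z (z - y); simpa using this
  linarith

lemma ConeAt.le_add {O : Set ℂ} {y n x e : ℂ} {r s d A B G p τ : ℝ} {u V : ℂ → ℝ}
    (h : ConeAt O y n r) (hb : Bornology.IsBounded O) (hyd : 2 * d ≤ ‖y‖) (hs : 0 < s)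
    (hr : 24 * s ≤ r) (hsd : 24 * s ≤ d) (hsG : 25 * s * (G / A) < 4)
    (hV : PotBounds O V d A B G) (hu : OuterSol O d u V p) (hx : x ∈ O) (hxy : ‖x - y‖ ≤ s / 20)
    (he : ‖e‖ = 1) (hne : 3 / 10 ≤ inner ℝ n e) (hτ : 0 ≤ τ) (hτs : τ ≤ 3 * s) :
    u x ≤ u (x + τ • e) := by
  have hg := h.sphereGeom hb hs hr hxy he hne
  have hd : ∀ z, ‖z - (x - s • e)‖ ≤ (2 * s) ^ 2 / (9 / 50 * s) → d ≤ ‖z‖ := fun z hz =>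
    norm_ge_of_near hyd hs hsd hxy he hz
  have h2s : 2 * s ≤ (2 * s) ^ 2 / (9 / 50 * s) := by
    have h1 : (2 * s) ^ 2 / (9 / 50 * s) = 200 / 9 * s := by field_simp; norm_num
    rw [h1]; linarith
  rw [← refl_sub_smul hs he hτ]
  have hsol : SphereGeom.Sol O (x - s • e) (9 / 50 * s) (2 * s) u V p := by
    refine ⟨hu.one_le, hu.cont, hu.pos, hu.zero, fun z hz hzd => hu.reg z hz (hd z hzd),
      fun z hz hzd => hu.eq z hz (hd z hzd), fun lam hlam z hz hzl => ?_⟩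
    have hzL : ‖z - (x - s • e)‖ ≤ 2 * s := hzl.le.trans hlam
    have hzt := hg.dist z (subset_closure hz) hzL
    refine hV.mono hs hsG hlam hzt hzl fun w hw => ?_
    have hz0 : 0 < ‖z - (x - s • e)‖ := hg.pos.trans_le hzt
    have hlam0 : 0 < lam := hz0.trans hzl
    have hzne : z ≠ x - s • e := by rintro h0; simp [h0] at hz0
    have hwc : ‖w - (x - s • e)‖ ≤ (2 * s) ^ 2 / (9 / 50 * s) := by
      have hcv : Convex ℝ (closedBall (x - s • e) ((2 * s) ^ 2 / (9 / 50 * s))) :=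
        convex_closedBall _ _
      have := hcv.segment_subset (x := z) (y := refl (x - s • e) lam z) ?_ ?_ hw
      · simpa [dist_eq_norm] using this
      · rw [mem_closedBall, dist_eq_norm]; exact hzL.trans h2s
      · rw [mem_closedBall, dist_eq_norm, norm_refl_sub]; gcongr
    refine ⟨?_, hd w hwc⟩
    obtain ⟨θ, hθ, rfl⟩ := (segment_eq_image_lineMap ℝ z (refl (x - s • e) lam z)) ▸ hw
    rw [AffineMap.lineMap_apply, vsub_eq_sub, vadd_eq_add] at *
    rw [refl_eq _ hzne] at *
    set k := (lam / ‖z - (x - s • e)‖) ^ 2 with hk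
    have hk1 : 1 < k := by
      have : 1 < lam / ‖z - (x - s • e)‖ := (one_lt_div hz0).2 hzl
      rw [hk]; nlinarith
    have hm : 0 ≤ θ * (k - 1) := mul_nonneg hθ.1 (by linarith)
    have hlam' : ‖z - (x - s • e)‖ ≤ lam := hzl.le
    rcases hm.eq_or_lt with h0 | h0
    · have : θ • (x - s • e + k • (z - (x - s • e)) - z) + z = z := by
        have : x - s • e + k • (z - (x - s • e)) - z = (k - 1) • (z - (x - s • e)) := by
          rw [sub_smul, one_smul]; abel
        rw [this, smul_smul, ← h0, zero_smul, zero_add]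
      rw [this]; exact hz
    · have hw' : θ • (x - s • e + k • (z - (x - s • e)) - z) + z =
          refl (x - s • e) (√(1 + θ * (k - 1)) * ‖z - (x - s • e)‖) z := by
        have : x - s • e + k • (z - (x - s • e)) - z = (k - 1) • (z - (x - s • e)) := by
          rw [sub_smul, one_smul]; abel
        rw [refl_eq _ hzne, mul_div_assoc, div_self hz0.ne', mul_one, Real.sq_sqrt (by linarith),
          this, smul_smul, add_smul, one_smul]
        abel
      rw [hw']
      refine hg.refl_mem _ ?_ z (subset_closure hz) ?_
      · refine le_trans ?_ hlam
        have hs1 : √(1 + θ * (k - 1)) ≤ √k := Real.sqrt_le_sqrt (by nlinarith [hθ.2])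
        rw [hk, Real.sqrt_sq (by positivity)] at hs1
        calc √(1 + θ * (k - 1)) * ‖z - (x - s • e)‖
            ≤ lam / ‖z - (x - s • e)‖ * ‖z - (x - s • e)‖ := by gcongr
          _ = lam := by field_simp
      · have : 1 < √(1 + θ * (k - 1)) := by
          rw [Real.lt_sqrt (by norm_num)]; linarith
        nlinarith
  have hxn : ‖x - (x - s • e)‖ = s := by
    rw [show x - (x - s • e) = s • e by abel, norm_smul, he, Real.norm_of_nonneg hs.le, mul_one]
  refine hg.le_refl hsol (V₁ := B) (fun z hz hzL => ?_) (fun z hz hzL => ?_) ?_ hx ?_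
  · exact hV.A_pos.trans_le (hV.le z hz (hd z (hzL.trans h2s)))
  · exact hV.ge z hz (hd z (hzL.trans h2s))
  · rw [Real.sqrt_le_left (by positivity)]; nlinarith
  · rw [hxn]; apply Real.le_sqrt_of_sq_le; nlinarith

lemma ConeAt.le_add_of_harmonic {O : Set ℂ} {y n x e : ℂ} {r s d τ : ℝ} {g : ℂ → ℝ}
    (h : ConeAt O y n r) (hb : Bornology.IsBounded O) (hyd : 2 * d ≤ ‖y‖) (hs : 0 < s)
    (hr : 24 * s ≤ r) (hsd : 24 * s ≤ d)
    (hgc : ContinuousOn g (closure O ∩ {z | d ≤ ‖z‖}))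
    (hgh : ∀ z ∈ O, d ≤ ‖z‖ → ContDiffAt ℝ 2 g z ∧ lapC g z = 0)
    (hpos : ∀ z ∈ O, 0 ≤ g z) (hzero : ∀ z ∈ closure O, z ∉ O → g z = 0)
    (hx : x ∈ O) (hxy : ‖x - y‖ ≤ s / 20)
    (he : ‖e‖ = 1) (hne : 3 / 10 ≤ inner ℝ n e) (hτ : 0 ≤ τ) (hτs : τ ≤ 3 * s) :
    g x ≤ g (x + τ • e) := by
  have hg := h.sphereGeom hb hs hr hxy he hne
  have hd : ∀ z, ‖z - (x - s • e)‖ ≤ (2 * s) ^ 2 / (9 / 50 * s) → d ≤ ‖z‖ := fun z hz =>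
    norm_ge_of_near hyd hs hsd hxy he hz
  rw [← refl_sub_smul hs he hτ]
  have hxn : ‖x - (x - s • e)‖ = s := by
    rw [show x - (x - s • e) = s • e by abel, norm_smul, he, Real.norm_of_nonneg hs.le, mul_one]
  refine hg.le_refl_of_harmonic (hgc.mono ?_) (fun z hz hzL => hgh z hz (hd z hzL)) hpos hzero
    ?_ hx ?_
  · rintro z ⟨hz1, hz2⟩
    exact ⟨hz1, hd z (by simpa [dist_eq_norm] using hz2)⟩
  · rw [Real.sqrt_le_left (by positivity)]; nlinarith
  · rw [hxn]; apply Real.le_sqrt_of_sq_le; nlinarith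

/-- Points whose distance to the boundary is at least `s / 20`. -/
def core (O : Set ℂ) (s : ℝ) : Set ℂ := {x | x ∈ closure O ∧ ∀ y ∈ frontier O, s / 20 ≤ ‖x - y‖}

lemma core_subset {O : Set ℂ} {s : ℝ} (hs : 0 < s) : core O s ⊆ O := by
  rintro x ⟨hx, h⟩
  by_contra hxO
  have := h x ⟨hx, fun hi => hxO (interior_subset hi)⟩
  rw [sub_self, norm_zero] at this
  linarith

lemma isCompact_core {O : Set ℂ} (hb : Bornology.IsBounded O) (s : ℝ) : IsCompact (core O s) := by
  refine hb.isCompact_closure.of_isClosed_subset ?_ (fun x hx => hx.1)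
  have : core O s = closure O ∩ ⋂ y ∈ frontier O, {x | s / 20 ≤ ‖x - y‖} := by
    ext x; simp [core]
  rw [this]
  refine isClosed_closure.inter (isClosed_biInter fun y _ => ?_)
  exact isClosed_le continuous_const (by fun_prop)

lemma ConeAt.ball_subset {O : Set ℂ} {y n x z : ℂ} {r s : ℝ} (h : ConeAt O y n r) (hs : 0 < s)
    (hr : 24 * s ≤ r) (hx : x ∈ O) (hxy : ‖x - y‖ ≤ s / 20) (hz : ‖z - (x + (2 * s) • n)‖ ≤ s / 4) :
    z ∈ core O s ∧ ∃ e τ, ‖e‖ = 1 ∧ 3 / 10 ≤ inner ℝ n e ∧ 0 ≤ τ ∧ τ ≤ 3 * s ∧ z = x + τ • e := by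
  have hnn : inner ℝ n n = (1:ℝ) := by rw [real_inner_self_eq_norm_sq, h.norm]; norm_num
  have key : ∀ w, ‖w - (x + (2 * s) • n)‖ ≤ 3 / 10 * s →
      ‖w - x‖ ≤ 23 / 10 * s ∧ 17 / 10 * s ≤ inner ℝ n (w - x) := by
    intro w hw
    have h1 : w - x = (w - (x + (2 * s) • n)) + (2 * s) • n := by abel
    constructor
    · calc ‖w - x‖ ≤ ‖w - (x + (2 * s) • n)‖ + ‖(2 * s) • n‖ := by
            rw [h1]; exact norm_add_le _ _
        _ ≤ 3 / 10 * s + 2 * s := by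
            rw [norm_smul, h.norm, Real.norm_of_nonneg (by linarith)]; linarith
        _ = _ := by ring
    · have h2 := abs_le.1 (abs_real_inner_le_norm n (w - (x + (2 * s) • n)))
      rw [h.norm] at h2
      rw [h1, inner_add_right, inner_smul_right, hnn]
      linarith [h2.1]
  have hmem : ∀ w, ‖w - (x + (2 * s) • n)‖ ≤ 3 / 10 * s → w ∈ O := by
    intro w hw
    obtain ⟨h1, h2⟩ := key w hw
    refine h.cone x ?_ w ?_ (subset_closure hx) ?_ ?_
    · rw [mem_ball, dist_eq_norm]; linarith
    · rw [mem_ball, dist_eq_norm]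
      calc ‖w - y‖ = ‖(w - x) + (x - y)‖ := by congr 1; abel
        _ ≤ _ := norm_add_le _ _
        _ < r := by linarith
    · rintro rfl
      simp at h2; linarith
    · linarith
  have hzO : z ∈ O := hmem z (by linarith)
  refine ⟨⟨subset_closure hzO, fun y' hy' => ?_⟩, ?_⟩
  · by_contra hc
    push Not at hc
    rw [h.isOpen.frontier_eq] at hy'
    refine hy'.2 (hmem y' ?_)
    calc ‖y' - (x + (2 * s) • n)‖ = ‖(z - (x + (2 * s) • n)) - (z - y')‖ := by congr 1; abel
      _ ≤ _ := norm_sub_le _ _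
      _ ≤ _ := by linarith
  · obtain ⟨h1, h2⟩ := key z (by linarith)
    have h3 := real_inner_le_norm n (z - x)
    rw [h.norm, one_mul] at h3
    have hpos : 0 < ‖z - x‖ := by linarith
    refine ⟨(‖z - x‖)⁻¹ • (z - x), ‖z - x‖, ?_, ?_, norm_nonneg _, by linarith, ?_⟩
    · rw [norm_smul, norm_inv, norm_norm, inv_mul_cancel₀ hpos.ne']
    · rw [inner_smul_right, inv_mul_eq_div, le_div_iff₀ hpos]; linarith
    · rw [smul_smul, mul_inv_cancel₀ hpos.ne', one_smul]; abel

/-- A pair of mutually inverse conformal maps between `O` and the unit disc. -/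
structure ConfPair (O : Set ℂ) (ψ φ : ℂ → ℂ) : Prop where
  isOpen : IsOpen O
  mapsTo : ∀ x ∈ O, ψ x ∈ ball (0 : ℂ) 1
  mapsTo' : ∀ z ∈ ball (0 : ℂ) 1, φ z ∈ O
  left_inv : ∀ x ∈ O, φ (ψ x) = x
  right_inv : ∀ z ∈ ball (0 : ℂ) 1, ψ (φ z) = z
  zero : φ 0 = 0
  zero_mem : (0 : ℂ) ∈ O
  diff : DifferentiableOn ℂ ψ O
  diff' : DifferentiableOn ℂ φ (ball 0 1)

lemma IsRM.exists_confPair {O : Set ℂ} {ψ : ℂ → ℂ} (h : IsRM O ψ) (hO : IsOpen O)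
    (h0 : (0 : ℂ) ∈ O) (hsurj : ∀ w, ‖w‖ < 1 → ∃ z ∈ O, ψ z = w) : ∃ φ, ConfPair O ψ φ := by
  have hex : ∀ w, ∃ z, ‖w‖ < 1 → z ∈ O ∧ ψ z = w := by
    intro w
    by_cases hw : ‖w‖ < 1
    · obtain ⟨z, hz⟩ := hsurj w hw
      exact ⟨z, fun _ => hz⟩
    · exact ⟨0, fun h => absurd h hw⟩
  choose φ hφ using hex
  have hl : ∀ x ∈ O, φ (ψ x) = x := fun x hx =>
    h.inj (hφ _ (h.mapsTo x hx)).1 hx (hφ _ (h.mapsTo x hx)).2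
  refine ⟨φ, hO, fun x hx => by simpa using h.mapsTo x hx,
    fun z hz => (hφ z (by simpa using hz)).1, hl, fun z hz => (hφ z (by simpa using hz)).2,
    ?_, h0, h.diff, fun z hz => ?_⟩
  · have := hl 0 h0; rwa [h.zero] at this
  · have hz' : ‖z‖ < 1 := by simpa using hz
    obtain ⟨hxO, hxz⟩ := hφ z hz'
    have hs : HasStrictDerivAt ψ (deriv ψ (φ z)) (φ z) :=
      (h.diff.analyticAt (hO.mem_nhds hxO)).hasStrictDerivAt
    have hne := h.deriv_ne _ hxO
    have h1 := hs.to_localInverse hne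
    have h2 := hs.eventually_right_inverse hne
    have h3 : hs.localInverse ψ _ _ hne (ψ (φ z)) = φ z :=
      (hs.eventually_left_inverse hne).self_of_nhds
    rw [hxz] at h1 h2 h3
    have h4 : ∀ᶠ w in 𝓝 z, hs.localInverse ψ _ _ hne w ∈ O :=
      h1.hasDerivAt.continuousAt.eventually (by rw [h3]; exact hO.mem_nhds hxO)
    refine (h1.hasDerivAt.congr_of_eventuallyEq ?_).differentiableAt.differentiableWithinAt
    filter_upwards [h2, h4] with w hw1 hw2
    rw [← hl _ hw2, hw1]

namespace ConfPair
variable {O : Set ℂ} {ψ φ : ℂ → ℂ}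

lemma analyticAt (h : ConfPair O ψ φ) {x : ℂ} (hx : x ∈ O) : AnalyticAt ℂ ψ x :=
  h.diff.analyticAt (h.isOpen.mem_nhds hx)

lemma analyticAt' (h : ConfPair O ψ φ) {z : ℂ} (hz : z ∈ ball (0 : ℂ) 1) : AnalyticAt ℂ φ z :=
  h.diff'.analyticAt (isOpen_ball.mem_nhds hz)

lemma deriv_mul (h : ConfPair O ψ φ) {z : ℂ} (hz : z ∈ ball (0 : ℂ) 1) :
    deriv ψ (φ z) * deriv φ z = 1 := by
  have h1 := (h.analyticAt (h.mapsTo' z hz)).differentiableAt.hasDerivAt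
  have h2 := (h.analyticAt' hz).differentiableAt.hasDerivAt
  have h3 := h1.comp z h2
  have h4 : HasDerivAt (ψ ∘ φ) 1 z := (hasDerivAt_id z).congr_of_eventuallyEq <| by
    filter_upwards [isOpen_ball.mem_nhds hz] with w hw using h.right_inv w hw
  exact h3.unique h4

lemma deriv_ne (h : ConfPair O ψ φ) {z : ℂ} (hz : z ∈ ball (0 : ℂ) 1) : deriv φ z ≠ 0 := by
  intro h0; simpa [h0] using h.deriv_mul hz

lemma zero' (h : ConfPair O ψ φ) : ψ 0 = 0 := by
  have := h.right_inv 0 (by simp); rwa [h.zero] at this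

lemma eq_zero_iff (h : ConfPair O ψ φ) {z : ℂ} (hz : z ∈ ball (0 : ℂ) 1) : φ z = 0 ↔ z = 0 := by
  constructor
  · intro h0; rw [← h.right_inv z hz, h0, h.zero']
  · rintro rfl; exact h.zero

lemma eq_zero_iff' (h : ConfPair O ψ φ) {x : ℂ} (hx : x ∈ O) : ψ x = 0 ↔ x = 0 := by
  constructor
  · intro h0; rw [← h.left_inv x hx, h0, h.zero]
  · rintro rfl; exact h.zero'

/-- The function `-log |ψ|²`, extended by zero. -/
def green (O : Set ℂ) (ψ : ℂ → ℂ) (x : ℂ) : ℝ :=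
  open Classical in if x ∈ O then -Real.log (sqd 0 (ψ x)) else 0

lemma green_eq {x : ℂ} (hx : x ∈ O) : green O ψ x = -Real.log (sqd 0 (ψ x)) := if_pos hx

lemma green_eventuallyEq (h : ConfPair O ψ φ) {x : ℂ} (hx : x ∈ O) :
    green O ψ =ᶠ[𝓝 x] fun y => -Real.log (sqd 0 (ψ y)) := by
  filter_upwards [h.isOpen.mem_nhds hx] with y hy using green_eq hy

lemma sqd_pos (h : ConfPair O ψ φ) {x : ℂ} (hx : x ∈ O) (hx0 : x ≠ 0) : 0 < sqd 0 (ψ x) := by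
  have : ψ x ≠ 0 := fun h0 => hx0 ((h.eq_zero_iff' hx).1 h0)
  rw [sqd_eq, sub_zero]; positivity

lemma green_nonneg (h : ConfPair O ψ φ) (x : ℂ) : 0 ≤ green O ψ x := by
  by_cases hx : x ∈ O
  · rw [green_eq hx, neg_nonneg]
    refine Real.log_nonpos (sqd_nonneg _ _) ?_
    have : ‖ψ x‖ < 1 := by simpa using h.mapsTo x hx
    rw [sqd_eq, sub_zero]
    exact pow_le_one₀ (norm_nonneg _) this.le
  · simp [green, hx]

lemma green_harmonic (h : ConfPair O ψ φ) {x : ℂ} (hx : x ∈ O) (hx0 : x ≠ 0) :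
    ContDiffAt ℝ 2 (green O ψ) x ∧ lapC (green O ψ) x = 0 := by
  have hs := h.sqd_pos hx hx0
  have h1 : ContDiffAt ℝ 2 (fun y => -Real.log (sqd 0 y)) (ψ x) :=
    ((contDiff_sqd 0).contDiffAt.log hs.ne').neg
  obtain ⟨h2, -, h3⟩ := lapC_comp_holomorphic (h.analyticAt hx) h1
  refine ⟨h2.congr_of_eventuallyEq (h.green_eventuallyEq hx), ?_⟩
  rw [lapC_congr (h.green_eventuallyEq hx), h3]
  have h4 := lapC_radial (ρ := fun s => -Real.log s) (ρ' := fun s => -s⁻¹)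
    (ρ'' := (sqd 0 (ψ x) ^ 2)⁻¹) (c := 0) (z := ψ x) ?_ ?_
  · rw [h4]
    have : 4 * sqd 0 (ψ x) * (sqd 0 (ψ x) ^ 2)⁻¹ + 4 * -(sqd 0 (ψ x))⁻¹ = 0 := by
      field_simp; ring
    rw [this, mul_zero]
  · filter_upwards [lt_mem_nhds hs] with s hs'
    exact (Real.hasDerivAt_log hs'.ne').fun_neg
  · exact (hasDerivAt_inv hs.ne').fun_neg.congr_deriv (by simp)

lemma isCompact_image (h : ConfPair O ψ φ) {ρ : ℝ} (hρ : ρ < 1) :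
    IsCompact (φ '' closedBall 0 ρ) :=
  (isCompact_closedBall 0 ρ).image_of_continuousOn
    (h.diff'.continuousOn.mono (closedBall_subset_ball hρ))

lemma green_continuousOn (h : ConfPair O ψ φ) : ContinuousOn (green O ψ) {x | x ≠ 0} := by
  intro x hx
  have hx0 : x ≠ 0 := hx
  by_cases hxO : x ∈ O
  · exact (h.green_harmonic hxO hx0).1.continuousAt.continuousWithinAt
  · refine ContinuousAt.continuousWithinAt ?_
    have hgx : green O ψ x = 0 := by simp [green, hxO]
    rw [Metric.continuousAt_iff]
    intro ε hε
    set ρ := Real.exp (-ε / 2) with hρ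
    have hρ1 : ρ < 1 := by rw [hρ, ← Real.exp_zero]; exact Real.exp_lt_exp.2 (by linarith)
    have hρ0 : 0 < ρ := Real.exp_pos _
    have hxn : x ∈ (φ '' closedBall 0 ρ)ᶜ := by
      rintro ⟨z, hz, rfl⟩
      exact hxO (h.mapsTo' z (closedBall_subset_ball hρ1 hz))
    obtain ⟨δ, hδ, hball⟩ := Metric.isOpen_iff.1 (h.isCompact_image hρ1).isClosed.isOpen_compl x hxn
    refine ⟨δ, hδ, fun y hy => ?_⟩
    rw [hgx, dist_eq_norm, sub_zero, Real.norm_of_nonneg (h.green_nonneg y)]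
    by_cases hyO : y ∈ O
    · rw [green_eq hyO]
      have h1 : ρ < ‖ψ y‖ := by
        by_contra hc
        push Not at hc
        exact hball hy ⟨ψ y, by simpa using hc, h.left_inv y hyO⟩
      have h2 : ρ ^ 2 < sqd 0 (ψ y) := by
        rw [sqd_eq, sub_zero]; gcongr
      have h3 := Real.log_lt_log (by positivity) h2
      rw [Real.log_pow, hρ, Real.log_exp] at h3
      push_cast at h3
      linarith
    · simp [green, hyO, hε]

end ConfPair

lemma nonneg_of_hasDerivAt_of_le {f : ℝ → ℝ} {f' δ : ℝ} (hf : HasDerivAt f f' 0) (hδ : 0 < δ)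
    (h : ∀ t, 0 ≤ t → t ≤ δ → f 0 ≤ f t) : 0 ≤ f' := by
  refine ge_of_tendsto hf.tendsto_slope_zero_right ?_
  filter_upwards [self_mem_nhdsWithin, mem_nhdsWithin_of_mem_nhds (Iic_mem_nhds hδ)] with t ht1 ht2
  have ht : 0 < t := ht1
  rw [smul_eq_mul, zero_add]
  exact mul_nonneg (inv_nonneg.2 ht.le) (sub_nonneg.2 (h t ht.le ht2))

lemma cone_algebra {p q X Y S T : ℝ} (hpq : 0 < p ^ 2 + q ^ 2)
    (h1 : 0 ≤ 3 / 10 * (p * X + q * Y) + 19 / 20 * (-q * X + p * Y))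
    (h2 : 0 ≤ 3 / 10 * (p * X + q * Y) - 19 / 20 * (-q * X + p * Y))
    (h3 : 3 / 10 * (p * S + q * T) + 19 / 20 * (-q * S + p * T) ≤ 0)
    (h4 : 3 / 10 * (p * S + q * T) - 19 / 20 * (-q * S + p * T) ≤ 0) :
    3 / 5 * ((X ^ 2 + Y ^ 2) * (S ^ 2 + T ^ 2)) ≤ (S * X + T * Y) ^ 2 := by
  set a := p * X + q * Y
  set b := -q * X + p * Y
  set c := p * S + q * T with hc
  set e := -q * S + p * T
  have e1 : a ^ 2 + b ^ 2 = (p ^ 2 + q ^ 2) * (X ^ 2 + Y ^ 2) := by ring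
  have e2 : c ^ 2 + e ^ 2 = (p ^ 2 + q ^ 2) * (S ^ 2 + T ^ 2) := by ring
  have e3 : a * c + b * e = (p ^ 2 + q ^ 2) * (S * X + T * Y) := by ring
  have ha : 0 ≤ a := by linarith
  have hcn : c ≤ 0 := by linarith
  have hb : |b| ≤ 6 / 19 * a := by rw [abs_le]; constructor <;> linarith
  have he : |e| ≤ 6 / 19 * -c := by rw [abs_le]; constructor <;> linarith
  have hb2 : b ^ 2 ≤ 36 / 361 * a ^ 2 := by
    rw [← sq_abs b]; nlinarith [abs_nonneg b]
  have he2 : e ^ 2 ≤ 36 / 361 * c ^ 2 := by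
    rw [← sq_abs e]; nlinarith [abs_nonneg e]
  have hbe : |b * e| ≤ 36 / 361 * (a * -c) := by
    rw [abs_mul]
    calc |b| * |e| ≤ (6 / 19 * a) * (6 / 19 * -c) := by gcongr
      _ = _ := by ring
  have hac : 0 ≤ a * -c := mul_nonneg ha (by linarith)
  have k1 : 325 / 361 * (a * -c) ≤ -(a * c + b * e) := by
    have := (abs_le.1 hbe).2
    linarith
  have k2 : (325 / 361 * (a * -c)) ^ 2 ≤ (a * c + b * e) ^ 2 := by
    rw [← neg_sq (a * c + b * e)]
    exact pow_le_pow_left₀ (by positivity) k1 2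
  have k3 : (a ^ 2 + b ^ 2) * (c ^ 2 + e ^ 2) ≤ (397 / 361) ^ 2 * (a ^ 2 * c ^ 2) := by
    calc (a ^ 2 + b ^ 2) * (c ^ 2 + e ^ 2) ≤ (397 / 361 * a ^ 2) * (397 / 361 * c ^ 2) := by
          gcongr <;> linarith
      _ = _ := by ring
  have k4 : 3 / 5 * ((a ^ 2 + b ^ 2) * (c ^ 2 + e ^ 2)) ≤ (a * c + b * e) ^ 2 := by
    have : 0 ≤ a ^ 2 * c ^ 2 := by positivity
    nlinarith
  rw [e1, e2, e3] at k4
  have k5 : 0 < (p ^ 2 + q ^ 2) ^ 2 := by positivity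
  have : (p ^ 2 + q ^ 2) ^ 2 * (3 / 5 * ((X ^ 2 + Y ^ 2) * (S ^ 2 + T ^ 2))) ≤
      (p ^ 2 + q ^ 2) ^ 2 * (S * X + T * Y) ^ 2 := by linarith
  exact le_of_mul_le_mul_left this k5

/-- The cone condition for the pulled back solution near the boundary. -/
lemma ConeAt.pohE_ge {O : Set ℂ} {y n x : ℂ} {r s d A B G p : ℝ} {u V : ℂ → ℝ} {ψ φ : ℂ → ℂ}
    (h : ConeAt O y n r) (hb : Bornology.IsBounded O) (hyd : 2 * d ≤ ‖y‖) (hs : 0 < s)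
    (hr : 24 * s ≤ r) (hsd : 24 * s ≤ d) (hsG : 25 * s * (G / A) < 4)
    (hV : PotBounds O V d A B G) (hu : OuterSol O d u V p) (hP : ConfPair O ψ φ)
    (hx : x ∈ O) (hxy : ‖x - y‖ ≤ s / 20) :
    1 / 10 * (sqd 0 (ψ x) * (dx (fun z => u (φ z)) (ψ x) ^ 2 + dy (fun z => u (φ z)) (ψ x) ^ 2)) ≤
      pohE (fun z => u (φ z)) (ψ x) := by
  set z := ψ x with hz
  have hzb : z ∈ ball (0 : ℂ) 1 := hP.mapsTo x hx
  have hφz : φ z = x := hP.left_inv x hx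
  have hdx : d ≤ ‖x‖ := by
    have : ‖y‖ ≤ ‖x‖ + ‖x - y‖ := by
      have := norm_sub_le x (x - y); simpa using this
    linarith
  have hux : ContDiffAt ℝ 2 u x := hu.reg x hx hdx
  set v : ℂ → ℝ := fun z => u (φ z) with hv
  have hfd : ∀ w, fderiv ℝ v z w = fderiv ℝ u x (deriv φ z * w) := by
    have := (lapC_comp_holomorphic (hP.analyticAt' hzb) (u := u) (by rwa [hφz])).2.1
    rwa [hφz] at this
  have hn0 : n ≠ 0 := by rw [← norm_ne_zero_iff, h.norm]; norm_num
  have hφ0 := hP.deriv_ne hzb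
  -- directional derivatives along the cone
  have hline : ∀ e : ℂ, HasDerivAt (fun τ : ℝ => x + τ • e) e 0 := fun e => by
    simpa using ((hasDerivAt_id (0 : ℝ)).smul_const e).const_add x
  have hdir : ∀ e : ℂ, ‖e‖ = 1 → 3 / 10 ≤ inner ℝ n e →
      0 ≤ fderiv ℝ v z (e / deriv φ z) ∧ inner ℝ z (e / deriv φ z) ≤ 0 := by
    intro e he hne
    constructor
    · rw [hfd, mul_div_cancel₀ _ hφ0]
      have h1 : HasDerivAt (fun τ : ℝ => u (x + τ • e)) (fderiv ℝ u x e) 0 := by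
        have h2 : HasFDerivAt u (fderiv ℝ u x) (x + (0 : ℝ) • e) := by
          simpa using (hux.differentiableAt (by norm_num)).hasFDerivAt
        exact h2.comp_hasDerivAt 0 (hline e)
      refine nonneg_of_hasDerivAt_of_le h1 (δ := 3 * s) (by positivity) fun t ht0 ht => ?_
      simpa using h.le_add hb hyd hs hr hsd hsG hV hu hx hxy he hne ht0 ht
    · have h1 : HasDerivAt (fun τ : ℝ => ψ (x + τ • e)) (deriv ψ x * e) 0 := by
        have h2 : HasDerivAt ψ (deriv ψ x) (x + (0 : ℝ) • e) := by
          simpa using (hP.analyticAt hx).differentiableAt.hasDerivAt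
        have := h2.scomp 0 (hline e)
        simpa [mul_comm, Function.comp_def] using this
      have h3 : deriv ψ x * e = e / deriv φ z := by
        have := hP.deriv_mul hzb
        rw [hφz] at this
        rw [eq_div_iff hφ0]
        linear_combination e * this
      have h4 := h1.norm_sq.fun_neg
      have h5 : 0 ≤ -(2 * inner ℝ (ψ (x + (0 : ℝ) • e)) (deriv ψ x * e)) := by
        have hev : ∀ᶠ τ in 𝓝 (0 : ℝ), x + τ • e ∈ O ∧ x + τ • e ≠ 0 := by
          refine (hline e).continuousAt.eventually (p := fun w => w ∈ O ∧ w ≠ 0) ?_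
          simp only [zero_smul, add_zero]
          refine (h.isOpen.eventually_mem hx).and (eventually_ne_nhds ?_)
          rintro rfl; simp at hdx; linarith
        obtain ⟨δ, hδ, hδO⟩ := Metric.eventually_nhds_iff.1 hev
        refine nonneg_of_hasDerivAt_of_le h4 (δ := min (δ / 2) (3 * s)) (by positivity) fun t ht0 ht => ?_
        have hmem := hδO (y := t) (by
          rw [dist_zero_right, Real.norm_of_nonneg ht0]
          linarith [ht.trans (min_le_left _ _)])
        have hmem0 := hδO (y := 0) (by simpa using hδ)
        have := h.le_add_of_harmonic (g := ConfPair.green O ψ) hb hyd hs hr hsd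
          (hP.green_continuousOn.mono fun w hw => by
            rintro rfl; have := hw.2; simp at this; linarith)
          (fun w hw hwd => hP.green_harmonic hw (by rintro rfl; simp at hwd; linarith))
          (fun w _ => hP.green_nonneg w) (fun w _ hw => by simp [ConfPair.green, hw])
          hx hxy he hne ht0 (ht.trans (min_le_right _ _))
        rw [ConfPair.green_eq hx, ConfPair.green_eq hmem.1, neg_le_neg_iff,
          Real.log_le_log_iff (hP.sqd_pos hmem.1 hmem.2) (hP.sqd_pos hx (by
            simpa using hmem0.2)), sqd_eq, sqd_eq, sub_zero, sub_zero] at this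
        simpa using this
      rw [h3, zero_smul, add_zero] at h5
      linarith
  -- the weaker statement for vectors of norm at most one
  have hdir' : ∀ e : ℂ, ‖e‖ ≤ 1 → 3 / 10 ≤ inner ℝ n e →
      0 ≤ fderiv ℝ v z (e / deriv φ z) ∧ inner ℝ z (e / deriv φ z) ≤ 0 := by
    intro e he hne
    have he0 : 0 < ‖e‖ := by
      have := real_inner_le_norm n e
      rw [h.norm] at this; linarith
    obtain ⟨h1, h2⟩ := hdir ((‖e‖)⁻¹ • e)
      (by rw [norm_smul, norm_inv, norm_norm, inv_mul_cancel₀ he0.ne'])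
      (by
        rw [inner_smul_right, inv_mul_eq_div, le_div_iff₀ he0]
        nlinarith)
    rw [smul_div_assoc] at h1 h2
    rw [map_smul, smul_eq_mul] at h1
    rw [inner_smul_right] at h2
    exact ⟨nonneg_of_mul_nonneg_right h1 (inv_pos.2 he0),
      nonpos_of_mul_nonpos_right h2 (inv_pos.2 he0)⟩
  set m := n / deriv φ z with hm
  have hnn : n.re ^ 2 + n.im ^ 2 = 1 := by
    have h1 : ‖n‖ ^ 2 = 1 := by rw [h.norm]; norm_num
    rw [← Complex.normSq_eq_norm_sq, Complex.normSq_apply] at h1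
    linarith
  have hcone : ∀ σ : ℝ, σ ^ 2 = (19 / 20) ^ 2 →
      0 ≤ 3 / 10 * (m.re * dx v z + m.im * dy v z) + σ * (-m.im * dx v z + m.re * dy v z) ∧
      3 / 10 * (m.re * z.re + m.im * z.im) + σ * (-m.im * z.re + m.re * z.im) ≤ 0 := by
    intro σ hσ
    have h1 := hdir' ((3 / 10 + σ * Complex.I) * n) ?_ ?_
    · rw [mul_div_assoc, ← hm, fderiv_eq, Complex.inner] at h1
      simp only [Complex.mul_re, Complex.mul_im, Complex.add_re, Complex.add_im, Complex.ofReal_re,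
        Complex.ofReal_im, Complex.I_re, Complex.I_im, Complex.conj_re, Complex.conj_im,
        Complex.div_ofNat_re, Complex.div_ofNat_im, Complex.re_ofNat, Complex.im_ofNat] at h1
      constructor
      · refine h1.1.trans_eq ?_; ring
      · refine le_trans (le_of_eq ?_) h1.2; ring
    · rw [norm_mul, h.norm, mul_one, ← abs_of_nonneg (norm_nonneg _), abs_le_one_iff_mul_self_le_one,
        ← sq, ← Complex.normSq_eq_norm_sq, Complex.normSq_apply]
      simp
      nlinarith
    · rw [Complex.inner]
      simp
      nlinarith
  have hm0 : 0 < m.re ^ 2 + m.im ^ 2 := by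
    have : m ≠ 0 := div_ne_zero hn0 hφ0
    have := Complex.normSq_pos.2 this
    rw [Complex.normSq_apply] at this
    nlinarith
  obtain ⟨a1, a2⟩ := hcone (19 / 20) rfl
  obtain ⟨b1, b2⟩ := hcone (-(19 / 20)) (by norm_num)
  have := cone_algebra hm0 a1 (by linarith) a2 (by linarith)
  have hpoh : pohE v z = (z.re * dx v z + z.im * dy v z) ^ 2
      - sqd 0 z * (dx v z ^ 2 + dy v z ^ 2) / 2 := rfl
  have hsq : sqd 0 z = z.re ^ 2 + z.im ^ 2 := by simp [sqd]
  rw [hpoh, hsq]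
  linarith

/-- The geometric data near the boundary of the domain used for the moving sphere estimates. -/
structure Collar (O : Set ℂ) (V : ℂ → ℝ) (r d A B G s : ℝ) : Prop where
  isOpen : IsOpen O
  bdd : Bornology.IsBounded O
  cone : ∀ y ∈ frontier O, ∃ n, ConeAt O y n r
  far : ∀ y ∈ frontier O, 2 * d ≤ ‖y‖
  s_pos : 0 < s
  s_le_r : 24 * s ≤ r
  s_le_d : 24 * s ≤ d
  s_lt : 25 * s * (G / A) < 4
  pot : PotBounds O V d A B G

namespace Collar
variable {O : Set ℂ} {V u : ℂ → ℝ} {ψ φ : ℂ → ℂ} {r d A B G s p : ℝ}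

lemma d_pos (h : Collar O V r d A B G s) : 0 < d := by linarith [h.s_pos, h.s_le_d]

lemma exists_near (h : Collar O V r d A B G s) {x : ℂ} (hx : x ∈ O) (hxc : x ∉ core O s) :
    ∃ y n, ConeAt O y n r ∧ ‖x - y‖ ≤ s / 20 := by
  have : ∃ y ∈ frontier O, ‖x - y‖ < s / 20 := by
    by_contra hc
    push Not at hc
    exact hxc ⟨subset_closure hx, hc⟩
  obtain ⟨y, hy, hxy⟩ := this
  obtain ⟨n, hn⟩ := h.cone y hy
  exact ⟨y, n, hn, hxy.le⟩

lemma exists_ball (h : Collar O V r d A B G s) (hu : OuterSol O d u V p) {x : ℂ} (hx : x ∈ O)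
    (hxc : x ∉ core O s) :
    ∃ c, ∀ z ∈ closedBall c (s / 4), z ∈ core O s ∧ z ∈ O ∧ d ≤ ‖z‖ ∧ u x ≤ u z := by
  obtain ⟨y, n, hn, hxy⟩ := h.exists_near hx hxc
  refine ⟨x + (2 * s) • n, fun z hz => ?_⟩
  rw [mem_closedBall, dist_eq_norm] at hz
  obtain ⟨h1, e, τ, he, hne, hτ, hτs, rfl⟩ := hn.ball_subset h.s_pos h.s_le_r hx hxy hz
  refine ⟨h1, core_subset h.s_pos h1, ?_, ?_⟩
  · have h2 : ‖(x + τ • e) - y‖ ≤ s / 20 + 3 * s := by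
      calc ‖(x + τ • e) - y‖ = ‖(x - y) + τ • e‖ := by congr 1; abel
        _ ≤ _ := norm_add_le _ _
        _ ≤ _ := by rw [norm_smul, he, Real.norm_of_nonneg hτ]; linarith
    have h3 : ‖y‖ ≤ ‖x + τ • e‖ + ‖(x + τ • e) - y‖ := by
      have := norm_sub_le (x + τ • e) ((x + τ • e) - y); simpa using this
    linarith [h.far y hn.mem, h.s_le_d, h.s_pos]
  · exact hn.le_add h.bdd (h.far y hn.mem) h.s_pos h.s_le_r h.s_le_d h.s_lt h.pot hu hx hxy he hne
      hτ hτs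

lemma le_norm (h : Collar O V r d A B G s) {x : ℂ} (hx : x ∈ O) (hxc : x ∉ core O s) :
    d ≤ ‖x‖ := by
  obtain ⟨y, n, hn, hxy⟩ := h.exists_near hx hxc
  have h3 : ‖y‖ ≤ ‖x‖ + ‖x - y‖ := by
    have := norm_sub_le x (x - y); simpa using this
  linarith [h.far y hn.mem, h.s_le_d, h.s_pos]

/-- A solution is bounded near the boundary. -/
lemma bound (h : Collar O V r d A B G s) (hu : OuterSol O d u V p) {x : ℂ} (hx : x ∈ O)
    (hxc : x ∉ core O s) : A * u x ^ (p - 1) * (s / 4) ^ 2 ≤ 32 := by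
  obtain ⟨c, hc⟩ := h.exists_ball hu hx hxc
  have hs := h.s_pos
  refine supersolution_bound (u := u) (x := c) (by positivity) (hu.pos x hx) h.pot.A_pos.le
    hu.one_le (hu.cont.mono fun z hz => subset_closure (hc z hz).2.1)
    (fun z hz => hu.reg z (hc z (ball_subset_closedBall hz)).2.1
      (hc z (ball_subset_closedBall hz)).2.2.1)
    (fun z hz => (hc z hz).2.2.2) (fun z hz => ?_)
  obtain ⟨-, h1, h2, -⟩ := hc z (ball_subset_closedBall hz)
  rw [hu.eq z h1 h2]
  exact mul_le_mul_of_nonneg_right (h.pot.le z h1 h2) (Real.rpow_nonneg (hu.pos z h1).le _)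

lemma pointwise_le (h : Collar O V r d A B G s) (hu : OuterSol O d u V p)
    (hV : ∀ x ∈ O, 0 ≤ V x) (hi : IntegrableOn (fun x => V x * u x ^ p) O) {x : ℂ} (hx : x ∈ O)
    (hxc : x ∉ core O s) :
    V x * u x ^ p ≤ B / A * (π * (s / 4) ^ 2)⁻¹ * ∫ z in core O s, V z * u z ^ p := by
  obtain ⟨c, hc⟩ := h.exists_ball hu hx hxc
  have hs := h.s_pos
  have hA := h.pot.A_pos
  have hp0 : 0 ≤ p := zero_le_one.trans hu.one_le
  have hcO : core O s ⊆ O := core_subset hs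
  have hvol := volReal_closedBall c (r := s / 4) (by positivity)
  have hux := hu.pos x hx
  have hB0 : 0 ≤ B := hA.le.trans ((h.pot.le x hx (h.le_norm hx hxc)).trans
    (h.pot.ge x hx (h.le_norm hx hxc)))
  have h1 : ∀ z ∈ closedBall c (s / 4), V x * u x ^ p ≤ B / A * (V z * u z ^ p) := by
    intro z hz
    obtain ⟨-, hz1, hz2, hz3⟩ := hc z hz
    have h2 : V x ≤ B / A * V z := by
      rw [div_mul_eq_mul_div, le_div_iff₀ hA]
      exact mul_le_mul (h.pot.ge x hx (h.le_norm hx hxc)) (h.pot.le z hz1 hz2) hA.le hB0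
    rw [← mul_assoc]
    exact mul_le_mul h2 (Real.rpow_le_rpow hux.le hz3 hp0) (Real.rpow_nonneg hux.le _)
      (mul_nonneg (div_nonneg hB0 hA.le) (hV z hz1))
  have h2 : ∫ _z in closedBall c (s / 4), V x * u x ^ p ≤
      ∫ z in closedBall c (s / 4), B / A * (V z * u z ^ p) := by
    refine setIntegral_mono_on ?_ ?_ measurableSet_closedBall h1
    · exact integrableOn_const (isCompact_closedBall c _).measure_lt_top.ne
    · exact (hi.mono_set fun z hz => (hc z hz).2.1).const_mul _
  rw [setIntegral_const, integral_const_mul, hvol, smul_eq_mul] at h2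
  have h3 : ∫ z in closedBall c (s / 4), V z * u z ^ p ≤ ∫ z in core O s, V z * u z ^ p := by
    refine setIntegral_mono_set (hi.mono_set hcO) ?_ ?_
    · refine (ae_restrict_iff' (isCompact_core h.bdd s).measurableSet).2 (.of_forall fun z hz => ?_)
      exact mul_nonneg (hV z (hcO hz)) (Real.rpow_nonneg (hu.pos z (hcO hz)).le _)
    · exact (show closedBall c (s / 4) ⊆ core O s from fun z hz => (hc z hz).1).eventuallyLE
  have hpos : 0 < π * (s / 4) ^ 2 := by positivity
  calc V x * u x ^ p = (π * (s / 4) ^ 2)⁻¹ * (π * (s / 4) ^ 2 * (V x * u x ^ p)) := by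
        field_simp
    _ ≤ (π * (s / 4) ^ 2)⁻¹ * (B / A * ∫ z in core O s, V z * u z ^ p) := by
        exact mul_le_mul_of_nonneg_left (h2.trans (mul_le_mul_of_nonneg_left h3
          (div_nonneg hB0 hA.le))) (inv_nonneg.2 hpos.le)
    _ = _ := by ring

/-- The total mass is controlled by the interior mass. -/
lemma mass_le (h : Collar O V r d A B G s) (hu : OuterSol O d u V p)
    (hV : ∀ x ∈ O, 0 ≤ V x) (hi : IntegrableOn (fun x => V x * u x ^ p) O) :
    ∫ z in O, V z * u z ^ p ≤
      (1 + volume.real O * (|B| / A * (π * (s / 4) ^ 2)⁻¹)) * ∫ z in core O s, V z * u z ^ p := by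
  have hs := h.s_pos
  have hA := h.pot.A_pos
  have hcO : core O s ⊆ O := core_subset hs
  have hm := (isCompact_core h.bdd s).measurableSet
  have hfin : volume O ≠ ⊤ := h.bdd.measure_lt_top.ne
  have hm0 : 0 ≤ ∫ z in core O s, V z * u z ^ p := setIntegral_nonneg hm fun z hz =>
    mul_nonneg (hV z (hcO hz)) (Real.rpow_nonneg (hu.pos z (hcO hz)).le _)
  have h1 : ∫ z in O, V z * u z ^ p =
      (∫ z in core O s, V z * u z ^ p) + ∫ z in O \ core O s, V z * u z ^ p := by
    have := setIntegral_union (μ := volume) (f := fun z => V z * u z ^ p)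
      (disjoint_sdiff_right (s := core O s) (t := O)) (h.isOpen.measurableSet.diff hm)
      (hi.mono_set hcO) (hi.mono_set sdiff_subset)
    rwa [union_sdiff_cancel hcO] at this
  set m := ∫ z in core O s, V z * u z ^ p with hmdef
  set C := |B| / A * (π * (s / 4) ^ 2)⁻¹ with hC
  have hC0 : 0 ≤ C := by positivity
  have h2 : ∫ z in O \ core O s, V z * u z ^ p ≤ ∫ _z in O \ core O s, C * m := by
    refine setIntegral_mono_on (hi.mono_set sdiff_subset) ?_ (h.isOpen.measurableSet.diff hm) ?_
    · exact integrableOn_const (measure_mono sdiff_subset |>.trans_lt hfin.lt_top).ne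
    · intro z hz
      refine (h.pointwise_le hu hV hi hz.1 hz.2).trans ?_
      rw [hC]
      gcongr
      exact le_abs_self B
  rw [setIntegral_const, smul_eq_mul] at h2
  have h3 : volume.real (O \ core O s) ≤ volume.real O := measureReal_mono sdiff_subset hfin
  have h4 : volume.real (O \ core O s) * (C * m) ≤ volume.real O * (C * m) := by gcongr
  rw [h1]
  linarith

lemma pohE_ge (h : Collar O V r d A B G s) (hu : OuterSol O d u V p) (hP : ConfPair O ψ φ)
    {z : ℂ} (hz : z ∈ ball (0 : ℂ) 1) (hzc : φ z ∉ core O s) :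
    1 / 10 * (sqd 0 z * (dx (fun z => u (φ z)) z ^ 2 + dy (fun z => u (φ z)) z ^ 2)) ≤
      pohE (fun z => u (φ z)) z := by
  have hx := hP.mapsTo' z hz
  obtain ⟨y, n, hn, hxy⟩ := h.exists_near hx hzc
  have := hn.pohE_ge h.bdd (h.far y hn.mem) h.s_pos h.s_le_r h.s_le_d h.s_lt h.pot hu hP hx hxy
  rwa [hP.right_inv z hz] at this

lemma exists_radius (h : Collar O V r d A B G s) (hP : ConfPair O ψ φ) :
    ∃ a, 0 < a ∧ a < 1 ∧ ∀ x ∈ core O s, ‖ψ x‖ < a := by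
  have hcO : core O s ⊆ O := core_subset h.s_pos
  have hc : ContinuousOn (fun x => ‖ψ x‖) (core O s) := (hP.diff.continuousOn.mono hcO).norm
  rcases (core O s).eq_empty_or_nonempty with he | hne
  · exact ⟨1 / 2, by norm_num, by norm_num, by simp [he]⟩
  · obtain ⟨x, hx, hmax⟩ := (isCompact_core h.bdd s).exists_isMaxOn hne hc
    have h1 : ‖ψ x‖ < 1 := by simpa using hP.mapsTo x (hcO hx)
    refine ⟨(‖ψ x‖ + 1) / 2, by positivity, by linarith, fun y hy => ?_⟩
    have : ‖ψ y‖ ≤ ‖ψ x‖ := hmax hy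
    linarith

end Collar

lemma exists_bounds {N : ℂ → ℝ} {S : Set ℂ} (hS : IsCompact S)
    (hN : ∀ x ∈ S, ContDiffAt ℝ 1 N x) (hpos : ∀ x ∈ S, 0 < N x) :
    ∃ n₀ > 0, ∃ n₁ > 0, ∃ n₂ > 0, ∀ x ∈ S, n₀ ≤ N x ∧ N x ≤ n₁ ∧ ‖fderiv ℝ N x‖ ≤ n₂ := by
  have hc : ContinuousOn N S := fun x hx => (hN x hx).continuousAt.continuousWithinAt
  have hc' : ContinuousOn (fun x => fderiv ℝ N x) S := fun x hx =>
    ((hN x hx).fderiv_right (m := 0) (by norm_num)).continuousAt.continuousWithinAt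
  obtain ⟨C₁, h1⟩ := hS.exists_bound_of_continuousOn hc
  obtain ⟨C₂, h2⟩ := hS.exists_bound_of_continuousOn hc'
  obtain ⟨C₃, h3⟩ := hS.exists_bound_of_continuousOn (hc.inv₀ fun x hx => (hpos x hx).ne')
  refine ⟨(|C₃| + 1)⁻¹, by positivity, |C₁| + 1, by positivity, |C₂| + 1, by positivity,
    fun x hx => ⟨?_, ?_, ?_⟩⟩
  · have h := h3 x hx
    rw [Pi.inv_apply, norm_inv, Real.norm_of_nonneg (hpos x hx).le] at h
    have hx0 := hpos x hx
    rw [inv_le_comm₀ (by positivity) hx0]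
    linarith [le_abs_self C₃]
  · linarith [h1 x hx, le_abs_self C₁, Real.le_norm_self (N x)]
  · linarith [h2 x hx, le_abs_self C₂]

lemma contDiffAt_norm_rpow {x : ℂ} (hx : x ≠ 0) (q : ℝ) : ContDiffAt ℝ 2 (fun x => ‖x‖ ^ q) x :=
  (contDiffAt_norm ℝ hx).rpow_const_of_ne (norm_ne_zero_iff.2 hx)

/-- Bounds for the coefficient `K`. -/
structure CoeffBounds (O : Set ℂ) (K : ℂ → ℝ) (k₀ k₁ k₂ : ℝ) : Prop where
  pos : 0 < k₀
  reg : ∀ x ∈ O, ContDiffAt ℝ 1 K x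
  ge : ∀ x ∈ O, k₀ ≤ K x
  le : ∀ x ∈ O, K x ≤ k₁
  grad : ∀ x ∈ O, ‖fderiv ℝ K x‖ ≤ k₂

/-- The Hénon potential. -/
def henonV (α : ℝ) (K : ℂ → ℝ) (x : ℂ) : ℝ := ‖x‖ ^ (2 * α) * K x

lemma CoeffBounds.exists_potBounds {O : Set ℂ} {K : ℂ → ℝ} {k₀ k₁ k₂ d : ℝ}
    (h : CoeffBounds O K k₀ k₁ k₂) (hb : Bornology.IsBounded O) (hd : 0 < d) (α : ℝ) :
    ∃ A B G, PotBounds O (henonV α K) d A B G := by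
  obtain ⟨R, hR, hOR⟩ := hb.subset_ball_lt 0 (0 : ℂ)
  have hS : IsCompact (closedBall (0 : ℂ) R ∩ {x | d ≤ ‖x‖}) :=
    (isCompact_closedBall 0 R).inter_right (isClosed_le continuous_const continuous_norm)
  have hne : ∀ x : ℂ, d ≤ ‖x‖ → x ≠ 0 := by
    rintro x hx rfl
    rw [norm_zero] at hx; linarith
  obtain ⟨n₀, hn₀, n₁, hn₁, n₂, hn₂, hn⟩ := exists_bounds (N := fun x : ℂ => ‖x‖ ^ (2 * α)) hS
    (fun x hx => (contDiffAt_norm_rpow (hne x hx.2) _).of_le (by norm_num))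
    (fun x hx => Real.rpow_pos_of_pos (norm_pos_iff.2 (hne x hx.2)) _)
  have hk₀ := h.pos
  have key : ∀ x ∈ O, d ≤ ‖x‖ → n₀ ≤ ‖x‖ ^ (2 * α) ∧ ‖x‖ ^ (2 * α) ≤ n₁ ∧
      ‖fderiv ℝ (fun x : ℂ => ‖x‖ ^ (2 * α)) x‖ ≤ n₂ := fun x hx hdx =>
    hn x ⟨ball_subset_closedBall (hOR hx), hdx⟩
  have hdiff : ∀ x ∈ O, d ≤ ‖x‖ → HasFDerivAt (henonV α K)
      (‖x‖ ^ (2 * α) • fderiv ℝ K x + K x • fderiv ℝ (fun x : ℂ => ‖x‖ ^ (2 * α)) x) x := by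
    intro x hx hdx
    exact (((contDiffAt_norm_rpow (hne x hdx) (2 * α)).differentiableAt
      (by norm_num)).hasFDerivAt).fun_mul ((h.reg x hx).differentiableAt (by norm_num)).hasFDerivAt
  refine ⟨n₀ * k₀, n₁ * k₁, n₁ * |k₂| + |k₁| * n₂ + 1, by positivity, by positivity,
    fun x hx hdx => ?_, fun x hx hdx => ?_, fun x hx hdx => (hdiff x hx hdx).differentiableAt,
    fun x hx hdx => ?_⟩
  · obtain ⟨h1, -, -⟩ := key x hx hdx
    exact mul_le_mul h1 (h.ge x hx) hk₀.le (hn₀.le.trans h1)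
  · obtain ⟨-, h2, -⟩ := key x hx hdx
    exact mul_le_mul h2 (h.le x hx) (hk₀.le.trans (h.ge x hx)) hn₁.le
  · obtain ⟨h1, h2, h3⟩ := key x hx hdx
    rw [(hdiff x hx hdx).fderiv]
    have hf0 : 0 ≤ ‖x‖ ^ (2 * α) := hn₀.le.trans h1
    have hK0 : 0 ≤ K x := hk₀.le.trans (h.ge x hx)
    calc _ ≤ ‖‖x‖ ^ (2 * α) • fderiv ℝ K x‖ +
          ‖K x • fderiv ℝ (fun x : ℂ => ‖x‖ ^ (2 * α)) x‖ := norm_add_le _ _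
      _ ≤ n₁ * |k₂| + |k₁| * n₂ := by
          rw [norm_smul, norm_smul, Real.norm_of_nonneg hf0, Real.norm_of_nonneg hK0]
          exact add_le_add (mul_le_mul h2 ((h.grad x hx).trans (le_abs_self _)) (norm_nonneg _)
            hn₁.le) (mul_le_mul ((h.le x hx).trans (le_abs_self _)) h3 (norm_nonneg _)
            (abs_nonneg _))
      _ ≤ _ := by linarith

/-- The weight obtained by pulling back a potential with a conformal map. -/
def pullW (V : ℂ → ℝ) (φ : ℂ → ℂ) (z : ℂ) : ℝ := V (φ z) * ‖deriv φ z‖ ^ 2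

lemma ConfPair.exists_factor {O : Set ℂ} {ψ φ : ℂ → ℂ} {K : ℂ → ℝ} (hP : ConfPair O ψ φ)
    (hK : ∀ x ∈ O, ContDiffAt ℝ 1 K x) (hK0 : ∀ x ∈ O, 0 < K x) (α : ℝ) :
    ∃ N : ℂ → ℝ, (∀ z ∈ ball (0 : ℂ) 1, ContDiffAt ℝ 1 N z ∧ 0 < N z) ∧
      ∀ z ∈ ball (0 : ℂ) 1, pullW (henonV α K) φ z = sqd 0 z ^ α * N z := by
  have h0 : (0 : ℂ) ∈ ball (0 : ℂ) 1 := by simp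
  set h := dslope φ 0 with hh
  have hd : DifferentiableOn ℂ h (ball 0 1) :=
    (Complex.differentiableOn_dslope (isOpen_ball.mem_nhds h0)).2 hP.diff'
  have hfac : ∀ z, φ z = z * h z := by
    intro z
    have := sub_smul_dslope φ 0 z
    rw [hP.zero, sub_zero, sub_zero, smul_eq_mul] at this
    exact this.symm
  have hne : ∀ z ∈ ball (0 : ℂ) 1, h z ≠ 0 := by
    intro z hz h1
    rcases eq_or_ne z 0 with rfl | hz0
    · rw [hh, dslope_same] at h1
      exact hP.deriv_ne h0 h1
    · have := hfac z
      rw [h1, mul_zero, hP.eq_zero_iff hz] at this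
      exact hz0 this
  refine ⟨fun z => ‖h z‖ ^ (2 * α) * K (φ z) * ‖deriv φ z‖ ^ 2, fun z hz => ⟨?_, ?_⟩,
    fun z hz => ?_⟩
  · have e1 : ContDiffAt ℝ 1 h z :=
      ((hd.analyticAt (isOpen_ball.mem_nhds hz)).contDiffAt (n := 1)).restrict_scalars ℝ
    have e2 : ContDiffAt ℝ 1 φ z :=
      ((hP.analyticAt' hz).contDiffAt (n := 1)).restrict_scalars ℝ
    have e3 : ContDiffAt ℝ 1 (deriv φ) z :=
      ((hP.analyticAt' hz).deriv.contDiffAt (n := 1)).restrict_scalars ℝ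
    refine ((ContDiffAt.rpow_const_of_ne (e1.norm ℝ (hne z hz))
      (norm_ne_zero_iff.2 (hne z hz))).mul ?_).mul ((e3.norm ℝ (hP.deriv_ne hz)).pow 2)
    exact (hK _ (hP.mapsTo' z hz)).comp z e2
  · have e1 := norm_pos_iff.2 (hne z hz)
    have e2 := norm_pos_iff.2 (hP.deriv_ne hz)
    have e3 := hK0 _ (hP.mapsTo' z hz)
    have e4 := Real.rpow_pos_of_pos e1 (2 * α)
    positivity
  · simp only [pullW, henonV]
    have : sqd 0 z ^ α = ‖z‖ ^ (2 * α) := by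
      rw [sqd_eq, sub_zero, ← Real.rpow_natCast, ← Real.rpow_mul (norm_nonneg _)]
      norm_num
    rw [this]
    conv_lhs => rw [show ‖φ z‖ = ‖z‖ * ‖h z‖ by rw [hfac z, norm_mul]]
    rw [Real.mul_rpow (norm_nonneg _) (norm_nonneg _)]
    ring

lemma sqd_rpow (z : ℂ) (α : ℝ) : sqd 0 z ^ α = ‖z‖ ^ (2 * α) := by
  rw [sqd_eq, sub_zero, ← Real.rpow_natCast, ← Real.rpow_mul (norm_nonneg _)]
  norm_num

lemma ConfPair.exists_isWeight {O : Set ℂ} {ψ φ : ℂ → ℂ} {K : ℂ → ℝ} {α b : ℝ}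
    (hP : ConfPair O ψ φ) (hK : ∀ x ∈ O, ContDiffAt ℝ 1 K x) (hK0 : ∀ x ∈ O, 0 < K x)
    (hα : -1 < α) (hb0 : 0 < b) (hb : b < 1) :
    ∃ C₀ > 0, ∃ c₀ > 0, IsWeight (pullW (henonV α K) φ) b (min α 0) C₀ ∧
      ∀ z ∈ closedBall (0 : ℂ) b, z ≠ 0 → c₀ * ‖z‖ ^ (2 * max α 0) ≤ pullW (henonV α K) φ z := by
  obtain ⟨N, hN, hW⟩ := hP.exists_factor hK hK0 α
  have hbb : closedBall (0 : ℂ) b ⊆ ball 0 1 := closedBall_subset_ball hb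
  obtain ⟨n₀, hn₀, n₁, hn₁, n₂, hn₂, hn⟩ := exists_bounds (isCompact_closedBall (0 : ℂ) b)
    (fun x hx => (hN x (hbb hx)).1) (fun x hx => (hN x (hbb hx)).2)
  set W := pullW (henonV α K) φ with hWdef
  have hspos : ∀ z : ℂ, z ≠ 0 → 0 < sqd 0 z := fun z hz => by
    rw [sqd_eq, sub_zero]; exact pow_pos (norm_pos_iff.2 hz) 2
  have hevW : ∀ z ∈ closedBall (0 : ℂ) b, W =ᶠ[𝓝 z] fun y => sqd 0 y ^ α * N y := by
    intro z hz
    filter_upwards [isOpen_ball.mem_nhds (hbb hz)] with y hy using hW y hy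
  have hcd : ∀ z : ℂ, z ≠ 0 → ContDiffAt ℝ 1 (fun y => sqd 0 y ^ α) z := fun z hz =>
    (contDiff_sqd 0).contDiffAt.rpow_const_of_ne (hspos z hz).ne'
  refine ⟨n₁ + 2 * |α| + n₂ * 2 / n₀, by positivity, n₀, hn₀, ⟨hb0, hb, lt_min hα (by norm_num),
    min_le_right _ _, by positivity, fun z hz hz0 => ?_, fun z hz hz0 => ?_, fun z hz hz0 => ?_,
    fun z hz hz0 => ?_⟩, fun z hz hz0 => ?_⟩
  · exact ((hcd z hz0).mul (hN z (hbb hz)).1).congr_of_eventuallyEq (hevW z hz)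
  · rw [hW z (hbb hz)]
    exact mul_pos (Real.rpow_pos_of_pos (hspos z hz0) _) (hN z (hbb hz)).2
  · rw [hW z (hbb hz), sqd_rpow]
    have hz1 : ‖z‖ ≤ 1 := by have := hbb hz; rw [mem_ball_zero_iff] at this; exact this.le
    have h1 : ‖z‖ ^ (2 * α) ≤ ‖z‖ ^ (2 * min α 0) :=
      Real.rpow_le_rpow_of_exponent_ge (norm_pos_iff.2 hz0) hz1
        (mul_le_mul_of_nonneg_left (min_le_left _ _) (by norm_num))
    have h2 : N z ≤ n₁ + 2 * |α| + n₂ * 2 / n₀ := by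
      have : 0 ≤ 2 * |α| + n₂ * 2 / n₀ := by positivity
      linarith [(hn z hz).2.1]
    rw [mul_comm]
    exact mul_le_mul h2 h1 (Real.rpow_nonneg (norm_nonneg _) _) (by positivity)
  · have hz1 : ‖z‖ ≤ 1 := by have := hbb hz; rw [mem_ball_zero_iff] at this; exact this.le
    have hs := hspos z hz0
    have hdf : HasFDerivAt W ((sqd 0 z ^ α) • fderiv ℝ N z +
        N z • fderiv ℝ (fun y => sqd 0 y ^ α) z) z :=
      ((((hcd z hz0).differentiableAt (by norm_num)).hasFDerivAt).fun_mul
        ((hN z (hbb hz)).1.differentiableAt (by norm_num)).hasFDerivAt).congr_of_eventuallyEq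
        (hevW z hz)
    have hr : HasDerivAt (fun s : ℝ => s ^ α) (α * sqd 0 z ^ (α - 1)) (sqd 0 z) :=
      Real.hasDerivAt_rpow_const (Or.inl hs.ne')
    have hdx := dx_radial (c := 0) (ρ := fun s => s ^ α) hr
    have hdy := dy_radial (c := 0) (ρ := fun s => s ^ α) hr
    have e1 : dx W z = sqd 0 z ^ α * dx N z + N z * dx (fun y => sqd 0 y ^ α) z := by
      simp only [dx, hdf.fderiv]; simp
    have e2 : dy W z = sqd 0 z ^ α * dy N z + N z * dy (fun y => sqd 0 y ^ α) z := by
      simp only [dy, hdf.fderiv]; simp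
    have e3 : sqd 0 z ^ α = sqd 0 z ^ (α - 1) * sqd 0 z := by
      rw [← Real.rpow_add_one hs.ne']; congr 1; ring
    have e4 : sqd 0 z = z.re ^ 2 + z.im ^ 2 := by simp [sqd]
    have e5 : z.re * dx W z + z.im * dy W z =
        sqd 0 z ^ α * (2 * α * N z + fderiv ℝ N z z) := by
      rw [e1, e2, hdx, hdy, fderiv_eq, e3]
      simp only [Complex.zero_re, Complex.zero_im, sub_zero]
      linear_combination (-2 * α * N z * sqd 0 z ^ (α - 1)) * e4
    have h1 : |fderiv ℝ N z z| ≤ n₂ := by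
      have := (fderiv ℝ N z).le_opNorm z
      rw [Real.norm_eq_abs] at this
      calc _ ≤ _ := this
        _ ≤ n₂ * 1 := mul_le_mul (hn z hz).2.2 hz1 (norm_nonneg _) hn₂.le
        _ = n₂ := mul_one _
    have hN0 := (hN z (hbb hz)).2
    have h2 : |2 * α * N z + fderiv ℝ N z z| ≤ (n₁ + 2 * |α| + n₂ * 2 / n₀) * N z := by
      have h3 : n₂ ≤ n₂ * 2 / n₀ * N z := by
        rw [div_mul_eq_mul_div, le_div_iff₀ hn₀]
        nlinarith [(hn z hz).1, mul_pos hn₂ hN0, mul_pos hn₂ hn₀]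
      calc _ ≤ |2 * α * N z| + |fderiv ℝ N z z| := abs_add_le _ _
        _ ≤ 2 * |α| * N z + n₂ := by
            refine add_le_add (le_of_eq ?_) h1
            rw [abs_mul, abs_mul, abs_of_pos hN0, abs_two]
        _ ≤ _ := by nlinarith [mul_pos hn₁ hN0]
    rw [e5, hW z (hbb hz), abs_mul, abs_of_pos (Real.rpow_pos_of_pos hs _)]
    calc _ ≤ sqd 0 z ^ α * ((n₁ + 2 * |α| + n₂ * 2 / n₀) * N z) := by gcongr
      _ = _ := by ring
  · rw [hW z (hbb hz), sqd_rpow, mul_comm]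
    have hz1 : ‖z‖ ≤ 1 := by have := hbb hz; rw [mem_ball_zero_iff] at this; exact this.le
    have h1 : ‖z‖ ^ (2 * max α 0) ≤ ‖z‖ ^ (2 * α) :=
      Real.rpow_le_rpow_of_exponent_ge (norm_pos_iff.2 hz0) hz1
        (mul_le_mul_of_nonneg_left (le_max_left _ _) (by norm_num))
    exact mul_le_mul h1 (hn z hz).1 hn₀.le (Real.rpow_nonneg (norm_nonneg _) _)

/-- A positive solution of `-Δu = V u ^ p` in `O` minus the origin, vanishing on the boundary. -/
structure FullSol (O : Set ℂ) (u V : ℂ → ℝ) (p : ℝ) : Prop where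
  one_le : 1 ≤ p
  cont : ContinuousOn u (closure O)
  pos : ∀ x ∈ O, 0 < u x
  zero : ∀ x ∈ closure O, x ∉ O → u x = 0
  reg : ∀ x ∈ O, x ≠ 0 → ContDiffAt ℝ 2 u x
  eq : ∀ x ∈ O, x ≠ 0 → -lapC u x = V x * u x ^ p

lemma FullSol.outerSol {O : Set ℂ} {u V : ℂ → ℝ} {p d : ℝ} (h : FullSol O u V p) (hd : 0 < d) :
    OuterSol O d u V p := by
  have hne : ∀ x : ℂ, d ≤ ‖x‖ → x ≠ 0 := by
    rintro x hx rfl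
    rw [norm_zero] at hx; linarith
  exact ⟨h.one_le, h.cont, h.pos, h.zero, fun x hx hdx => h.reg x hx (hne x hdx),
    fun x hx hdx => h.eq x hx (hne x hdx)⟩

lemma FullSol.isSol {O : Set ℂ} {u V : ℂ → ℝ} {ψ φ : ℂ → ℂ} {p : ℝ} (h : FullSol O u V p)
    (hP : ConfPair O ψ φ) : IsSol (pullW V φ) (fun z => u (φ z)) p := by
  refine ⟨?_, fun z hz hz0 => ?_, fun z hz => h.pos _ (hP.mapsTo' z hz), fun z hz hz0 => ?_⟩
  · exact h.cont.comp hP.diff'.continuousOn fun z hz => subset_closure (hP.mapsTo' z hz)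
  · exact (lapC_comp_holomorphic (hP.analyticAt' hz) (h.reg _ (hP.mapsTo' z hz)
      (mt (hP.eq_zero_iff hz).1 hz0))).1
  · have h0 := mt (hP.eq_zero_iff hz).1 hz0
    rw [(lapC_comp_holomorphic (hP.analyticAt' hz) (h.reg _ (hP.mapsTo' z hz) h0)).2.2, pullW]
    have := h.eq _ (hP.mapsTo' z hz) h0
    linear_combination ‖deriv φ z‖ ^ 2 * this

lemma FullSol.integrableOn {O : Set ℂ} {u K : ℂ → ℝ} {p α k₀ k₁ k₂ : ℝ}
    (h : FullSol O u (henonV α K) p) (hO : IsOpen O) (hb : Bornology.IsBounded O)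
    (hK : CoeffBounds O K k₀ k₁ k₂) (hα : -1 < α) {q : ℝ} (hq : 0 ≤ q) :
    IntegrableOn (fun x => henonV α K x * u x ^ q) O := by
  obtain ⟨R, hR, hOR⟩ := hb.subset_ball_lt 0 (0 : ℂ)
  obtain ⟨M, hM⟩ := hb.isCompact_closure.exists_bound_of_continuousOn h.cont
  have h1 : IntegrableOn (fun x : ℂ => ‖x‖ ^ (2 * α)) O :=
    (integrableOn_rpow_norm hα R).mono_set (hOR.trans ball_subset_closedBall)
  have hc : ContinuousOn (fun x => K x * u x ^ q) O :=
    ContinuousOn.mul (fun x hx => (hK.reg x hx).continuousAt.continuousWithinAt)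
      ((h.cont.mono subset_closure).rpow_const fun x _ => Or.inr hq)
  have h2 : Integrable (fun x => K x * u x ^ q * ‖x‖ ^ (2 * α)) (volume.restrict O) := by
    refine h1.bdd_mul (c := |k₁| * |M| ^ q) (hc.aestronglyMeasurable hO.measurableSet) ?_
    refine (ae_restrict_iff' hO.measurableSet).2 (.of_forall fun x hx => ?_)
    have hux := h.pos x hx
    have hKx : 0 ≤ K x := hK.pos.le.trans (hK.ge x hx)
    have huM : u x ≤ |M| := (Real.le_norm_self _).trans ((hM x (subset_closure hx)).trans
      (le_abs_self _))
    rw [norm_mul, Real.norm_of_nonneg hKx, Real.norm_of_nonneg (Real.rpow_nonneg hux.le _)]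
    exact mul_le_mul ((hK.le x hx).trans (le_abs_self _)) (Real.rpow_le_rpow hux.le huM hq)
      (Real.rpow_nonneg hux.le _) (abs_nonneg _)
  refine h2.congr (.of_forall fun x => ?_)
  simp only [henonV]
  ring

lemma CoeffBounds.nonneg {O : Set ℂ} {K : ℂ → ℝ} {k₀ k₁ k₂ : ℝ} (hK : CoeffBounds O K k₀ k₁ k₂)
    (α : ℝ) {x : ℂ} (hx : x ∈ O) : 0 ≤ henonV α K x :=
  mul_nonneg (Real.rpow_nonneg (norm_nonneg _) _) (hK.pos.le.trans (hK.ge x hx))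

lemma ConfPair.integral_image {O : Set ℂ} {ψ φ : ℂ → ℂ} (hP : ConfPair O ψ φ) (V u : ℂ → ℝ)
    (p : ℝ) {a : ℝ} (ha : a < 1) :
    ∫ x in φ '' closedBall 0 a, V x * u x ^ p =
      ∫ z in closedBall 0 a, pullW V φ z * u (φ z) ^ p := by
  have hab : closedBall (0 : ℂ) a ⊆ ball 0 1 := closedBall_subset_ball ha
  have hd : ∀ z ∈ closedBall (0 : ℂ) a, HasFDerivWithinAt φ
      ((ContinuousLinearMap.toSpanSingleton ℂ (deriv φ z)).restrictScalars ℝ)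
      (closedBall 0 a) z := fun z hz =>
    ((hP.analyticAt' (hab hz)).differentiableAt.hasDerivAt.hasFDerivAt.restrictScalars
      ℝ).hasFDerivWithinAt
  have hinj : InjOn φ (closedBall 0 a) := fun z hz w hw h => by
    rw [← hP.right_inv z (hab hz), h, hP.right_inv w (hab hw)]
  rw [integral_image_eq_integral_abs_det_fderiv_smul volume measurableSet_closedBall hd hinj]
  refine setIntegral_congr_fun measurableSet_closedBall fun z _ => ?_
  have hdet : ((ContinuousLinearMap.toSpanSingleton ℂ (deriv φ z)).restrictScalars ℝ).det =
      ‖deriv φ z‖ ^ 2 := by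
    simp [ContinuousLinearMap.det, LinearMap.det_restrictScalars, Algebra.norm_complex_eq,
      Complex.normSq_eq_norm_sq]
  simp only [hdet, pullW, smul_eq_mul]
  rw [abs_of_nonneg (by positivity)]
  ring

lemma le_of_rpow_le {M Q p p₀ : ℝ} (hp₀ : 1 < p₀) (hp : p₀ ≤ p) (hM : 1 ≤ M)
    (h : M ^ (p - 1) ≤ Q) : M ≤ Q ^ (p₀ - 1)⁻¹ := by
  have h1 : M ^ (p₀ - 1) ≤ Q :=
    (Real.rpow_le_rpow_of_exponent_le hM (by linarith)).trans h
  have h2 : 0 < p₀ - 1 := by linarith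
  calc M = (M ^ (p₀ - 1)) ^ (p₀ - 1)⁻¹ := by
        rw [← Real.rpow_mul (by linarith), mul_inv_cancel₀ h2.ne', Real.rpow_one]
    _ ≤ Q ^ (p₀ - 1)⁻¹ := Real.rpow_le_rpow (by positivity) h1 (inv_nonneg.2 h2.le)

theorem exists_mass_bound {O : Set ℂ} {K : ℂ → ℝ} {ψ φ : ℂ → ℂ}
    {r d A B G s α p₀ k₀ k₁ k₂ : ℝ} (h : Collar O (henonV α K) r d A B G s)
    (hP : ConfPair O ψ φ) (hK : CoeffBounds O K k₀ k₁ k₂) (hα : -1 < α) (hp₀ : 1 < p₀) :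
    ∃ ρ₀ > 0, ∀ p, p₀ ≤ p → ∀ u : ℂ → ℝ, FullSol O u (henonV α K) p →
      p * ∫ x in O, henonV α K x * u x ^ (p + 1) ≤ ρ₀ := by
  have hs := h.s_pos
  have hA := h.pot.A_pos
  have hcO : core O s ⊆ O := core_subset hs
  obtain ⟨a, ha0, ha1, ha⟩ := h.exists_radius hP
  set b := (a + 1) / 2 with hb
  have hab : a < b := by rw [hb]; linarith
  have hb1 : b < 1 := by rw [hb]; linarith
  obtain ⟨C₀, hC₀, c₀, hc₀, hW, hWlow⟩ := hP.exists_isWeight hK.reg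
    (fun x hx => hK.pos.trans_le (hK.ge x hx)) hα (ha0.trans hab) hb1
  set V := henonV α K with hV
  set C₁ := 1 + volume.real O * (|B| / A * (π * (s / 4) ^ 2)⁻¹) with hC₁
  have hC₁0 : 0 < C₁ := by positivity
  obtain ⟨C, hC, hmul⟩ := exists_mul_mass_le ha0 hab hb1 hC₀ hC₁0 (c := 1 / 10) (by norm_num)
  obtain ⟨D, hD, hmax⟩ := exists_max_bound (R := b - a) (by linarith) hW.β_gt hW.β_le
    (le_max_right α 0) hC₀ hc₀ hp₀ (mul_pos hC₁0 hC)
  set Q := 512 / (A * s ^ 2) with hQ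
  set M₁ := 1 + D + Q ^ (p₀ - 1)⁻¹ with hM₁
  have hM₁0 : 0 < M₁ := by positivity
  refine ⟨C₁ * C * M₁ ^ 2, by positivity, fun p hp u hu => ?_⟩
  have hp0 : 0 < p := by linarith
  have huO := hu.outerSol h.d_pos
  have hVnn : ∀ x ∈ O, 0 ≤ V x := fun x hx => hK.nonneg α hx
  have hi := hu.integrableOn h.isOpen h.bdd hK hα hp0.le
  have hi' := hu.integrableOn h.isOpen h.bdd hK hα (q := p + 1) (by linarith)
  have hsol := hu.isSol hP
  -- the maximum
  obtain ⟨x₀, hx₀c, hx₀max⟩ := h.bdd.isCompact_closure.exists_isMaxOn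
    ⟨0, subset_closure hP.zero_mem⟩ hu.cont
  have hx₀ : x₀ ∈ O := by
    by_contra hc
    have h1 : u 0 ≤ u x₀ := hx₀max (subset_closure hP.zero_mem)
    rw [hu.zero x₀ hx₀c hc] at h1
    linarith [hu.pos 0 hP.zero_mem]
  set M := u x₀ with hM
  have hM0 : 0 < M := hu.pos x₀ hx₀
  have huM : ∀ x ∈ O, u x ≤ M := fun x hx => hx₀max (subset_closure hx)
  -- masses
  have hnn : ∀ x ∈ O, 0 ≤ V x * u x ^ p := fun x hx =>
    mul_nonneg (hVnn x hx) (Real.rpow_nonneg (hu.pos x hx).le _)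
  have himg : ∀ {ρ}, ρ < 1 → φ '' closedBall 0 ρ ⊆ O := by
    rintro ρ hρ _ ⟨z, hz, rfl⟩
    exact hP.mapsTo' z (closedBall_subset_ball hρ hz)
  have htot : ∫ x in O, V x * u x ^ p ≤ C₁ * mass (pullW V φ) (fun z => u (φ z)) p 0 a := by
    refine (h.mass_le huO hVnn hi).trans (mul_le_mul_of_nonneg_left ?_ hC₁0.le)
    rw [mass, ← hP.integral_image V u p ha1]
    refine setIntegral_mono_set (hi.mono_set (himg ha1)) ?_ ?_
    · exact (ae_restrict_iff' (hP.isCompact_image ha1).measurableSet).2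
        (.of_forall fun x hx => hnn x (himg ha1 hx))
    · refine (show core O s ⊆ φ '' closedBall 0 a from fun x hx => ?_).eventuallyLE
      exact ⟨ψ x, by simpa using (ha x hx).le, hP.left_inv x (hcO hx)⟩
  have hbtot : mass (pullW V φ) (fun z => u (φ z)) p 0 b ≤ ∫ x in O, V x * u x ^ p := by
    rw [mass, ← hP.integral_image V u p hb1]
    exact setIntegral_mono_set hi ((ae_restrict_iff' h.isOpen.measurableSet).2
      (.of_forall hnn)) (himg hb1).eventuallyLE
  have hpm : p * mass (pullW V φ) (fun z => u (φ z)) p 0 a ≤ C * M := by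
    refine hmul (pullW V φ) (fun z => u (φ z)) p (min α 0) M hp0 hsol hW ?_ ?_ (hbtot.trans htot)
    · intro z hza hzb
      have hzball : z ∈ ball (0 : ℂ) 1 := by rw [mem_ball_zero_iff]; linarith
      refine h.pohE_ge huO hP hzball fun hzc => ?_
      have := ha _ hzc
      rw [hP.right_inv z hzball] at this
      linarith
    · exact fun z hz => huM _ (hP.mapsTo' z (closedBall_subset_ball hb1 hz))
  have hpM : p * (∫ x in O, V x * u x ^ p) ≤ C₁ * C * M := by
    calc p * (∫ x in O, V x * u x ^ p)
        ≤ p * (C₁ * mass (pullW V φ) (fun z => u (φ z)) p 0 a) := by gcongr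
      _ = C₁ * (p * mass (pullW V φ) (fun z => u (φ z)) p 0 a) := by ring
      _ ≤ C₁ * (C * M) := by gcongr
      _ = _ := by ring
  -- bound for the maximum
  have hMM : M ≤ M₁ := by
    have hQ0 : 0 ≤ Q ^ (p₀ - 1)⁻¹ := by positivity
    rcases le_total M 1 with hM1 | hM1
    · rw [hM₁]; linarith
    by_cases hcore : x₀ ∈ core O s
    · have hz₀ := ha x₀ hcore
      have hv : u (φ (ψ x₀)) = M := by rw [hP.left_inv x₀ hx₀]
      have hsub : closedBall (ψ x₀) (b - a) ⊆ closedBall 0 b :=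
        closedBall_subset_closedBall' (by rw [dist_zero_right]; linarith)
      have h1 := hmax (pullW V φ) (fun z => u (φ z)) p b (ψ x₀) hp hsol hW hWlow hsub
        (fun z hz => by
          rw [hv]; exact huM _ (hP.mapsTo' z (closedBall_subset_ball hb1 hz)))
        (by rw [hv]; exact hM1) ?_
      · rw [hv] at h1
        rw [hM₁]; linarith
      · rw [hv]
        refine le_trans (mul_le_mul_of_nonneg_left ?_ hp0.le) hpM
        exact (hsol.mass_mono hW subset_rfl hsub).trans hbtot
    · have h1 := h.bound huO hx₀ hcore
      have h2 : M ^ (p - 1) ≤ Q := by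
        rw [hQ, le_div_iff₀ (by positivity)]
        linarith
      have := le_of_rpow_le hp₀ hp hM1 h2
      rw [hM₁]; linarith
  -- conclusion
  have hfin : ∫ x in O, V x * u x ^ (p + 1) ≤ M * ∫ x in O, V x * u x ^ p := by
    rw [← integral_const_mul]
    refine setIntegral_mono_on hi' (hi.const_mul M) h.isOpen.measurableSet fun x hx => ?_
    have hux := hu.pos x hx
    rw [Real.rpow_add_one hux.ne']
    have := mul_le_mul_of_nonneg_left (huM x hx) (hnn x hx)
    linarith
  calc p * ∫ x in O, V x * u x ^ (p + 1) ≤ p * (M * ∫ x in O, V x * u x ^ p) := by gcongr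
    _ = M * (p * ∫ x in O, V x * u x ^ p) := by ring
    _ ≤ M * (C₁ * C * M) := by gcongr
    _ = C₁ * C * M ^ 2 := by ring
    _ ≤ C₁ * C * M₁ ^ 2 := by gcongr

lemma exists_fderiv_bound {E : Type*} [NormedAddCommGroup E] [NormedSpace ℝ E] {O : Set E}
    (hO : IsOpen O) (hc : IsCompact (closure O)) {f : E → ℝ} (hf : ContDiffOn ℝ 1 f (closure O)) :
    ∃ C, ∀ x ∈ O, ‖fderiv ℝ f x‖ ≤ C := by
  suffices h : ∃ C, ∀ x ∈ closure O ∩ O, ‖fderiv ℝ f x‖ ≤ C by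
    obtain ⟨C, hC⟩ := h
    exact ⟨C, fun x hx => hC x ⟨subset_closure hx, hx⟩⟩
  refine hc.induction_on (p := fun s => ∃ C, ∀ x ∈ s ∩ O, ‖fderiv ℝ f x‖ ≤ C)
    ⟨0, by simp⟩ ?_ ?_ ?_
  · rintro s t hst ⟨C, hC⟩
    exact ⟨C, fun x hx => hC x ⟨hst hx.1, hx.2⟩⟩
  · rintro s t ⟨C, hC⟩ ⟨C', hC'⟩
    refine ⟨max C C', ?_⟩
    rintro x ⟨hx | hx, hxO⟩
    · exact (hC x ⟨hx, hxO⟩).trans (le_max_left _ _)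
    · exact (hC' x ⟨hx, hxO⟩).trans (le_max_right _ _)
  · intro x hx
    have h1 : ContDiffWithinAt ℝ (0 + 1) f (closure O) x := by simpa using hf x hx
    obtain ⟨v, hv, -, -, g, hg, hgc⟩ :=
      (contDiffWithinAt_succ_iff_hasFDerivWithinAt' (by simp)).1 h1
    rw [insert_eq_of_mem hx] at hv
    have h2 : ∀ᶠ y in 𝓝[closure O] x, ‖g y‖ < ‖g x‖ + 1 :=
      hgc.continuousWithinAt.norm.eventually_lt continuousWithinAt_const (by simp)
    refine ⟨_, Filter.inter_mem hv h2, ‖g x‖ + 1, ?_⟩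
    rintro y ⟨⟨hyv, hy⟩, hyO⟩
    have h3 : HasFDerivAt f (g y) y := (hg y hyv).hasFDerivAt
      (mem_of_superset (hO.mem_nhds hyO) subset_closure)
    rw [h3.fderiv]
    exact le_of_lt hy

/-- The standard isometric identification of the Euclidean plane with `ℂ`. -/
def toComplex : Plane ≃ₗᵢ[ℝ] ℂ := Complex.orthonormalBasisOneI.repr.symm

lemma toComplex_symm_one : toComplex.symm 1 = EuclideanSpace.single 0 1 := by
  have h : Complex.orthonormalBasisOneI.repr 1 = EuclideanSpace.single 0 1 := by
    simpa using Complex.orthonormalBasisOneI.repr_self 0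
  exact h

lemma toComplex_symm_I : toComplex.symm Complex.I = EuclideanSpace.single 1 1 := by
  have h : Complex.orthonormalBasisOneI.repr Complex.I = EuclideanSpace.single 1 1 := by
    simpa using Complex.orthonormalBasisOneI.repr_self 1
  exact h

lemma fderiv_comp_toComplex_symm (u : Plane → ℝ) (z v : ℂ) :
    fderiv ℝ (fun w => u (toComplex.symm w)) z v
      = fderiv ℝ u (toComplex.symm z) (toComplex.symm v) := by
  have := toComplex.symm.toContinuousLinearEquiv.comp_right_fderiv (f := u) (x := z)
  exact DFunLike.congr_fun this v

lemma lapC_comp_toComplex_symm (u : Plane → ℝ) (z : ℂ) :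
    lapC (fun w => u (toComplex.symm w)) z = lap u (toComplex.symm z) := by
  have hx : dx (fun w => u (toComplex.symm w)) = fun w =>
      (fun y => fderiv ℝ u y (EuclideanSpace.single 0 1)) (toComplex.symm w) := by
    ext w; rw [dx, fderiv_comp_toComplex_symm, toComplex_symm_one]
  have hy : dy (fun w => u (toComplex.symm w)) = fun w =>
      (fun y => fderiv ℝ u y (EuclideanSpace.single 1 1)) (toComplex.symm w) := by
    ext w; rw [dy, fderiv_comp_toComplex_symm, toComplex_symm_I]
  rw [lapC, hx, hy, dx, dy,
    fderiv_comp_toComplex_symm (fun y => fderiv ℝ u y (EuclideanSpace.single 0 1)),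
    fderiv_comp_toComplex_symm (fun y => fderiv ℝ u y (EuclideanSpace.single 1 1)),
    toComplex_symm_one, toComplex_symm_I, lap, Fin.sum_univ_two]

lemma norm_fderiv_comp_toComplex_symm (u : Plane → ℝ) (z : ℂ) :
    ‖fderiv ℝ (fun w => u (toComplex.symm w)) z‖ ≤ ‖fderiv ℝ u (toComplex.symm z)‖ := by
  refine ContinuousLinearMap.opNorm_le_bound _ (norm_nonneg _) fun v => ?_
  rw [fderiv_comp_toComplex_symm]
  refine (ContinuousLinearMap.le_opNorm _ _).trans ?_
  rw [LinearIsometryEquiv.norm_map]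

lemma toComplex_image_closure (s : Set Plane) :
    toComplex '' closure s = closure (toComplex '' s) :=
  toComplex.toHomeomorph.image_closure s

lemma mem_toComplex_image {s : Set Plane} {z : ℂ} :
    z ∈ toComplex '' s ↔ toComplex.symm z ∈ s := by
  rw [LinearIsometryEquiv.image_eq_preimage_symm]; rfl

lemma exists_coeffBounds {Ω : Set Plane} (hΩo : IsOpen Ω) (hΩb : Bornology.IsBounded Ω)
    (h0 : (0 : Plane) ∈ Ω) {K : Plane → ℝ} (hK : ContDiffOn ℝ 1 K (closure Ω))
    (hKpos : ∀ x ∈ closure Ω, 0 < K x) :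
    ∃ k₀ k₁ k₂, CoeffBounds (toComplex '' Ω) (fun z => K (toComplex.symm z)) k₀ k₁ k₂ := by
  have hc : IsCompact (closure Ω) := hΩb.isCompact_closure
  have hne : (closure Ω).Nonempty := ⟨0, subset_closure h0⟩
  obtain ⟨a, ha, hmin⟩ := hc.exists_isMinOn hne hK.continuousOn
  obtain ⟨b, hb, hmax⟩ := hc.exists_isMaxOn hne hK.continuousOn
  obtain ⟨C, hC⟩ := exists_fderiv_bound hΩo hc hK
  refine ⟨K a, K b, C, hKpos a ha, ?_, ?_, ?_, ?_⟩ <;> intro z hz <;>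
    rw [mem_toComplex_image] at hz
  · have h1 : ContDiffAt ℝ 1 K (toComplex.symm z) :=
      hK.contDiffAt (mem_of_superset (hΩo.mem_nhds hz) subset_closure)
    exact h1.comp z toComplex.symm.contDiff.contDiffAt
  · exact hmin (subset_closure hz)
  · exact hmax (subset_closure hz)
  · exact (norm_fderiv_comp_toComplex_symm K z).trans (hC _ hz)

lemma exists_collar {Ω : Set Plane} (hΩo : IsOpen Ω) (hΩb : Bornology.IsBounded Ω)
    (hΩsm : SmoothBoundary Ω) (h0 : (0 : Plane) ∈ Ω) {α k₀ k₁ k₂ : ℝ} {K : ℂ → ℝ}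
    (hK : CoeffBounds (toComplex '' Ω) K k₀ k₁ k₂) :
    ∃ r d A B G s, Collar (toComplex '' Ω) (henonV α K) r d A B G s := by
  have hOo : IsOpen (toComplex '' Ω) := toComplex.toHomeomorph.isOpenMap _ hΩo
  have hOb : Bornology.IsBounded (toComplex '' Ω) :=
    toComplex.lipschitz.isBounded_image hΩb
  have h0O : (0 : ℂ) ∈ toComplex '' Ω := ⟨0, h0, map_zero _⟩
  obtain ⟨r, hr, hcone⟩ := exists_hasCone hΩo hΩb hΩsm (ε := 1 / 50) (by norm_num)
  have hcone' := hcone.image toComplex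
  obtain ⟨δ, hδ, hball⟩ := Metric.isOpen_iff.1 hOo 0 h0O
  obtain ⟨A, B, G, hpot⟩ := hK.exists_potBounds hOb (half_pos hδ) α
  have hA := hpot.A_pos
  have hG := hpot.G_pos
  refine ⟨r, δ / 2, A, B, G, min (min (r / 24) (δ / 2 / 24)) (A / (10 * G)), hOo, hOb, ?_, ?_,
    by positivity, ?_, ?_, ?_, hpot⟩
  · intro y hy
    obtain ⟨n, hn, hc⟩ := hcone' y hy
    exact ⟨n, hOo, hy, hn, hc⟩
  · intro y hy
    by_contra hlt
    push Not at hlt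
    have h1 : y ∈ toComplex '' Ω := hball (by rw [mem_ball_zero_iff]; linarith)
    rw [hOo.frontier_eq] at hy
    exact hy.2 h1
  · have := (min_le_left (min (r / 24) (δ / 2 / 24)) (A / (10 * G))).trans (min_le_left _ _)
    linarith
  · have := (min_le_left (min (r / 24) (δ / 2 / 24)) (A / (10 * G))).trans (min_le_right _ _)
    linarith
  · have h1 := min_le_right (min (r / 24) (δ / 2 / 24)) (A / (10 * G))
    have h2 : A / (10 * G) * (G / A) = 1 / 10 := by field_simp
    have h3 := mul_le_mul_of_nonneg_right h1 (div_pos hG hA).le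
    rw [h2] at h3
    linarith

lemma exists_confPair {Ω : Set Plane} (hΩo : IsOpen Ω) (hΩb : Bornology.IsBounded Ω)
    (hΩsc : SimplyConnectedSpace Ω) (h0 : (0 : Plane) ∈ Ω) :
    ∃ ψ φ, ConfPair (toComplex '' Ω) ψ φ := by
  have hOo : IsOpen (toComplex '' Ω) := toComplex.toHomeomorph.isOpenMap _ hΩo
  have hOb : Bornology.IsBounded (toComplex '' Ω) :=
    toComplex.lipschitz.isBounded_image hΩb
  have h0O : (0 : ℂ) ∈ toComplex '' Ω := ⟨0, h0, map_zero _⟩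
  have hOsc : IsSimplyConnected (toComplex '' Ω) :=
    toComplex.toHomeomorph.isEmbedding.isSimplyConnected_image.2 hΩsc
  obtain ⟨f, hf, hsurj⟩ := exists_riemann_map hOo hOsc hOb h0O
  obtain ⟨φ, hφ⟩ := hf.exists_confPair hOo h0O hsurj
  exact ⟨f, φ, hφ⟩

lemma fullSol_comp_toComplex_symm {Ω : Set Plane} (hΩo : IsOpen Ω) {α p : ℝ} (hp : 1 ≤ p)
    {K u : Plane → ℝ} (hc : ContinuousOn u (closure Ω)) (hu : ContDiffOn ℝ 2 u (Ω \ {0}))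
    (hpos : ∀ x ∈ Ω, 0 < u x)
    (heq : ∀ x ∈ Ω \ {0}, -lap u x = ‖x‖ ^ (2 * α) * K x * u x ^ p)
    (hz : ∀ x ∈ frontier Ω, u x = 0) :
    FullSol (toComplex '' Ω) (fun z => u (toComplex.symm z))
      (henonV α fun z => K (toComplex.symm z)) p := by
  have hmem : ∀ z ∈ toComplex '' Ω, z ≠ 0 → toComplex.symm z ∈ Ω \ {0} := fun z hz hz0 =>
    ⟨mem_toComplex_image.1 hz, by simpa using hz0⟩
  refine ⟨hp, ?_, fun z hz => hpos _ (mem_toComplex_image.1 hz), ?_, ?_, ?_⟩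
  · refine hc.comp toComplex.symm.continuous.continuousOn fun z hz => ?_
    rwa [← toComplex_image_closure, mem_toComplex_image] at hz
  · intro z hz1 hz2
    rw [← toComplex_image_closure, mem_toComplex_image] at hz1
    rw [mem_toComplex_image] at hz2
    exact hz _ (by rw [hΩo.frontier_eq]; exact ⟨hz1, hz2⟩)
  · intro z hz hz0
    have h1 : ContDiffAt ℝ 2 u (toComplex.symm z) :=
      hu.contDiffAt ((hΩo.sdiff isClosed_singleton).mem_nhds (hmem z hz hz0))
    exact h1.comp z toComplex.symm.contDiff.contDiffAt
  · intro z hz hz0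
    rw [lapC_comp_toComplex_symm, heq _ (hmem z hz hz0), henonV, LinearIsometryEquiv.norm_map]

end Henon

/-- Uniform mass bound for the Hénon–Lane–Emden problem on a bounded, simply connected
planar domain with smooth boundary. -/
theorem mass_bound_henon (Ω : Set Plane) (hΩo : IsOpen Ω)
    (hΩb : Bornology.IsBounded Ω) (hΩsc : SimplyConnectedSpace Ω)
    (hΩsm : SmoothBoundary Ω) (h0 : (0 : Plane) ∈ Ω)
    (α p₀ : ℝ) (hα : -1 < α) (hp₀ : 1 < p₀)
    (K : Plane → ℝ) (hK : ContDiffOn ℝ 1 K (closure Ω))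
    (hKpos : ∀ x ∈ closure Ω, 0 < K x) :
    ∃ ρ₀ > 0, ∀ (p : ℝ), p₀ ≤ p → ∀ u : Plane → ℝ,
      ContinuousOn u (closure Ω) → ContDiffOn ℝ 2 u (Ω \ {0}) →
      (∀ x ∈ Ω, 0 < u x) →
      (∀ x ∈ Ω \ {0}, -lap u x = ‖x‖ ^ (2 * α) * K x * u x ^ p) →
      (∀ x ∈ frontier Ω, u x = 0) →
      p * ∫ x in Ω, ‖x‖ ^ (2 * α) * K x * u x ^ (p + 1) ≤ ρ₀ := by
  obtain ⟨k₀, k₁, k₂, hKb⟩ := Henon.exists_coeffBounds hΩo hΩb h0 hK hKpos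
  obtain ⟨r, d, A, B, G, s, hcol⟩ := Henon.exists_collar (α := α) hΩo hΩb hΩsm h0 hKb
  obtain ⟨ψ, φ, hP⟩ := Henon.exists_confPair hΩo hΩb hΩsc h0
  obtain ⟨ρ₀, hρ₀, hbound⟩ := Henon.exists_mass_bound hcol hP hKb hα hp₀
  refine ⟨ρ₀, hρ₀, fun p hp u hc hu hpos heq hz => ?_⟩
  have h1 := hbound p hp _
    (Henon.fullSol_comp_toComplex_symm hΩo (hp₀.le.trans hp) hc hu hpos heq hz)
  rw [Henon.toComplex.measurePreserving.setIntegral_image_emb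
    Henon.toComplex.toHomeomorph.measurableEmbedding] at h1
  simpa [Henon.henonV] using h1
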